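/- Let Ω ⊂ ℝ^d (d ≥ 2) be a bounded domain with boundary of class C^{2,γ} and let f ∈ C^∞(cl(Ω)×ℝ×ℝ^d, ℝ). Let p = p(x,t) be a time-periodic classical solution of ∂_t p = Δp + f(x, p, ∇p) on Ω×ℝ with homogeneous Dirichlet boundary condition, with minimal period ω > 0, such that p and ∇p are uniformly bounded on Ω×ℝ. Then there exists a dense open set of points (x₀,t₀) ∈ Ω×ℝ such that: (i) (∂_t p(x₀,t₀), ∇∂_t p(x₀,t₀)) ≠ (0,0), and (ii) for every t ∈ ℝ, if (p(x₀,t), ∇p(x₀,t)) = (p(x₀,t₀), ∇p(x₀,t₀)) then t ∈ t₀ + ωℤ. -/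

import Mathlib

open Set MeasureTheory

/-- The partial derivative of `f` in the `i`-th coordinate direction. -/
noncomputable def pd {d : ℕ} (i : Fin d) (f : (Fin d → ℝ) → ℝ) (x : Fin d → ℝ) : ℝ :=
  fderiv ℝ f x (Pi.single i 1)

/-- The Laplacian of `f`. -/
noncomputable def lap {d : ℕ} (f : (Fin d → ℝ) → ℝ) (x : Fin d → ℝ) : ℝ :=
  ∑ i, pd i (pd i f) x

/-- `Ω` is a domain with boundary of class `C^{2,γ}`: it admits a global defining
function `φ` of class `C²` whose second derivative is `γ`-Hölder continuous, with
nonvanishing gradient on the boundary. -/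
def HasC2HolderBoundary {d : ℕ} (Ω : Set (Fin d → ℝ)) (γ : NNReal) : Prop :=
  ∃ (φ : (Fin d → ℝ) → ℝ) (C : NNReal),
    ContDiff ℝ 2 φ ∧ HolderWith C γ (iteratedFDeriv ℝ 2 φ) ∧
    Ω = {x | φ x < 0} ∧ ∀ x ∈ frontier Ω, fderiv ℝ φ x ≠ 0

/-! ## Space-time setting -/

open Filter Topology

/-- space-time -/
abbrev Esp (d : ℕ) : Type := (Fin d → ℝ) × ℝ

/-- the `i`-th spatial direction -/
def ex {d : ℕ} (i : Fin d) : Esp d := (Pi.single i 1, 0)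

/-- the time direction -/
def et {d : ℕ} : Esp d := (0, 1)

theorem ld_add {E : Type*} [AddCommGroup E] [Module ℝ E] {u u1 : E → ℝ} {a : E}
    (h : ∀ z, HasLineDerivAt ℝ u (u1 z) z a) (y : E) (r : ℝ) :
    HasDerivAt (fun s : ℝ => u (y + s • a)) (u1 (y + r • a)) r := by
  have h0 : HasDerivAt (fun s : ℝ => u (y + r • a + s • a)) (u1 (y + r • a)) (r - r) := by
    rw [sub_self]; exact h (y + r • a)
  have := h0.comp_sub_const r r
  refine this.congr_of_eventuallyEq (Eventually.of_forall fun s => ?_)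
  simp only
  congr 1
  rw [sub_smul]; abel

theorem ld_sub {E : Type*} [AddCommGroup E] [Module ℝ E] {u u1 : E → ℝ} {a : E}
    (h : ∀ z, HasLineDerivAt ℝ u (u1 z) z a) (y : E) (r : ℝ) :
    HasDerivAt (fun s : ℝ => u (y - s • a)) (-u1 (y - r • a)) r := by
  have h0 := (ld_add h y (-r)).comp r (hasDerivAt_neg r)
  simp only [Function.comp_def, neg_smul, ← sub_eq_add_neg, mul_neg, mul_one] at h0
  exact h0

theorem snd_test {f f' : ℝ → ℝ} {c x0 : ℝ} (hf : ∀ᶠ r in 𝓝 x0, HasDerivAt f (f' r) r)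
    (hf' : HasDerivAt f' c x0) (hmax : IsLocalMax f x0) : c ≤ 0 := by
  by_contra hc
  push Not at hc
  have e1 : deriv f =ᶠ[𝓝 x0] f' := hf.mono fun r hr => hr.deriv
  have e2 : deriv (deriv f) x0 = c := by rw [e1.deriv_eq, hf'.deriv]
  have hmin : IsLocalMin f x0 :=
    isLocalMin_of_deriv_deriv_pos (by rw [e2]; exact hc) hmax.deriv_eq_zero
      hf.self_of_nhds.continuousAt
  have hconst : f =ᶠ[𝓝 x0] fun _ => f x0 := by
    filter_upwards [hmax, hmin] with y h1 h2 using le_antisymm h1 h2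
  have e3 : deriv f =ᶠ[𝓝 x0] fun _ => 0 := by
    have := hconst.deriv
    refine this.trans (Eventually.of_forall fun y => by simp)
  have e4 : deriv (deriv f) x0 = 0 := by rw [e3.deriv_eq]; simp
  linarith

open Set MeasureTheory Filter Topology

/-! ## The four point barrier -/

/-- four point mixed difference -/
def fourpt {E : Type*} [AddCommGroup E] [Module ℝ E] (u : E → ℝ) (a b : E) (z : E) (h k : ℝ) : ℝ :=
  u (z + h • a + k • b) - u (z + h • a - k • b) - u (z - h • a + k • b) + u (z - h • a - k • b)

theorem fourpt_deriv_h {E : Type*} [AddCommGroup E] [Module ℝ E] {u u1 : E → ℝ} {a b : E}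
    (h1 : ∀ z, HasLineDerivAt ℝ u (u1 z) z a) (z : E) (h k : ℝ) :
    HasDerivAt (fun r => fourpt u a b z r k)
      (u1 (z + h • a + k • b) - u1 (z + h • a - k • b) + u1 (z - h • a + k • b)
        - u1 (z - h • a - k • b)) h := by
  have A1 := ld_add h1 (z + k • b) h
  have A2 := ld_add h1 (z - k • b) h
  have A3 := ld_sub h1 (z + k • b) h
  have A4 := ld_sub h1 (z - k • b) h
  have := ((A1.sub A2).sub A3).add A4
  have e1 : ∀ r : ℝ, z + r • a + k • b = z + k • b + r • a := fun r => by abel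
  have e2 : ∀ r : ℝ, z + r • a - k • b = z - k • b + r • a := fun r => by abel
  have e3 : ∀ r : ℝ, z - r • a + k • b = z + k • b - r • a := fun r => by abel
  have e4 : ∀ r : ℝ, z - r • a - k • b = z - k • b - r • a := fun r => by abel
  simp only [fourpt, e1, e2, e3, e4]
  exact this.congr_deriv (by ring)

theorem fourpt_deriv_h2 {E : Type*} [AddCommGroup E] [Module ℝ E] {u1 u2 : E → ℝ} {a b : E}
    (h1 : ∀ z, HasLineDerivAt ℝ u1 (u2 z) z a) (z : E) (h k : ℝ) :
    HasDerivAt (fun r => u1 (z + r • a + k • b) - u1 (z + r • a - k • b) + u1 (z - r • a + k • b)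
        - u1 (z - r • a - k • b))
      (fourpt u2 a b z h k) h := by
  have A1 := ld_add h1 (z + k • b) h
  have A2 := ld_add h1 (z - k • b) h
  have A3 := ld_sub h1 (z + k • b) h
  have A4 := ld_sub h1 (z - k • b) h
  have := ((A1.sub A2).add A3).sub A4
  have e1 : ∀ r : ℝ, z + r • a + k • b = z + k • b + r • a := fun r => by abel
  have e2 : ∀ r : ℝ, z + r • a - k • b = z - k • b + r • a := fun r => by abel
  have e3 : ∀ r : ℝ, z - r • a + k • b = z + k • b - r • a := fun r => by abel
  have e4 : ∀ r : ℝ, z - r • a - k • b = z - k • b - r • a := fun r => by abel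
  simp only [fourpt, e1, e2, e3, e4]
  exact this.congr_deriv (by ring)

theorem fourpt_deriv_c {E : Type*} [AddCommGroup E] [Module ℝ E] {u u1 : E → ℝ} {a b c : E}
    (h1 : ∀ z, HasLineDerivAt ℝ u (u1 z) z c) (z : E) (h k s : ℝ) :
    HasDerivAt (fun r : ℝ => fourpt u a b (z + r • c) h k) (fourpt u1 a b (z + s • c) h k) s := by
  have A1 := ld_add h1 (z + h • a + k • b) s
  have A2 := ld_add h1 (z + h • a - k • b) s
  have A3 := ld_add h1 (z - h • a + k • b) s
  have A4 := ld_add h1 (z - h • a - k • b) s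
  have := ((A1.sub A2).sub A3).add A4
  have e1 : ∀ r : ℝ, z + r • c + h • a + k • b = z + h • a + k • b + r • c := fun r => by abel
  have e2 : ∀ r : ℝ, z + r • c + h • a - k • b = z + h • a - k • b + r • c := fun r => by abel
  have e3 : ∀ r : ℝ, z + r • c - h • a + k • b = z - h • a + k • b + r • c := fun r => by abel
  have e4 : ∀ r : ℝ, z + r • c - h • a - k • b = z - h • a - k • b + r • c := fun r => by abel
  simp only [fourpt, e1, e2, e3, e4]
  exact this

theorem fourpt_symm {E : Type*} [AddCommGroup E] [Module ℝ E] (u : E → ℝ) (a b : E) (z : E)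
    (h k : ℝ) : fourpt u a b z h k = fourpt u b a z k h := by
  have e1 : z + h • a + k • b = z + k • b + h • a := by abel
  have e2 : z + h • a - k • b = z - k • b + h • a := by abel
  have e3 : z - h • a + k • b = z + k • b - h • a := by abel
  have e4 : z - h • a - k • b = z - k • b - h • a := by abel
  simp only [fourpt, e1, e2, e3, e4]; ring

/-- Lipschitz bound along a line -/
theorem ld_lip {E : Type*} [AddCommGroup E] [Module ℝ E] {u u1 : E → ℝ} {a : E} {R : ℝ}
    (h1 : ∀ z, HasLineDerivAt ℝ u (u1 z) z a) (hR : ∀ z, |u1 z| ≤ R) (y : E) (r s : ℝ) :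
    |u (y + r • a) - u (y + s • a)| ≤ R * |r - s| := by
  have := Convex.norm_image_sub_le_of_norm_hasDerivWithin_le (f := fun s : ℝ => u (y + s • a))
    (f' := fun s : ℝ => u1 (y + s • a)) (s := univ) (C := R) (x := s) (y := r)
    (fun x _ => (ld_add h1 y x).hasDerivWithinAt) (fun x _ => by simpa using hR _) convex_univ
    (mem_univ _) (mem_univ _)
  simpa using this

theorem fourpt_le_lin {E : Type*} [AddCommGroup E] [Module ℝ E] {u u1 : E → ℝ} {a b : E} {R : ℝ}
    (h1 : ∀ z, HasLineDerivAt ℝ u (u1 z) z b) (hR : ∀ z, |u1 z| ≤ R) (z : E) (h k : ℝ)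
    (hk : 0 ≤ k) : fourpt u a b z h k ≤ 4 * R * k := by
  have A := ld_lip h1 hR (z + h • a) k (-k)
  have B := ld_lip h1 hR (z - h • a) k (-k)
  have e : |k - -k| = 2 * k := by rw [abs_of_nonneg] <;> linarith
  rw [e] at A B
  simp only [neg_smul, ← sub_eq_add_neg] at A B
  have := abs_le.1 A
  have := abs_le.1 B
  unfold fourpt
  linarith

theorem barrier {d : ℕ} {ω : ℝ} (hω : 0 < ω) {u : Esp d → ℝ} {u1 u2 : Fin d → Esp d → ℝ}
    {ut G : Esp d → ℝ} (hc : Continuous u) (hper : ∀ z, u (z + ω • et) = u z) {N R : ℝ}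
    (hsupp : ∀ z : Esp d, N < ‖z.1‖ → u z = 0)
    (h1 : ∀ i z, HasLineDerivAt ℝ u (u1 i z) z (ex i))
    (h2 : ∀ i z, HasLineDerivAt ℝ (u1 i) (u2 i z) z (ex i))
    (ht : ∀ z, HasLineDerivAt ℝ u (ut z) z et)
    (heq : ∀ z, ut z = ∑ i, u2 i z + G z)
    (hR : ∀ i z, |u1 i z| ≤ R) (i j : Fin d)
    {ψ ψ1 ψ11 m : ℝ → ℝ → ℝ} (hψc : Continuous fun q : ℝ × ℝ => ψ q.1 q.2)
    (hψs : ∀ h k, ψ h k = ψ k h)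
    (hψ0 : ∀ h k, 0 ≤ h → h ≤ 1 → 0 ≤ k → k ≤ 1 → 0 ≤ ψ h k)
    (hψb : ∀ k, 0 ≤ k → k ≤ 1 → 4 * R * k ≤ ψ 1 k)
    (hψ1 : ∀ h k, 0 < h → h < 1 → 0 < k → k < 1 → HasDerivAt (fun r => ψ r k) (ψ1 h k) h)
    (hψ11 : ∀ h k, 0 < h → h < 1 → 0 < k → k < 1 → HasDerivAt (fun r => ψ1 r k) (ψ11 h k) h)
    (hm : ∀ h k, 0 < h → h < 1 → 0 < k → k < 1 → 0 ≤ m h k)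
    (hG : ∀ z h k, 0 < h → h < 1 → 0 < k → k < 1 → fourpt G (ex i) (ex j) z h k ≤ m h k)
    (hψm : ∀ h k, 0 < h → h < 1 → 0 < k → k < 1 → ψ11 h k + ψ11 k h < - 2 * m h k)
    (z : Esp d) (h k : ℝ) (hh0 : 0 ≤ h) (hh1 : h ≤ 1) (hk0 : 0 ≤ k) (hk1 : k ≤ 1) :
    fourpt u (ex i) (ex j) z h k ≤ ψ h k := by
  classical
  by_contra hcon
  push Not at hcon
  set a : Esp d := ex i with ha
  set b : Esp d := ex j with hb
  let Φ : Esp d × ℝ × ℝ → ℝ := fun q => fourpt u a b q.1 q.2.1 q.2.2 - ψ q.2.1 q.2.2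
  have hΦc : Continuous Φ := by
    have : Continuous fun q : Esp d × ℝ × ℝ => ψ q.2.1 q.2.2 := hψc.comp continuous_snd
    unfold Φ fourpt
    fun_prop
  -- periodicity
  have hperz : ∀ (y : Esp d) (n : ℤ), u (y + ((n : ℝ) * ω) • et) = u y := by
    intro y n
    have hP : Function.Periodic (fun s : ℝ => u (y + s • et)) ω := by
      intro s
      have := hper (y + s • et)
      simpa [add_smul, add_assoc] using this
    have := hP.int_mul n 0
    simpa using this
  have hperΦ : ∀ (y : Esp d) (n : ℤ) (h k : ℝ), Φ (y + ((n : ℝ) * ω) • et, h, k) = Φ (y, h, k) := by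
    intro y n h k
    have e1 : ∀ v w : Esp d, y + ((n : ℝ) * ω) • et + v + w = y + v + w + ((n : ℝ) * ω) • et :=
      fun v w => by abel
    simp only [Φ, fourpt, sub_eq_add_neg, e1, hperz]
  -- outside
  have hnormex : ∀ l : Fin d, ‖(ex l : Esp d).1‖ ≤ 1 := by
    intro l
    simp only [ex]
    refine (pi_norm_le_iff_of_nonneg zero_le_one).2 fun m => ?_
    by_cases hlm : m = l
    · subst hlm; simp
    · simp [hlm]
  have hout : ∀ (y : Esp d) (h k : ℝ), 0 ≤ h → h ≤ 1 → 0 ≤ k → k ≤ 1 → N + 2 < ‖y.1‖ →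
      fourpt u a b y h k = 0 := by
    intro y h k hh0 hh1 hk0 hk1 hy
    have key : ∀ s r : ℝ, |s| ≤ 1 → |r| ≤ 1 → u (y + s • a + r • b) = 0 := by
      intro s r hs hr
      apply hsupp
      have t1 : ‖y.1‖ ≤ ‖(y + s • a + r • b).1‖ + ‖s • a.1‖ + ‖r • b.1‖ := by
        have : y.1 = (y + s • a + r • b).1 - s • a.1 - r • b.1 := by
          simp only [Prod.fst_add, Prod.smul_fst]
          abel
        calc ‖y.1‖ = ‖(y + s • a + r • b).1 - s • a.1 - r • b.1‖ := by rw [← this]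
          _ ≤ _ := (norm_sub_le _ _).trans (add_le_add_left (norm_sub_le _ _) _)
      have t2 : ‖s • a.1‖ ≤ 1 := by
        rw [norm_smul]; exact mul_le_one₀ hs (norm_nonneg _) (hnormex i)
      have t3 : ‖r • b.1‖ ≤ 1 := by
        rw [norm_smul]; exact mul_le_one₀ hr (norm_nonneg _) (hnormex j)
      linarith
    have ah : |h| ≤ 1 := abs_le.2 ⟨by linarith, hh1⟩
    have ak : |k| ≤ 1 := abs_le.2 ⟨by linarith, hk1⟩
    have k1 := key h k ah ak
    have k2 := key h (-k) ah (by simpa using ak)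
    have k3 := key (-h) k (by simpa using ah) ak
    have k4 := key (-h) (-k) (by simpa using ah) (by simpa using ak)
    simp only [neg_smul, ← sub_eq_add_neg] at k1 k2 k3 k4
    simp [fourpt, k1, k2, k3, k4]
  let K : Set (Esp d × ℝ × ℝ) :=
    (Metric.closedBall 0 (N + 2) ×ˢ Icc 0 ω) ×ˢ (Icc 0 1 ×ˢ Icc 0 1)
  have hK : IsCompact K :=
    ((isCompact_closedBall _ _).prod isCompact_Icc).prod (isCompact_Icc.prod isCompact_Icc)
  -- reduction of any point with positive value to K
  have hred : ∀ (y : Esp d) (h k : ℝ), 0 ≤ h → h ≤ 1 → 0 ≤ k → k ≤ 1 → 0 < Φ (y, h, k) →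
      ∃ q ∈ K, Φ q = Φ (y, h, k) := by
    intro y h k hh0 hh1 hk0 hk1 hpos
    refine ⟨(y + (((-⌊y.2 / ω⌋ : ℤ) : ℝ) * ω) • et, h, k), ⟨⟨?_, ?_⟩, ⟨hh0, hh1⟩, ⟨hk0, hk1⟩⟩, hperΦ _ _ _ _⟩
    · by_contra hy
      rw [mem_closedBall_zero_iff] at hy
      simp [et] at hy
      have := hout y h k hh0 hh1 hk0 hk1 hy
      have h3 := hψ0 h k hh0 hh1 hk0 hk1
      simp only [Φ, this] at hpos
      linarith
    · have f1 := Int.floor_le (y.2 / ω)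
      have f2 := Int.lt_floor_add_one (y.2 / ω)
      rw [le_div_iff₀ hω] at f1
      rw [div_lt_iff₀ hω] at f2
      simp only [et, Prod.snd_add, Prod.smul_snd, smul_eq_mul, mem_Icc]
      push_cast
      constructor <;> nlinarith
  have hpos : 0 < Φ (z, h, k) := by simp only [Φ]; linarith
  obtain ⟨q0, hq0K, hq0⟩ := hred z h k hh0 hh1 hk0 hk1 hpos
  obtain ⟨q, hqK, hqmax⟩ := hK.exists_isMaxOn ⟨q0, hq0K⟩ hΦc.continuousOn
  have hqpos : 0 < Φ q := lt_of_lt_of_le (by rw [hq0]; exact hpos) (hqmax hq0K)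
  have hglob : ∀ (y : Esp d) (h k : ℝ), 0 ≤ h → h ≤ 1 → 0 ≤ k → k ≤ 1 → Φ (y, h, k) ≤ Φ q := by
    intro y h k hh0 hh1 hk0 hk1
    by_cases hp : 0 < Φ (y, h, k)
    · obtain ⟨q', hq'K, hq'⟩ := hred y h k hh0 hh1 hk0 hk1 hp
      rw [← hq']; exact hqmax hq'K
    · linarith
  clear hred hq0 hq0K
  obtain ⟨y, h', k'⟩ := q
  obtain ⟨-, ⟨hh0', hh1'⟩, ⟨hk0', hk1'⟩⟩ := hqK
  simp only at hh0' hh1' hk0' hk1'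
  -- interior
  have p1 : h' ≠ 0 := by
    rintro rfl
    have := hψ0 0 k' le_rfl zero_le_one hk0' hk1'
    simp only [Φ, fourpt, zero_smul, add_zero, sub_zero] at hqpos
    linarith
  have p2 : k' ≠ 0 := by
    rintro rfl
    have := hψ0 h' 0 hh0' hh1' le_rfl zero_le_one
    simp only [Φ, fourpt, zero_smul, add_zero, sub_zero] at hqpos
    linarith
  have p3 : h' ≠ 1 := by
    rintro rfl
    have := fourpt_le_lin (a := a) (h1 j) (hR j) y 1 k' hk0'
    have := hψb k' hk0' hk1'
    simp only [Φ] at hqpos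
    linarith
  have p4 : k' ≠ 1 := by
    rintro rfl
    have := fourpt_le_lin (a := b) (h1 i) (hR i) y 1 h' hh0'
    have := hψb h' hh0' hh1'
    have := fourpt_symm u a b y h' 1
    have := hψs h' 1
    simp only [Φ] at hqpos
    linarith
  have hh0'' := lt_of_le_of_ne hh0' p1.symm
  have hk0'' := lt_of_le_of_ne hk0' p2.symm
  have hh1'' := lt_of_le_of_ne hh1' p3
  have hk1'' := lt_of_le_of_ne hk1' p4
  -- time derivative
  have T : fourpt ut a b y h' k' = 0 := by
    have hd := fourpt_deriv_c (a := a) (b := b) ht y h' k' 0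
    simp only [zero_smul, add_zero] at hd
    refine IsLocalMax.hasDerivAt_eq_zero ?_ hd
    refine Eventually.of_forall fun r => ?_
    have := hglob (y + r • et) h' k' hh0' hh1' hk0' hk1'
    simp only [Φ] at this
    simp only [zero_smul, add_zero]
    linarith
  -- space derivatives
  have X : ∀ l, fourpt (u2 l) a b y h' k' ≤ 0 := by
    intro l
    have hd2 := fourpt_deriv_c (a := a) (b := b) (h2 l) y h' k' 0
    simp only [zero_smul, add_zero] at hd2
    refine snd_test (f := fun r => fourpt u a b (y + r • ex l) h' k') (x0 := 0)
      (f' := fun r => fourpt (u1 l) a b (y + r • ex l) h' k')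
      (Eventually.of_forall fun r => fourpt_deriv_c (h1 l) y h' k' r) hd2 ?_
    refine Eventually.of_forall fun r => ?_
    have := hglob (y + r • ex l) h' k' hh0' hh1' hk0' hk1'
    simp only [Φ] at this
    simp only [zero_smul, add_zero]
    linarith
  have Hh : fourpt (u2 i) a b y h' k' ≤ ψ11 h' k' := by
    have key := snd_test (f := fun r => fourpt u a b y r k' - ψ r k') (x0 := h')
      (f' := fun r => (u1 i (y + r • a + k' • b) - u1 i (y + r • a - k' • b)
        + u1 i (y - r • a + k' • b) - u1 i (y - r • a - k' • b)) - ψ1 r k')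
      (c := fourpt (u2 i) a b y h' k' - ψ11 h' k') ?_ ?_ ?_
    · linarith
    · filter_upwards [Ioo_mem_nhds hh0'' hh1''] with r hr
      exact (fourpt_deriv_h (h1 i) y r k').sub (hψ1 r k' hr.1 hr.2 hk0'' hk1'')
    · exact (fourpt_deriv_h2 (h2 i) y h' k').sub (hψ11 h' k' hh0'' hh1'' hk0'' hk1'')
    · filter_upwards [Ioo_mem_nhds hh0'' hh1''] with r hr
      exact hglob y r k' hr.1.le hr.2.le hk0' hk1'
  have Hk : fourpt (u2 j) a b y h' k' ≤ ψ11 k' h' := by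
    rw [fourpt_symm]
    have key := snd_test (f := fun r => fourpt u b a y r h' - ψ r h') (x0 := k')
      (f' := fun r => (u1 j (y + r • b + h' • a) - u1 j (y + r • b - h' • a)
        + u1 j (y - r • b + h' • a) - u1 j (y - r • b - h' • a)) - ψ1 r h')
      (c := fourpt (u2 j) b a y k' h' - ψ11 k' h') ?_ ?_ ?_
    · linarith
    · filter_upwards [Ioo_mem_nhds hk0'' hk1''] with r hr
      exact (fourpt_deriv_h (h1 j) y r h').sub (hψ1 r h' hr.1 hr.2 hh0'' hh1'')
    · exact (fourpt_deriv_h2 (h2 j) y k' h').sub (hψ11 k' h' hk0'' hk1'' hh0'' hh1'')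
    · filter_upwards [Ioo_mem_nhds hk0'' hk1''] with r hr
      have := hglob y h' r hh0' hh1' hr.1.le hr.2.le
      simp only [Φ] at this
      rw [fourpt_symm u b a y r h', fourpt_symm u b a y k' h', hψs r h', hψs k' h']
      exact this
  have E : fourpt ut a b y h' k' = ∑ l, fourpt (u2 l) a b y h' k' + fourpt G a b y h' k' := by
    simp only [fourpt, heq, Finset.sum_add_distrib, Finset.sum_sub_distrib]
    ring
  have hGm := hG y h' k' hh0'' hh1'' hk0'' hk1''
  have hmm := hm h' k' hh0'' hh1'' hk0'' hk1''
  have hpm := hψm h' k' hh0'' hh1'' hk0'' hk1''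
  have S : 2 * ∑ l, fourpt (u2 l) a b y h' k' ≤
      fourpt (u2 i) a b y h' k' + fourpt (u2 j) a b y h' k' := by
    have Si : ∑ l, fourpt (u2 l) a b y h' k' ≤ fourpt (u2 i) a b y h' k' := by
      rw [← Finset.add_sum_erase _ _ (Finset.mem_univ i)]
      have := Finset.sum_nonpos (s := Finset.univ.erase i) (fun l _ => X l)
      linarith
    have Sj : ∑ l, fourpt (u2 l) a b y h' k' ≤ fourpt (u2 j) a b y h' k' := by
      rw [← Finset.add_sum_erase _ _ (Finset.mem_univ j)]
      have := Finset.sum_nonpos (s := Finset.univ.erase j) (fun l _ => X l)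
      linarith
    linarith
  linarith

open Set MeasureTheory Filter Topology

/-! ## Interior regularity by barriers -/

/-- a compactly supported (in space), periodic solution of the heat equation with right side -/
structure Sol {d : ℕ} (ω N R : ℝ) (u : Esp d → ℝ) (u1 u2 : Fin d → Esp d → ℝ)
    (ut G : Esp d → ℝ) : Prop where
  hω : 0 < ω
  hc : Continuous u
  hper : ∀ z, u (z + ω • et) = u z
  hsupp : ∀ z : Esp d, N < ‖z.1‖ → u z = 0
  h1 : ∀ i z, HasLineDerivAt ℝ u (u1 i z) z (ex i)
  h2 : ∀ i z, HasLineDerivAt ℝ (u1 i) (u2 i z) z (ex i)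
  ht : ∀ z, HasLineDerivAt ℝ u (ut z) z et
  heq : ∀ z, ut z = ∑ i, u2 i z + G z
  hR : ∀ i z, |u1 i z| ≤ R

theorem HasLineDerivAt.neg' {E : Type*} [AddCommGroup E] [Module ℝ E] {u : E → ℝ} {c : ℝ} {z a : E}
    (h : HasLineDerivAt ℝ u c z a) : HasLineDerivAt ℝ (fun z => -u z) (-c) z a := by
  unfold HasLineDerivAt at *
  exact h.fun_neg

theorem fourpt_neg {E : Type*} [AddCommGroup E] [Module ℝ E] (u : E → ℝ) (a b : E) (z : E)
    (h k : ℝ) : fourpt (fun z => -u z) a b z h k = - fourpt u a b z h k := by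
  unfold fourpt; ring

theorem Sol.neg {d : ℕ} {ω N R : ℝ} {u : Esp d → ℝ} {u1 u2 : Fin d → Esp d → ℝ}
    {ut G : Esp d → ℝ} (S : Sol ω N R u u1 u2 ut G) :
    Sol ω N R (fun z => -u z) (fun i z => -u1 i z) (fun i z => -u2 i z) (fun z => -ut z)
      (fun z => - G z) where
  hω := S.hω
  hc := S.hc.neg
  hper z := by rw [S.hper]
  hsupp z hz := by rw [S.hsupp z hz, neg_zero]
  h1 i z := (S.h1 i z).neg'
  h2 i z := (S.h2 i z).neg'
  ht z := (S.ht z).neg'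
  heq z := by rw [S.heq]; simp; ring
  hR i z := by rw [abs_neg]; exact S.hR i z

theorem neg_log_le {h : ℝ} (h0 : 0 ≤ h) : h * Real.negMulLog h ≤ 2 * (h * √h) := by
  rcases h0.eq_or_lt with rfl | h0
  · simp
  have hs : 0 < √h := Real.sqrt_pos.2 h0
  have h1 : Real.log ((√h)⁻¹) ≤ (√h)⁻¹ - 1 := Real.log_le_sub_one_of_pos (inv_pos.2 hs)
  rw [Real.log_inv, Real.log_sqrt h0.le] at h1
  have h2 : - Real.log h ≤ 2 * (√h)⁻¹ := by linarith
  have h3 : h = √h * √h := (Real.mul_self_sqrt h0.le).symm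
  have h4 : Real.negMulLog h ≤ 2 * √h := by
    unfold Real.negMulLog
    calc -h * Real.log h = h * (- Real.log h) := by ring
      _ ≤ h * (2 * (√h)⁻¹) := by gcongr
      _ = 2 * √h := by
        nth_rewrite 1 [h3]; field_simp
  nlinarith

theorem sol_stepA_one {d : ℕ} {ω N R M : ℝ} {u : Esp d → ℝ} {u1 u2 : Fin d → Esp d → ℝ}
    {ut G : Esp d → ℝ} (S : Sol ω N R u u1 u2 ut G) (hM : ∀ z, |G z| ≤ M) (i j : Fin d)
    (z : Esp d) (h : ℝ) (h0 : 0 ≤ h) (h1 : h ≤ 1) :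
    fourpt u (ex i) (ex j) z h h ≤ (4 * R + 4 * (4 * M + 1)) * (h * √h) := by
  have hM0 : 0 ≤ M := (abs_nonneg _).trans (hM 0)
  have hR0 : 0 ≤ R := (abs_nonneg _).trans (S.hR i 0)
  have key := barrier S.hω S.hc S.hper S.hsupp S.h1 S.h2 S.ht S.heq S.hR i j
    (ψ := fun h k => 4 * R * (h * k) + (4 * M + 1) * (k * Real.negMulLog h + h * Real.negMulLog k))
    (ψ1 := fun h k => 4 * R * k + (4 * M + 1) * (k * (- Real.log h - 1) + Real.negMulLog k))
    (ψ11 := fun h k => (4 * M + 1) * (k * (- h⁻¹)))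
    (m := fun _ _ => 4 * M) ?_ ?_ ?_ ?_ ?_ ?_ ?_ ?_ ?_ z h h h0 h1 h0 h1
  · refine key.trans ?_
    have e1 : h ≤ √h := by
      exact Real.le_sqrt_of_sq_le (by nlinarith)
    have e2 := neg_log_le h0
    have e3 : h * h ≤ h * √h := by gcongr
    nlinarith
  · have := Real.continuous_negMulLog
    fun_prop
  · intro h k; ring
  · intro h k h0 h1 k0 k1
    have := Real.negMulLog_nonneg h0 h1
    have := Real.negMulLog_nonneg k0 k1
    positivity
  · intro k k0 k1
    have := Real.negMulLog_nonneg k0 k1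
    simp only [Real.negMulLog_one]
    nlinarith
  · intro h k h0 h1 k0 k1
    have := Real.hasDerivAt_negMulLog h0.ne'
    have e := (((hasDerivAt_id h).mul_const k).const_mul (4 * R)).add
      (((this.const_mul k).add ((hasDerivAt_id h).mul_const (Real.negMulLog k))).const_mul (4 * M + 1))
    exact e.congr_deriv (by ring)
  · intro h k h0 h1 k0 k1
    have e := (((((Real.hasDerivAt_log h0.ne').neg.sub_const 1).const_mul k).add_const
      (Real.negMulLog k)).const_mul (4 * M + 1)).const_add (4 * R * k)
    exact e.congr_deriv (by ring)
  · intro h k _ _ _ _; positivity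
  · intro z h k _ _ _ _
    unfold fourpt
    have := fun y => abs_le.1 (hM y)
    linarith [(this (z + h • ex i + k • ex j)).2, (this (z + h • ex i - k • ex j)).1,
      (this (z - h • ex i + k • ex j)).1, (this (z - h • ex i - k • ex j)).2]
  · intro h k h0 h1 k0 k1
    have e : 2 ≤ k * h⁻¹ + h * k⁻¹ := by
      have : k * h⁻¹ + h * k⁻¹ - 2 = (k - h) ^ 2 * (h⁻¹ * k⁻¹) := by
        field_simp; ring
      have : 0 ≤ (k - h) ^ 2 * (h⁻¹ * k⁻¹) := by positivity
      linarith
    nlinarith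

theorem sol_stepA {d : ℕ} {ω N R M : ℝ} {u : Esp d → ℝ} {u1 u2 : Fin d → Esp d → ℝ}
    {ut G : Esp d → ℝ} (S : Sol ω N R u u1 u2 ut G) (hM : ∀ z, |G z| ≤ M) (i j : Fin d)
    (z : Esp d) (h : ℝ) (h0 : 0 ≤ h) (h1 : h ≤ 1) :
    |fourpt u (ex i) (ex j) z h h| ≤ (4 * R + 4 * (4 * M + 1)) * (h * √h) := by
  refine abs_le.2 ⟨?_, sol_stepA_one S hM i j z h h0 h1⟩
  have := sol_stepA_one S.neg (M := M) (fun z => by rw [abs_neg]; exact hM z) i j z h h0 h1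
  rw [fourpt_neg] at this
  linarith

/-- dyadic Taylor lemma -/
theorem dyadic_taylor {f : ℝ → ℝ} {f0 C : ℝ} (hC : 0 ≤ C) (hf : HasDerivAt f f0 0)
    (hd : ∀ h, 0 ≤ h → h ≤ 1 → |f h - 2 * f (h / 2) + f 0| ≤ C * (h * √h)) (h : ℝ) (h0 : 0 ≤ h)
    (h1 : h ≤ 1) : |f h - f 0 - h * f0| ≤ 4 * C * (h * √h) := by
  rcases h0.eq_or_lt with rfl | h0
  · simp
  let E : ℝ → ℝ := fun h => f h - f 0 - h * f0
  let q : ℝ → ℝ := fun h => |E h| - 4 * C * (h * √h)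
  have hq : ∀ h, 0 ≤ h → h ≤ 1 → q h ≤ 2 * q (h / 2) := by
    intro h h0 h1
    have e1 := hd h h0 h1
    have e2 : E h = 2 * E (h / 2) + (f h - 2 * f (h / 2) + f 0) := by simp only [E]; ring
    have e3 : |E h| ≤ 2 * |E (h / 2)| + C * (h * √h) := by
      rw [e2]
      refine (abs_add_le _ _).trans ?_
      rw [abs_mul, abs_two]; linarith
    have e4 : √(h / 2) ≤ 3 / 4 * √h := by
      rw [Real.sqrt_le_left (by positivity), mul_pow, Real.sq_sqrt h0]
      linarith
    have e5 : C * h * √(h / 2) ≤ C * h * (3 / 4 * √h) := by gcongr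
    simp only [q]
    nlinarith
  have hqn : ∀ n : ℕ, q h ≤ 2 ^ n * q (h / 2 ^ n) := by
    intro n
    induction n with
    | zero => simp
    | succ n ih =>
      refine ih.trans ?_
      have := hq (h / 2 ^ n) (by positivity) ((div_le_self h0.le (one_le_pow₀ (by norm_num))).trans h1)
      rw [pow_succ, mul_assoc, ← div_div]
      gcongr
  have hlim : Tendsto (fun n : ℕ => 2 ^ n * |E (h / 2 ^ n)|) atTop (𝓝 0) := by
    have ho : Tendsto (fun n : ℕ => h / 2 ^ n) atTop (𝓝[≠] 0) := by
      refine tendsto_nhdsWithin_iff.2 ⟨?_, Eventually.of_forall fun n => ?_⟩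
      · exact tendsto_const_nhds.div_atTop (tendsto_pow_atTop_atTop_of_one_lt (by norm_num))
      · exact (by positivity : 0 < h / 2 ^ n).ne'
    have := ((hasDerivAt_iff_tendsto_slope.1 hf).comp ho)
    have t2 := ((this.sub_const f0).abs.const_mul h)
    rw [sub_self, abs_zero, mul_zero] at t2
    refine t2.congr fun n => ?_
    simp only [Function.comp, E, slope_def_field, sub_zero]
    have hp : (0 : ℝ) < 2 ^ n := by positivity
    have : f (h / 2 ^ n) - f 0 - h / 2 ^ n * f0 = ((f (h / 2 ^ n) - f 0) / (h / 2 ^ n) - f0) * (h / 2 ^ n) := by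
      field_simp
    rw [this, abs_mul, abs_of_pos (show 0 < h / 2 ^ n by positivity)]
    field_simp
  have : q h ≤ 0 := by
    refine ge_of_tendsto hlim (Eventually.of_forall fun n => (hqn n).trans ?_)
    have : 0 ≤ 4 * C * (h / 2 ^ n * √(h / 2 ^ n)) := by positivity
    simp only [q]
    gcongr
    linarith
  simp only [q, E] at this
  linarith

theorem sol_taylor {d : ℕ} {ω N R M : ℝ} {u : Esp d → ℝ} {u1 u2 : Fin d → Esp d → ℝ}
    {ut G : Esp d → ℝ} (S : Sol ω N R u u1 u2 ut G) (hM : ∀ z, |G z| ≤ M) (j : Fin d)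
    (z : Esp d) (h : ℝ) (h0 : 0 ≤ h) (h1 : h ≤ 1) :
    |u (z + h • ex j) - u z - h * u1 j z| ≤ 4 * (4 * R + 4 * (4 * M + 1)) * (h * √h) := by
  have hM0 : 0 ≤ M := (abs_nonneg _).trans (hM 0)
  have hR0 : 0 ≤ R := (abs_nonneg _).trans (S.hR j 0)
  have := dyadic_taylor (f := fun r => u (z + r • ex j)) (f0 := u1 j z)
    (C := 4 * R + 4 * (4 * M + 1)) (by positivity) (S.h1 j z) ?_ h h0 h1
  · simpa using this
  · intro h h0 h1
    have e := sol_stepA S hM j j (z + (h / 2) • ex j) (h / 4) (by positivity) (by linarith)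
    have e1 : z + (h / 2) • ex j + (h / 4) • ex j + (h / 4) • ex j = z + h • ex j := by module
    have e2 : z + (h / 2) • ex j + (h / 4) • ex j - (h / 4) • ex j = z + (h / 2) • ex j := by module
    have e3 : z + (h / 2) • ex j - (h / 4) • ex j + (h / 4) • ex j = z + (h / 2) • ex j := by module
    have e4 : z + (h / 2) • ex j - (h / 4) • ex j - (h / 4) • ex j = z + (0 : ℝ) • ex j := by module
    unfold fourpt at e
    rw [e1, e2, e3, e4] at e
    have e5 : √(h / 4) ≤ √h := Real.sqrt_le_sqrt (by linarith)
    have e6 : h / 4 * √(h / 4) ≤ h * √h := by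
      apply mul_le_mul (by linarith) e5 (Real.sqrt_nonneg _) h0
    have e7 : (4 * R + 4 * (4 * M + 1)) * (h / 4 * √(h / 4)) ≤ (4 * R + 4 * (4 * M + 1)) * (h * √h) := by
      gcongr
    refine le_trans (le_of_eq ?_) (e.trans e7)
    congr 1; ring

theorem sol_cont {d : ℕ} {ω N R M : ℝ} {u : Esp d → ℝ} {u1 u2 : Fin d → Esp d → ℝ}
    {ut G : Esp d → ℝ} (S : Sol ω N R u u1 u2 ut G) (hM : ∀ z, |G z| ≤ M) (j : Fin d) :
    Continuous (u1 j) := by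
  have hM0 : 0 ≤ M := (abs_nonneg _).trans (hM 0)
  have hR0 : 0 ≤ R := (abs_nonneg _).trans (S.hR j 0)
  set C := 4 * (4 * R + 4 * (4 * M + 1)) with hC
  have hC0 : 0 ≤ C := by positivity
  let hn : ℕ → ℝ := fun n => 1 / ((n : ℝ) + 1)
  have hn0 : ∀ n, 0 < hn n := fun n => by positivity
  have hn1 : ∀ n, hn n ≤ 1 := fun n => by
    simp only [hn]; rw [div_le_one (by positivity)]; linarith [n.cast_nonneg (α := ℝ)]
  have hlim : Tendsto (fun n => C * √(hn n)) atTop (𝓝 0) := by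
    have := (Real.continuous_sqrt.tendsto 0).comp tendsto_one_div_add_atTop_nhds_zero_nat
    simpa [hn, Function.comp_def] using this.const_mul C
  have hu : TendstoUniformly (fun n z => (u (z + hn n • ex j) - u z) / hn n) (u1 j) atTop := by
    rw [Metric.tendstoUniformly_iff]
    intro ε hε
    filter_upwards [hlim.eventually_lt_const hε] with n hn' z
    refine lt_of_le_of_lt ?_ hn'
    have := sol_taylor S hM j z (hn n) (hn0 n).le (hn1 n)
    rw [dist_comm, Real.dist_eq]
    have e : (u (z + hn n • ex j) - u z) / hn n - u1 j z
      = (u (z + hn n • ex j) - u z - hn n * u1 j z) / hn n := by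
        have := (hn0 n).ne'
        field_simp
    rw [e, abs_div, abs_of_pos (hn0 n), div_le_iff₀ (hn0 n)]
    linarith
  refine hu.continuous (Eventually.of_forall fun n => ?_).frequently
  have := S.hc
  fun_prop

theorem sol_holder {d : ℕ} {ω N R M : ℝ} {u : Esp d → ℝ} {u1 u2 : Fin d → Esp d → ℝ}
    {ut G : Esp d → ℝ} (S : Sol ω N R u u1 u2 ut G) (hM : ∀ z, |G z| ≤ M) (i j : Fin d)
    (z : Esp d) (h : ℝ) (h0 : 0 ≤ h) (h1 : h ≤ 1) :
    |u1 j (z + h • ex i) - u1 j z| ≤ 9 * (4 * R + 4 * (4 * M + 1)) * √h := by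
  have hM0 : 0 ≤ M := (abs_nonneg _).trans (hM 0)
  have hR0 : 0 ≤ R := (abs_nonneg _).trans (S.hR j 0)
  set C := 4 * R + 4 * (4 * M + 1) with hC
  have hC0 : 0 ≤ C := by positivity
  rcases h0.eq_or_lt with rfl | h0
  · simp
  have t1 := sol_taylor S hM j z h h0.le h1
  have t2 := sol_taylor S hM j (z + h • ex i) h h0.le h1
  have e := sol_stepA S hM i j (z + (h / 2) • ex i + (h / 2) • ex j) (h / 2) (by positivity) (by linarith)
  rw [← hC] at t1 t2 e
  have e1 : z + (h / 2) • ex i + (h / 2) • ex j + (h / 2) • ex i + (h / 2) • ex j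
    = z + h • ex i + h • ex j := by module
  have e2 : z + (h / 2) • ex i + (h / 2) • ex j + (h / 2) • ex i - (h / 2) • ex j
    = z + h • ex i := by module
  have e3 : z + (h / 2) • ex i + (h / 2) • ex j - (h / 2) • ex i + (h / 2) • ex j
    = z + h • ex j := by module
  have e4 : z + (h / 2) • ex i + (h / 2) • ex j - (h / 2) • ex i - (h / 2) • ex j = z := by module
  unfold fourpt at e
  rw [e1, e2, e3, e4] at e
  have e5 : √(h / 2) ≤ √h := Real.sqrt_le_sqrt (by linarith)
  have e6 : h / 2 * √(h / 2) ≤ h * √h := by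
    apply mul_le_mul (by linarith) e5 (Real.sqrt_nonneg _) h0.le
  have e7 : C * (h / 2 * √(h / 2)) ≤ C * (h * √h) := by gcongr
  have e8 := e.trans e7
  rw [abs_le] at t1 t2 e8
  have : |h * (u1 j (z + h • ex i) - u1 j z)| ≤ h * (9 * C * √h) := by
    rw [abs_le]
    constructor <;> nlinarith
  rw [abs_mul, abs_of_pos h0] at this
  exact le_of_mul_le_mul_left this h0

open Set MeasureTheory Filter Topology

theorem hasDerivAt_mul_sqrt {h : ℝ} (h0 : 0 < h) :
    HasDerivAt (fun h => h * √h) (3 / 2 * √h) h := by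
  have := (hasDerivAt_id h).mul (Real.hasDerivAt_sqrt h0.ne')
  refine this.congr_deriv ?_
  have h3 : √h * √h = h := (Real.mul_self_sqrt h0.le)
  have hs : 0 < √h := Real.sqrt_pos.2 h0
  simp only [id]
  field_simp
  nlinarith

theorem sol_stepB_one {d : ℕ} {ω N R K : ℝ} {u : Esp d → ℝ} {u1 u2 : Fin d → Esp d → ℝ}
    {ut G : Esp d → ℝ} (S : Sol ω N R u u1 u2 ut G) (hK0 : 0 ≤ K)
    (hK : ∀ i z h, 0 ≤ h → h ≤ 2 → |G (z + h • ex i) - G z| ≤ K * √h) (i j : Fin d)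
    (z : Esp d) (h : ℝ) (h0 : 0 ≤ h) (h1 : h ≤ 1) :
    fourpt u (ex i) (ex j) z h h ≤ (4 * R + 2 * (12 * K + 1)) * h ^ 2 := by
  have hR0 : 0 ≤ R := (abs_nonneg _).trans (S.hR i 0)
  set B := 12 * K + 1 with hB
  have hB0 : 0 < B := by positivity
  have key := barrier S.hω S.hc S.hper S.hsupp S.h1 S.h2 S.ht S.heq S.hR i j
    (ψ := fun h k => (4 * R + 2 * B) * (h * k) - B * (k * (h * √h) + h * (k * √k)))
    (ψ1 := fun h k => (4 * R + 2 * B) * k - B * (k * (3 / 2 * √h) + k * √k))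
    (ψ11 := fun h k => - (B * (k * (3 / 4 * (√h)⁻¹))))
    (m := fun h k => 4 * K * √(min h k)) ?_ ?_ ?_ ?_ ?_ ?_ ?_ ?_ ?_ z h h h0 h1 h0 h1
  · refine key.trans ?_
    have : 0 ≤ B * (h * (h * √h) + h * (h * √h)) := by positivity
    nlinarith
  · fun_prop
  · intro h k; ring
  · intro h k h0 h1 k0 k1
    have e1 : √h ≤ 1 := Real.sqrt_le_one.2 h1
    have e2 : √k ≤ 1 := Real.sqrt_le_one.2 k1
    have : (4 * R + 2 * B) * (h * k) - B * (k * (h * √h) + h * (k * √k))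
      = h * k * (4 * R + B * ((1 - √h) + (1 - √k))) := by ring
    simp only [this]
    have : 0 ≤ (1 - √h) + (1 - √k) := by linarith
    positivity
  · intro k k0 k1
    have e2 : √k ≤ 1 := Real.sqrt_le_one.2 k1
    have : (4 * R + 2 * B) * (1 * k) - B * (k * (1 * √1) + 1 * (k * √k))
      = 4 * R * k + B * k * (1 - √k) := by rw [Real.sqrt_one]; ring
    simp only [this]
    have : 0 ≤ (1 - √k) := by linarith
    have : 0 ≤ B * k * (1 - √k) := by positivity
    linarith
  · intro h k h0 h1 k0 k1
    have e := (((hasDerivAt_id h).mul_const k).const_mul (4 * R + 2 * B)).sub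
      ((((hasDerivAt_mul_sqrt h0).const_mul k).add ((hasDerivAt_id h).mul_const (k * √k))).const_mul B)
    exact e.congr_deriv (by ring)
  · intro h k h0 h1 k0 k1
    have e := (((((Real.hasDerivAt_sqrt h0.ne').const_mul (3 / 2)).const_mul k).add_const
      (k * √k)).const_mul B).const_sub ((4 * R + 2 * B) * k)
    refine e.congr_deriv ?_
    have hs : 0 < √h := Real.sqrt_pos.2 h0
    field_simp
    norm_num
  · intro h k _ _ _ _; positivity
  · intro z h k h0 h1 k0 k1
    have s2 : ∀ r : ℝ, 0 ≤ r → √(2 * r) ≤ 2 * √r := by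
      intro r hr
      rw [Real.sqrt_le_left (by positivity), mul_pow, Real.sq_sqrt hr]; linarith
    rcases le_total h k with hhk | hhk
    · rw [min_eq_left hhk]
      have a1 := hK i (z - h • ex i + k • ex j) (2 * h) (by positivity) (by linarith)
      have a2 := hK i (z - h • ex i - k • ex j) (2 * h) (by positivity) (by linarith)
      have e1 : z - h • ex i + k • ex j + (2 * h) • ex i = z + h • ex i + k • ex j := by module
      have e2 : z - h • ex i - k • ex j + (2 * h) • ex i = z + h • ex i - k • ex j := by module
      rw [e1] at a1
      rw [e2] at a2
      have := mul_le_mul_of_nonneg_left (s2 h h0.le) hK0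
      unfold fourpt
      linarith [(abs_le.1 a1).2, (abs_le.1 a2).1]
    · rw [min_eq_right hhk]
      have a1 := hK j (z + h • ex i - k • ex j) (2 * k) (by positivity) (by linarith)
      have a2 := hK j (z - h • ex i - k • ex j) (2 * k) (by positivity) (by linarith)
      have e1 : z + h • ex i - k • ex j + (2 * k) • ex j = z + h • ex i + k • ex j := by module
      have e2 : z - h • ex i - k • ex j + (2 * k) • ex j = z - h • ex i + k • ex j := by module
      rw [e1] at a1
      rw [e2] at a2
      have := mul_le_mul_of_nonneg_left (s2 k k0.le) hK0
      unfold fourpt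
      linarith [(abs_le.1 a1).2, (abs_le.1 a2).1]
  · intro h k h0 h1 k0 k1
    have g : ∀ a b : ℝ, 0 < a → a ≤ b → √a ≤ b * (√a)⁻¹ := by
      intro a b ha hab
      have hs : 0 < √a := Real.sqrt_pos.2 ha
      rw [le_mul_inv_iff₀ hs, Real.mul_self_sqrt ha.le]; exact hab
    have hm0 : 0 < √(min h k) := Real.sqrt_pos.2 (lt_min h0 k0)
    have e : √(min h k) ≤ k * (√h)⁻¹ + h * (√k)⁻¹ := by
      rcases le_total h k with hhk | hhk
      · rw [min_eq_left hhk]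
        have := g h k h0 hhk
        have : 0 ≤ h * (√k)⁻¹ := by positivity
        linarith
      · rw [min_eq_right hhk]
        have := g k h k0 hhk
        have : 0 ≤ k * (√h)⁻¹ := by positivity
        linarith
    have := mul_le_mul_of_nonneg_left e hB0.le
    rw [hB] at *
    nlinarith

theorem sol_stepB {d : ℕ} {ω N R K : ℝ} {u : Esp d → ℝ} {u1 u2 : Fin d → Esp d → ℝ}
    {ut G : Esp d → ℝ} (S : Sol ω N R u u1 u2 ut G) (hK0 : 0 ≤ K)
    (hK : ∀ i z h, 0 ≤ h → h ≤ 2 → |G (z + h • ex i) - G z| ≤ K * √h) (i : Fin d) (z : Esp d) :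
    u2 i z ≤ 4 * R + 2 * (12 * K + 1) := by
  have hR0 : 0 ≤ R := (abs_nonneg _).trans (S.hR i 0)
  set A := 4 * R + 2 * (12 * K + 1) with hA
  have key := snd_test (f := fun r : ℝ => u (z + r • ex i) + u (z - r • ex i) - A / 4 * r ^ 2)
    (f' := fun r : ℝ => u1 i (z + r • ex i) + - u1 i (z - r • ex i) - A / 4 * (2 * r))
    (c := u2 i (z + (0 : ℝ) • ex i) + - - u2 i (z - (0 : ℝ) • ex i) - A / 4 * 2) (x0 := 0) ?_ ?_ ?_
  · simp at key
    have : 0 ≤ A := by positivity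
    linarith
  · refine Eventually.of_forall fun r => ?_
    refine ((ld_add (S.h1 i) z r).add (ld_sub (S.h1 i) z r)).sub ?_
    have := ((hasDerivAt_pow 2 r).const_mul (A / 4))
    simpa using this
  · refine ((ld_add (S.h2 i) z 0).add (ld_sub (S.h2 i) z 0).neg).sub ?_
    have := ((hasDerivAt_id (0 : ℝ)).const_mul 2).const_mul (A / 4)
    simpa using this
  · filter_upwards [Icc_mem_nhds (show (-1 : ℝ) < 0 by norm_num) (show (0 : ℝ) < 1 by norm_num)] with r hr
    have gen : ∀ r : ℝ, 0 ≤ r → r ≤ 1 → u (z + r • ex i) + u (z - r • ex i) - A / 4 * r ^ 2 ≤ 2 * u z := by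
      intro r r0 r1
      have e := sol_stepB_one S hK0 hK i i z (r / 2) (by positivity) (by linarith)
      unfold fourpt at e
      have e1 : z + (r / 2) • ex i + (r / 2) • ex i = z + r • ex i := by module
      have e2 : z + (r / 2) • ex i - (r / 2) • ex i = z := by module
      have e3 : z - (r / 2) • ex i + (r / 2) • ex i = z := by module
      have e4 : z - (r / 2) • ex i - (r / 2) • ex i = z - r • ex i := by module
      rw [e1, e2, e3, e4] at e
      nlinarith
    have e0 : u (z + (0 : ℝ) • ex i) + u (z - (0 : ℝ) • ex i) - A / 4 * 0 ^ 2 = 2 * u z := by simp; ring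
    rw [e0]
    rcases le_total 0 r with h | h
    · exact gen r h hr.2
    · have := gen (-r) (by linarith) (by linarith [hr.1])
      simp only [neg_smul, sub_neg_eq_add, ← sub_eq_add_neg] at this
      rw [neg_sq] at this
      linarith

theorem sol_bdd2 {d : ℕ} {ω N R K : ℝ} {u : Esp d → ℝ} {u1 u2 : Fin d → Esp d → ℝ}
    {ut G : Esp d → ℝ} (S : Sol ω N R u u1 u2 ut G) (hK0 : 0 ≤ K)
    (hK : ∀ i z h, 0 ≤ h → h ≤ 2 → |G (z + h • ex i) - G z| ≤ K * √h) (i : Fin d) (z : Esp d) :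
    |u2 i z| ≤ 4 * R + 2 * (12 * K + 1) := by
  refine abs_le.2 ⟨?_, sol_stepB S hK0 hK i z⟩
  have := sol_stepB S.neg hK0 (fun i z h h0 h1 => by
    rw [neg_sub_neg, abs_sub_comm]; exact hK i z h h0 h1) i z
  linarith

open Set MeasureTheory Filter Topology

/-! ## Localization of the periodic solution -/

/-- the interior hypotheses on the periodic solution -/
structure Per {d : ℕ} (Ω : Set (Fin d → ℝ)) (f : ((Fin d → ℝ) × ℝ × (Fin d → ℝ)) → ℝ)
    (p : (Fin d → ℝ) → ℝ → ℝ) (ω R : ℝ) : Prop where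
  hΩo : IsOpen Ω
  hf : ContDiffOn ℝ (⊤ : ℕ∞) f (closure Ω ×ˢ ((univ : Set ℝ) ×ˢ (univ : Set (Fin d → ℝ))))
  hpc : ContinuousOn (fun q : (Fin d → ℝ) × ℝ => p q.1 q.2) (closure Ω ×ˢ (univ : Set ℝ))
  hpx : ∀ t : ℝ, ContDiffOn ℝ 2 (fun x => p x t) Ω
  hpt : ∀ x ∈ Ω, ContDiff ℝ 1 (p x)
  hpeq : ∀ x ∈ Ω, ∀ t : ℝ, deriv (p x) t = lap (fun y => p y t) x
        + f (x, p x t, fun i => pd i (fun y => p y t) x)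
  hω : 0 < ω
  hper : ∀ x ∈ closure Ω, ∀ t : ℝ, p x (t + ω) = p x t
  hbnd : ∀ x ∈ Ω, ∀ t : ℝ, |p x t| ≤ R ∧ ∀ i, |pd i (fun y => p y t) x| ≤ R

/-- an admissible cut-off -/
structure Cut {d : ℕ} (Ω : Set (Fin d → ℝ)) (χ : (Fin d → ℝ) → ℝ) : Prop where
  sm : ContDiff ℝ (⊤ : ℕ∞) χ
  cs : HasCompactSupport χ
  ts : tsupport χ ⊆ Ω

noncomputable def uu {d : ℕ} (χ : (Fin d → ℝ) → ℝ) (p : (Fin d → ℝ) → ℝ → ℝ) (z : Esp d) : ℝ :=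
  χ z.1 * p z.1 z.2
noncomputable def uu1 {d : ℕ} (χ : (Fin d → ℝ) → ℝ) (p : (Fin d → ℝ) → ℝ → ℝ) (i : Fin d)
    (z : Esp d) : ℝ :=
  pd i χ z.1 * p z.1 z.2 + χ z.1 * pd i (fun y => p y z.2) z.1
noncomputable def uu2 {d : ℕ} (χ : (Fin d → ℝ) → ℝ) (p : (Fin d → ℝ) → ℝ → ℝ) (i : Fin d)
    (z : Esp d) : ℝ :=
  pd i (pd i χ) z.1 * p z.1 z.2 + 2 * pd i χ z.1 * pd i (fun y => p y z.2) z.1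
    + χ z.1 * pd i (pd i (fun y => p y z.2)) z.1
noncomputable def uut {d : ℕ} (χ : (Fin d → ℝ) → ℝ) (p : (Fin d → ℝ) → ℝ → ℝ) (z : Esp d) : ℝ :=
  χ z.1 * deriv (p z.1) z.2
noncomputable def gg {d : ℕ} (χ : (Fin d → ℝ) → ℝ) (f : ((Fin d → ℝ) × ℝ × (Fin d → ℝ)) → ℝ)
    (q : (Fin d → ℝ) × ℝ × (Fin d → ℝ)) : ℝ :=
  χ q.1 * f q - ∑ i, (pd i (pd i χ) q.1 * q.2.1 + 2 * pd i χ q.1 * q.2.2 i)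
noncomputable def uuG {d : ℕ} (χ : (Fin d → ℝ) → ℝ) (f : ((Fin d → ℝ) × ℝ × (Fin d → ℝ)) → ℝ)
    (p : (Fin d → ℝ) → ℝ → ℝ) (z : Esp d) : ℝ :=
  gg χ f (z.1, p z.1 z.2, fun i => pd i (fun y => p y z.2) z.1)

theorem pd_smooth {d : ℕ} {χ : (Fin d → ℝ) → ℝ} (h : ContDiff ℝ (⊤ : ℕ∞) χ) (i : Fin d) :
    ContDiff ℝ (⊤ : ℕ∞) (pd i χ) := by
  have : ContDiff ℝ (⊤ : ℕ∞) (fderiv ℝ χ) := h.fderiv_right (by norm_cast)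
  exact this.clm_apply contDiff_const

theorem pd_ev {d : ℕ} {χ χ' : (Fin d → ℝ) → ℝ} {x : Fin d → ℝ} (h : χ =ᶠ[𝓝 x] χ') (i : Fin d) :
    pd i χ =ᶠ[𝓝 x] pd i χ' := by
  filter_upwards [h.fderiv (𝕜 := ℝ)] with y hy
  simp [pd, hy]

theorem pd_const {d : ℕ} (c : ℝ) (i : Fin d) : pd i (fun _ : Fin d → ℝ => c) = fun _ => 0 := by
  funext x; simp [pd]

theorem pd_ev0 {d : ℕ} {χ : (Fin d → ℝ) → ℝ} {x : Fin d → ℝ} {c : ℝ}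
    (hx : χ =ᶠ[𝓝 x] fun _ => c) (i : Fin d) : pd i χ =ᶠ[𝓝 x] fun _ => 0 := by
  have := pd_ev hx i
  rwa [pd_const] at this

theorem line_of_fderiv {d : ℕ} {u : Esp d → ℝ} {z : Esp d} {i : Fin d} {g : (Fin d → ℝ) → ℝ}
    (hg : DifferentiableAt ℝ g z.1) (he : ∀ᶠ y in 𝓝 z.1, u (y, z.2) = g y) :
    HasLineDerivAt ℝ u (pd i g z.1) z (ex i) := by
  have h1 : HasLineDerivAt ℝ (fun y => u (y, z.2)) (pd i g z.1) z.1 (Pi.single i 1) := by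
    have : HasFDerivAt (fun y => u (y, z.2)) (fderiv ℝ g z.1) z.1 :=
      hg.hasFDerivAt.congr_of_eventuallyEq he
    exact this.hasLineDerivAt _
  unfold HasLineDerivAt at *
  refine h1.congr_of_eventuallyEq (Eventually.of_forall fun s => ?_)
  simp [ex]
  congr 1
  ext <;> simp

theorem pd_mul {d : ℕ} {g h : (Fin d → ℝ) → ℝ} {x : Fin d → ℝ} (hg : DifferentiableAt ℝ g x)
    (hh : DifferentiableAt ℝ h x) (i : Fin d) :
    pd i (fun y => g y * h y) x = pd i g x * h x + g x * pd i h x := by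
  unfold pd
  rw [fderiv_fun_mul hg hh]
  simp; ring

theorem pd_add {d : ℕ} {g h : (Fin d → ℝ) → ℝ} {x : Fin d → ℝ} (hg : DifferentiableAt ℝ g x)
    (hh : DifferentiableAt ℝ h x) (i : Fin d) :
    pd i (fun y => g y + h y) x = pd i g x + pd i h x := by
  unfold pd
  rw [fderiv_fun_add hg hh]
  simp

namespace Per
variable {d : ℕ} {Ω : Set (Fin d → ℝ)} {f : ((Fin d → ℝ) × ℝ × (Fin d → ℝ)) → ℝ}
    {p : (Fin d → ℝ) → ℝ → ℝ} {ω R : ℝ} {χ : (Fin d → ℝ) → ℝ}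

theorem c2 (h : Per Ω f p ω R) {x : Fin d → ℝ} (hx : x ∈ Ω) (t : ℝ) :
    ContDiffAt ℝ 2 (fun y => p y t) x := (h.hpx t).contDiffAt (h.hΩo.mem_nhds hx)

theorem dp (h : Per Ω f p ω R) {x : Fin d → ℝ} (hx : x ∈ Ω) (t : ℝ) :
    DifferentiableAt ℝ (fun y => p y t) x := (h.c2 hx t).differentiableAt (by norm_num)

theorem dp1 (h : Per Ω f p ω R) {x : Fin d → ℝ} (hx : x ∈ Ω) (t : ℝ) (i : Fin d) :
    DifferentiableAt ℝ (pd i (fun y => p y t)) x := by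
  have : ContDiffAt ℝ 1 (fderiv ℝ (fun y => p y t)) x := (h.c2 hx t).fderiv_right (by norm_num)
  exact (this.differentiableAt (by norm_num)).clm_apply (differentiableAt_const _)

theorem sol (h : Per Ω f p ω R) (hχ : Cut Ω χ) :
    ∃ N R', Sol ω N R' (uu χ p) (uu1 χ p) (uu2 χ p) (uut χ p) (uuG χ f p) := by
  have hd : ∀ x, DifferentiableAt ℝ χ x := fun x => hχ.sm.differentiable (by norm_num) x
  have hd1 : ∀ i x, DifferentiableAt ℝ (pd i χ) x :=
    fun i x => (pd_smooth hχ.sm i).differentiable (by norm_num) x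
  have hcs : ∀ i, HasCompactSupport (pd i χ) := by
    intro i
    refine hχ.cs.fderiv ℝ |>.mono' ?_
    intro x hx
    by_contra hc
    have : fderiv ℝ χ x = 0 := image_eq_zero_of_notMem_tsupport hc
    exact hx (by simp [pd, this])
  obtain ⟨C0, hC0⟩ := hχ.cs.exists_bound_of_continuous hχ.sm.continuous
  choose C1 hC1 using fun i => (hcs i).exists_bound_of_continuous (pd_smooth hχ.sm i).continuous
  obtain ⟨N, hN⟩ := hχ.cs.isBounded.exists_norm_le
  by_cases hne : Ω.Nonempty
  swap
  · have : χ = fun _ => 0 := by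
      funext x
      refine image_eq_zero_of_notMem_tsupport fun hx => hne ⟨x, hχ.ts hx⟩
    subst this
    have e0 : uu (fun _ => 0) p = fun _ => 0 := by funext z; simp [uu]
    have e1 : ∀ i, uu1 (fun _ => 0) p i = fun _ => 0 := by intro i; funext z; simp [uu1, pd_const]
    refine ⟨0, 0, h.hω, ?_, ?_, ?_, ?_, ?_, ?_, ?_, ?_⟩
    · rw [e0]; exact continuous_const
    · simp [e0]
    · simp [e0]
    · simp [e0, e1, HasLineDerivAt, hasDerivAt_const]
    · simp [e1, uu2, pd_const, HasLineDerivAt, hasDerivAt_const]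
    · simp [e0, uut, HasLineDerivAt, hasDerivAt_const]
    · simp [uut, uu2, uuG, gg, pd_const]
    · simp [e1]
  have hR0 : 0 ≤ R := by
    obtain ⟨x, hx⟩ := hne
    exact (abs_nonneg _).trans (h.hbnd x hx 0).1
  have zev : ∀ x, x ∉ tsupport χ → χ =ᶠ[𝓝 x] fun _ => 0 :=
    fun x hx => notMem_tsupport_iff_eventuallyEq.1 hx
  refine ⟨N, ∑ i, C1 i * R + C0 * R, h.hω, ?_, ?_, ?_, ?_, ?_, ?_, ?_, ?_⟩
  · rw [continuous_iff_continuousAt]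
    intro z
    by_cases hz : z.1 ∈ Ω
    · have : ContinuousAt (fun q : (Fin d → ℝ) × ℝ => p q.1 q.2) z := by
        refine h.hpc.continuousAt ?_
        refine prod_mem_nhds (mem_of_superset (h.hΩo.mem_nhds hz) subset_closure) univ_mem
      have h2 := hχ.sm.continuous
      unfold uu
      exact (h2.continuousAt.comp continuousAt_fst).mul this
    · have h1 := zev z.1 fun hc => hz (hχ.ts hc)
      have : uu χ p =ᶠ[𝓝 z] fun _ => 0 := by
        filter_upwards [continuousAt_fst.eventually h1] with y hy
        simp [uu, hy]
      exact continuousAt_const.congr this.symm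
  · intro z
    by_cases hz : z.1 ∈ Ω
    · simp [uu, et, h.hper _ (subset_closure hz)]
    · have h1 := zev z.1 fun hc => hz (hχ.ts hc)
      simp [uu, et, h1.self_of_nhds]
  · intro z hz
    have h1 := zev z.1 fun hc => by
      have := hN _ hc
      linarith
    simp [uu, h1.self_of_nhds]
  · intro i z
    by_cases hz : z.1 ∈ Ω
    · have := line_of_fderiv (u := uu χ p) (z := z) (i := i) ((hd z.1).mul (h.dp hz z.2))
        (Eventually.of_forall fun y => rfl)
      have e := pd_mul (hd z.1) (h.dp hz z.2) i
      rw [show (χ * fun y => p y z.2) = fun y => χ y * p y z.2 from rfl, e] at this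
      exact this
    · have h1 := zev z.1 fun hc => hz (hχ.ts hc)
      have h2 := pd_ev0 h1 i
      have := line_of_fderiv (u := uu χ p) (z := z) (i := i) (g := fun _ => 0)
        (differentiableAt_const _) (h1.mono fun y hy => by simp [uu, hy])
      rw [pd_const] at this
      simpa [uu1, h1.self_of_nhds, h2.self_of_nhds] using this
  · intro i z
    by_cases hz : z.1 ∈ Ω
    · have this := line_of_fderiv (u := uu1 χ p i) (z := z) (i := i)
        (((hd1 i z.1).fun_mul (h.dp hz z.2)).fun_add ((hd z.1).fun_mul (h.dp1 hz z.2 i)))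
        (Eventually.of_forall fun y => rfl)
      have e := pd_add ((hd1 i z.1).fun_mul (h.dp hz z.2)) ((hd z.1).fun_mul (h.dp1 hz z.2 i)) i
      have e1 := pd_mul (hd1 i z.1) (h.dp hz z.2) i
      have e2 := pd_mul (hd z.1) (h.dp1 hz z.2 i) i
      rw [e, e1, e2] at this
      convert this using 1
      unfold uu2; ring
    · have h1 := zev z.1 fun hc => hz (hχ.ts hc)
      have h2 := pd_ev0 h1 i
      have h3 := pd_ev0 h2 i
      have := line_of_fderiv (u := uu1 χ p i) (z := z) (i := i) (g := fun _ => 0)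
        (differentiableAt_const _)
        (by filter_upwards [h1, h2] with y hy hy2; simp [uu1, hy, hy2])
      rw [pd_const] at this
      simpa [uu2, h1.self_of_nhds, h2.self_of_nhds, h3.self_of_nhds] using this
  · intro z
    by_cases hz : z.1 ∈ Ω
    · have h1 : HasDerivAt (p z.1) (deriv (p z.1) z.2) z.2 :=
        ((h.hpt _ hz).differentiable (by norm_num) z.2).hasDerivAt
      have h2 : HasDerivAt (fun s : ℝ => p z.1 (z.2 + s)) (deriv (p z.1) z.2) 0 := by
        refine HasDerivAt.comp_const_add (f := p z.1) z.2 0 ?_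
        rw [add_zero]; exact h1
      have := h2.const_mul (χ z.1)
      unfold HasLineDerivAt
      simpa [uu, uut, et] using this
    · have h1 := zev z.1 fun hc => hz (hχ.ts hc)
      unfold HasLineDerivAt
      simpa [uu, uut, et, h1.self_of_nhds] using hasDerivAt_const (0 : ℝ) (0 : ℝ)
  · intro z
    by_cases hz : z.1 ∈ Ω
    · simp only [uut, h.hpeq z.1 hz z.2, lap, uu2, uuG, gg, Finset.sum_add_distrib, ← Finset.mul_sum]
      ring
    · have h1 := zev z.1 fun hc => hz (hχ.ts hc)
      have h2 := fun i => pd_ev0 h1 i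
      have h3 := fun i => pd_ev0 (h2 i) i
      simp [uut, uu2, uuG, gg, h1.self_of_nhds, (h2 _).self_of_nhds, (h3 _).self_of_nhds]
  · intro i z
    have hC10 : ∀ i, 0 ≤ C1 i := fun i => (norm_nonneg _).trans (hC1 i 0)
    have hC00 : 0 ≤ C0 := (norm_nonneg _).trans (hC0 0)
    have hs : C1 i * R ≤ ∑ i, C1 i * R :=
      Finset.single_le_sum (f := fun i => C1 i * R)
        (fun i _ => mul_nonneg (hC10 i) hR0) (Finset.mem_univ i)
    by_cases hz : z.1 ∈ Ω
    · obtain ⟨b1, b2⟩ := h.hbnd z.1 hz z.2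
      refine (abs_add_le _ _).trans ?_
      rw [abs_mul, abs_mul]
      have b3 := hC1 i z.1
      have b4 := hC0 z.1
      rw [Real.norm_eq_abs] at b3 b4
      have b5 : |pd i χ z.1| * |p z.1 z.2| ≤ C1 i * R := by gcongr; exact hC10 i
      have b6 : |χ z.1| * |pd i (fun y => p y z.2) z.1| ≤ C0 * R := by
        gcongr; exact b2 i
      linarith
    · have h1 := zev z.1 fun hc => hz (hχ.ts hc)
      have h2 := fun i => pd_ev0 h1 i
      simp only [uu1, h1.self_of_nhds, (h2 _).self_of_nhds]
      simp
      have : 0 ≤ ∑ i, C1 i * R := (mul_nonneg (hC10 i) hR0).trans hs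
      positivity

end Per

open Set MeasureTheory Filter Topology

theorem lip_ext {d : ℕ} {Ω : Set (Fin d → ℝ)} (hΩ : IsOpen Ω) {χ : (Fin d → ℝ) → ℝ} (hχ : Cut Ω χ)
    {g : ((Fin d → ℝ) × ℝ × (Fin d → ℝ)) → ℝ}
    (hg : ContDiffOn ℝ 1 g (Ω ×ˢ (univ : Set (ℝ × (Fin d → ℝ))))) (R : ℝ) :
    ∃ (F : ((Fin d → ℝ) × ℝ × (Fin d → ℝ)) → ℝ) (L : NNReal) (M : ℝ), LipschitzWith L F ∧
      (∀ q, |F q| ≤ M) ∧ (∀ q, g q = 0 → F q = 0) ∧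
      ∀ x u ξ, |u| ≤ R → (∀ i, |ξ i| ≤ R) → F (x, u, ξ) = χ x * g (x, u, ξ) := by
  let θ : ContDiffBump (0 : ℝ × (Fin d → ℝ)) := ⟨|R| + 1, |R| + 2, by positivity, by linarith⟩
  let F : ((Fin d → ℝ) × ℝ × (Fin d → ℝ)) → ℝ := fun q => θ q.2 * (χ q.1 * g q)
  have hF : ContDiff ℝ 1 F := by
    rw [contDiff_iff_contDiffAt]
    intro q
    by_cases hq : q.1 ∈ Ω
    · have h1 : ContDiffAt ℝ 1 g q :=
        hg.contDiffAt (prod_mem_nhds (hΩ.mem_nhds hq) univ_mem)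
      have h2 : ContDiff ℝ 1 χ := hχ.sm.of_le (by norm_cast)
      have h3 : ContDiff ℝ 1 θ := θ.contDiff
      exact (h3.comp contDiff_snd).contDiffAt.mul ((h2.comp contDiff_fst).contDiffAt.mul h1)
    · have h1 := notMem_tsupport_iff_eventuallyEq.1 (fun hc => hq (hχ.ts hc) : q.1 ∉ tsupport χ)
      have : F =ᶠ[𝓝 q] fun _ => 0 := by
        filter_upwards [continuousAt_fst.eventually h1] with y hy
        simp [F, hy]
      exact contDiffAt_const.congr_of_eventuallyEq this
  have hcs : HasCompactSupport F := by
    refine HasCompactSupport.intro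
      (K := tsupport χ ×ˢ Metric.closedBall (0 : ℝ × (Fin d → ℝ)) (|R| + 2))
      (hχ.cs.isCompact.prod (isCompact_closedBall _ _)) fun q hq => ?_
    by_cases hc : q.1 ∈ tsupport χ
    · have h2 : q.2 ∉ Metric.closedBall (0 : ℝ × (Fin d → ℝ)) (|R| + 2) := fun h2 => hq ⟨hc, h2⟩
      have : θ q.2 = 0 := by
        refine θ.zero_of_le_dist ?_
        rw [Metric.mem_closedBall, not_le] at h2
        exact h2.le
      simp [F, this]
    · simp [F, image_eq_zero_of_notMem_tsupport hc]
  obtain ⟨L, hL⟩ := hF.lipschitzWith_of_hasCompactSupport hcs (by norm_num)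
  obtain ⟨M, hM⟩ := hcs.exists_bound_of_continuous hF.continuous
  refine ⟨F, L, M, hL, hM, fun q hq => by simp [F, hq], fun x u ξ hu hξ => ?_⟩
  have : θ (u, ξ) = 1 := by
    refine θ.one_of_mem_closedBall ?_
    rw [mem_closedBall_zero_iff, Prod.norm_def]
    have hR : R ≤ |R| := le_abs_self R
    refine max_le ?_ ((pi_norm_le_iff_of_nonneg (by positivity)).2 fun i => ?_)
    · change |u| ≤ |R| + 1
      linarith
    · have := hξ i
      change |ξ i| ≤ |R| + 1
      linarith
  simp [F, this]

theorem abs_le_norm_fun {d : ℕ} {v : Fin d → ℝ} {C : ℝ} (hC : 0 ≤ C) (h : ∀ i, |v i| ≤ C) :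
    ‖v‖ ≤ C := (pi_norm_le_iff_of_nonneg hC).2 fun i => by simpa using h i

namespace Per
variable {d : ℕ} {Ω : Set (Fin d → ℝ)} {f : ((Fin d → ℝ) × ℝ × (Fin d → ℝ)) → ℝ}
    {p : (Fin d → ℝ) → ℝ → ℝ} {ω R : ℝ} {χ χ' χ'' : (Fin d → ℝ) → ℝ}

theorem fC1 (h : Per Ω f p ω R) : ContDiffOn ℝ 1 f (Ω ×ˢ (univ : Set (ℝ × (Fin d → ℝ)))) := by
  refine (h.hf.of_le (by norm_cast)).mono ?_
  rw [univ_prod_univ]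
  exact prod_mono subset_closure subset_rfl

theorem uuG_eq (h : Per Ω f p ω R) (hχ : Cut Ω χ) (hχ' : Cut Ω χ')
    (hh : ∀ x ∈ tsupport χ, χ' =ᶠ[𝓝 x] fun _ => 1) :
    ∃ (F : ((Fin d → ℝ) × ℝ × (Fin d → ℝ)) → ℝ) (L : NNReal) (M : ℝ), LipschitzWith L F ∧
      (∀ q, |F q| ≤ M) ∧
      ∀ z, uuG χ f p z = F (z.1, uu χ' p z, fun i => uu1 χ' p i z) := by
  have hg : ContDiffOn ℝ 1 (gg χ f) (Ω ×ˢ (univ : Set (ℝ × (Fin d → ℝ)))) := by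
    have h1 := h.fC1
    have h2 : ContDiff ℝ 1 χ := hχ.sm.of_le (by norm_cast)
    have h3 : ∀ i, ContDiff ℝ 1 (pd i χ) := fun i => (pd_smooth hχ.sm i).of_le (by norm_cast)
    have h4 : ∀ i, ContDiff ℝ 1 (pd i (pd i χ)) :=
      fun i => (pd_smooth (pd_smooth hχ.sm i) i).of_le (by norm_cast)
    unfold gg
    refine ((h2.comp contDiff_fst).contDiffOn.mul h1).sub (ContDiff.contDiffOn ?_)
    refine ContDiff.sum fun i _ => ?_
    have := h3 i
    have := h4 i
    fun_prop
  obtain ⟨F, L, M, hL, hM, hz, hF⟩ := lip_ext h.hΩo hχ' hg R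
  refine ⟨F, L, M, hL, hM, fun z => ?_⟩
  by_cases hx : z.1 ∈ tsupport χ
  · have hΩ := hχ.ts hx
    have e1 := hh z.1 hx
    have e2 := fun i => pd_ev0 e1 i
    have b := h.hbnd z.1 hΩ z.2
    simp only [uu, uu1, e1.self_of_nhds, (e2 _).self_of_nhds, one_mul, zero_mul, zero_add]
    rw [hF _ _ _ b.1 b.2, e1.self_of_nhds, one_mul, uuG]
  · have h1 := notMem_tsupport_iff_eventuallyEq.1 hx
    have h2 := fun i => pd_ev0 h1 i
    have h3 := fun i => pd_ev0 (h2 i) i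
    have g0 : ∀ a, gg χ f (z.1, a) = 0 := by
      intro a
      have k1 := h1.self_of_nhds
      simp only [Pi.zero_apply] at k1
      simp [gg, k1, (h2 _).self_of_nhds, (h3 _).self_of_nhds]
    rw [hz _ (g0 _), uuG, g0]

theorem uuG_bdd (h : Per Ω f p ω R) (hχ : Cut Ω χ) (hχ' : Cut Ω χ')
    (hh : ∀ x ∈ tsupport χ, χ' =ᶠ[𝓝 x] fun _ => 1) : ∃ M, ∀ z, |uuG χ f p z| ≤ M := by
  obtain ⟨F, L, M, hL, hM, hF⟩ := h.uuG_eq hχ hχ' hh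
  exact ⟨M, fun z => by rw [hF]; exact hM _⟩

theorem uu1_cont (h : Per Ω f p ω R) (hχ : Cut Ω χ) (hχ' : Cut Ω χ')
    (hh : ∀ x ∈ tsupport χ, χ' =ᶠ[𝓝 x] fun _ => 1) (i : Fin d) : Continuous (uu1 χ p i) := by
  obtain ⟨M, hM⟩ := h.uuG_bdd hχ hχ' hh
  obtain ⟨N, R', S⟩ := h.sol hχ
  exact sol_cont S hM i

theorem uuG_cont (h : Per Ω f p ω R) (hχ : Cut Ω χ) (hχ' : Cut Ω χ') (hχ'' : Cut Ω χ'')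
    (hh : ∀ x ∈ tsupport χ, χ' =ᶠ[𝓝 x] fun _ => 1)
    (hh' : ∀ x ∈ tsupport χ', χ'' =ᶠ[𝓝 x] fun _ => 1) : Continuous (uuG χ f p) := by
  obtain ⟨F, L, M, hL, hM, hF⟩ := h.uuG_eq hχ hχ' hh
  obtain ⟨N, R', S⟩ := h.sol hχ'
  have h1 := S.hc
  have h2 := fun i => h.uu1_cont hχ' hχ'' hh' i
  rw [show uuG χ f p = fun z => F (z.1, uu χ' p z, fun i => uu1 χ' p i z) from funext hF]
  exact hL.continuous.comp (by fun_prop)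

theorem uuG_holder (h : Per Ω f p ω R) (hχ : Cut Ω χ) (hχ' : Cut Ω χ') (hχ'' : Cut Ω χ'')
    (hh : ∀ x ∈ tsupport χ, χ' =ᶠ[𝓝 x] fun _ => 1)
    (hh' : ∀ x ∈ tsupport χ', χ'' =ᶠ[𝓝 x] fun _ => 1) :
    ∃ K, 0 ≤ K ∧ ∀ i z h, 0 ≤ h → h ≤ 2 →
      |uuG χ f p (z + h • ex i) - uuG χ f p z| ≤ K * √h := by
  obtain ⟨F, L, M, hL, hM, hF⟩ := h.uuG_eq hχ hχ' hh
  obtain ⟨N, R', S⟩ := h.sol hχ'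
  obtain ⟨M', hM'⟩ := h.uuG_bdd hχ' hχ'' hh'
  by_cases hd : Nonempty (Fin d)
  swap
  · exact ⟨0, le_rfl, fun i => (hd ⟨i⟩).elim⟩
  obtain ⟨i0⟩ := hd
  have hM0 : 0 ≤ M' := (abs_nonneg _).trans (hM' 0)
  have hR0 : 0 ≤ R' := (abs_nonneg _).trans (S.hR i0 0)
  set C := 2 + 2 * R' + 9 * (4 * R' + 4 * (4 * M' + 1)) with hC
  have hC0 : 0 ≤ C := by positivity
  refine ⟨L * C, by positivity, fun i z r r0 r2 => ?_⟩
  rw [hF, hF, ← Real.dist_eq]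
  refine (hL.dist_le_mul _ _).trans ?_
  rw [mul_assoc]
  gcongr
  have hs : r ≤ 2 * √r := by
    have e1 : r = √r * √r := (Real.mul_self_sqrt r0).symm
    have e2 : √r ≤ 2 := by rw [Real.sqrt_le_left (by norm_num)]; linarith
    have := Real.sqrt_nonneg r
    nlinarith
  have hs0 := Real.sqrt_nonneg r
  have hCs : 0 ≤ C * √r := by positivity
  rw [Prod.dist_eq, Prod.dist_eq]
  refine max_le ?_ (max_le ?_ ?_)
  · simp only [dist_eq_norm]
    refine abs_le_norm_fun hCs fun j => ?_
    have : |(z + r • ex i).1 j - z.1 j| ≤ r := by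
      by_cases hj : j = i
      · subst hj; simp [ex, abs_of_nonneg r0]
      · simp [ex, hj, r0]
    have : 2 * √r ≤ C * √r := by
      refine mul_le_mul_of_nonneg_right ?_ hs0
      have : 0 ≤ 2 * R' + 9 * (4 * R' + 4 * (4 * M' + 1)) := by positivity
      linarith
    simp only [Pi.sub_apply]
    linarith
  · have := ld_lip (S.h1 i) (S.hR i) z r 0
    simp only [zero_smul, add_zero, sub_zero, abs_of_nonneg r0] at this
    rw [Real.dist_eq]
    have h2 : R' * r ≤ R' * (2 * √r) := by gcongr
    have : 0 ≤ (2 + 9 * (4 * R' + 4 * (4 * M' + 1))) * √r := by positivity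
    rw [hC]
    linarith
  · simp only [dist_eq_norm]
    refine abs_le_norm_fun hCs fun j => ?_
    simp only [Pi.sub_apply]
    rcases le_total r 1 with hr | hr
    · have := sol_holder S hM' i j z r r0 hr
      have : 0 ≤ (2 + 2 * R') * √r := by positivity
      rw [hC]
      linarith
    · have h1 := abs_le.1 (S.hR j (z + r • ex i))
      have h2 := abs_le.1 (S.hR j z)
      have h3 : 1 ≤ √r := Real.one_le_sqrt.2 hr
      have h4 : R' ≤ R' * √r := le_mul_of_one_le_right hR0 h3
      have : 0 ≤ (2 + 9 * (4 * R' + 4 * (4 * M' + 1))) * √r := by positivity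
      rw [hC, abs_le]
      constructor <;> linarith

end Per

theorem bump_cut {d : ℕ} {Ω : Set (Fin d → ℝ)} {x0 : Fin d → ℝ} (b : ContDiffBump x0)
    (h : Metric.closedBall x0 b.rOut ⊆ Ω) : Cut Ω b :=
  ⟨b.contDiff, b.hasCompactSupport, by rw [b.tsupport_eq]; exact h⟩

theorem bump_near {d : ℕ} {x0 : Fin d → ℝ} (b : ContDiffBump x0) {s : ℝ} (h : s < b.rIn)
    (x : Fin d → ℝ) (hx : x ∈ Metric.closedBall x0 s) : b =ᶠ[𝓝 x] fun _ => 1 := by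
  have : x ∈ Metric.ball x0 b.rIn := Metric.closedBall_subset_ball h hx
  exact b.eventuallyEq_one_of_mem_ball this

/-- local regularity package -/
theorem Per.loc {d : ℕ} {Ω : Set (Fin d → ℝ)} {f : ((Fin d → ℝ) × ℝ × (Fin d → ℝ)) → ℝ}
    {p : (Fin d → ℝ) → ℝ → ℝ} {ω R : ℝ} (h : Per Ω f p ω R) {x0 : Fin d → ℝ} {r : ℝ} (hr : 0 < r)
    (hb : Metric.closedBall x0 (6 * r) ⊆ Ω) :
    ∃ (N R' C L : ℝ) (u : Esp d → ℝ) (u1 u2 : Fin d → Esp d → ℝ) (ut G : Esp d → ℝ),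
      Sol ω N R' u u1 u2 ut G ∧ (∀ i, Continuous (u1 i)) ∧ Continuous G ∧
      (∀ i z, |u2 i z| ≤ C) ∧ (∀ z, |ut z| ≤ C) ∧ 0 ≤ L ∧
      ∀ x ∈ Metric.ball x0 r, ∀ t, u (x, t) = p x t ∧
        (∀ i, u1 i (x, t) = pd i (fun y => p y t) x) ∧
        ∀ s, |G (x, t) - G (x, s)| ≤ L * (|u (x, t) - u (x, s)| + ∑ i, |u1 i (x, t) - u1 i (x, s)|) := by
  let b1 : ContDiffBump x0 := ⟨r, 2 * r, hr, by linarith⟩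
  let b2 : ContDiffBump x0 := ⟨3 * r, 4 * r, by positivity, by linarith⟩
  let b3 : ContDiffBump x0 := ⟨5 * r, 6 * r, by positivity, by linarith⟩
  have c1 : Cut Ω b1 := bump_cut b1 ((Metric.closedBall_subset_closedBall (by
    show 2 * r ≤ 6 * r; linarith)).trans hb)
  have c2 : Cut Ω b2 := bump_cut b2 ((Metric.closedBall_subset_closedBall (by
    show 4 * r ≤ 6 * r; linarith)).trans hb)
  have c3 : Cut Ω b3 := bump_cut b3 hb
  have h12 : ∀ x ∈ tsupport b1, b2 =ᶠ[𝓝 x] fun _ => 1 := by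
    intro x hx
    rw [b1.tsupport_eq] at hx
    exact bump_near b2 (show 2 * r < 3 * r by linarith) x hx
  have h23 : ∀ x ∈ tsupport b2, b3 =ᶠ[𝓝 x] fun _ => 1 := by
    intro x hx
    rw [b2.tsupport_eq] at hx
    exact bump_near b3 (show 4 * r < 5 * r by linarith) x hx
  obtain ⟨N, R', S⟩ := h.sol c1
  obtain ⟨K, hK0, hK⟩ := h.uuG_holder c1 c2 c3 h12 h23
  obtain ⟨M, hM⟩ := h.uuG_bdd c1 c2 h12
  have hb2 := fun i z => sol_bdd2 S hK0 hK i z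
  obtain ⟨F, L, M', hL, -, -, hF⟩ := lip_ext h.hΩo c1 h.fC1 R
  set A := 4 * R' + 2 * (12 * K + 1) with hA
  have hM0 : 0 ≤ M := (abs_nonneg _).trans (hM 0)
  refine ⟨N, R', |A| + d * |A| + M, L, uu b1 p, uu1 b1 p, uu2 b1 p, uut b1 p, uuG b1 f p, S,
    fun i => h.uu1_cont c1 c2 h12 i, h.uuG_cont c1 c2 c3 h12 h23, ?_, ?_, L.2, ?_⟩
  · intro i z
    have := hb2 i z
    have := le_abs_self A
    have : 0 ≤ d * |A| := by positivity
    linarith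
  · intro z
    rw [S.heq]
    refine (abs_add_le _ _).trans ?_
    have h1 : |∑ i, uu2 b1 p i z| ≤ d * |A| := by
      refine (Finset.abs_sum_le_sum_abs _ _).trans ?_
      refine (Finset.sum_le_card_nsmul _ _ |A| fun i _ => (hb2 i z).trans (le_abs_self A)).trans ?_
      simp
    have := hM z
    have := abs_nonneg A
    linarith
  · intro x hx t
    have e1 : b1 =ᶠ[𝓝 x] fun _ => 1 := b1.eventuallyEq_one_of_mem_ball hx
    have e2 := fun i => pd_ev0 e1 i
    have e3 := fun i => pd_ev0 (e2 i) i
    have hxΩ : x ∈ Ω := hb (Metric.ball_subset_closedBall (Metric.ball_subset_ball (by linarith) hx))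
    have q1 : ∀ t, uu b1 p (x, t) = p x t := fun t => by
      simp only [uu, e1.self_of_nhds, one_mul]
    have q2 : ∀ t i, uu1 b1 p i (x, t) = pd i (fun y => p y t) x := fun t i => by
      simp only [uu1, e1.self_of_nhds, (e2 i).self_of_nhds, one_mul, zero_mul, zero_add]
    refine ⟨q1 t, q2 t, fun s => ?_⟩
    have q3 : ∀ t, uuG b1 f p (x, t) = F (x, p x t, fun i => pd i (fun y => p y t) x) := fun t => by
      have b := h.hbnd x hxΩ t
      rw [hF _ _ _ b.1 b.2]
      simp only [uuG, gg, e1.self_of_nhds, (e2 _).self_of_nhds, (e3 _).self_of_nhds]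
      simp
    rw [q3, q3, ← Real.dist_eq]
    refine (hL.dist_le_mul _ _).trans ?_
    gcongr
    have hn : 0 ≤ ∑ i, |uu1 b1 p i (x, t) - uu1 b1 p i (x, s)| :=
      Finset.sum_nonneg fun i _ => abs_nonneg _
    rw [Prod.dist_eq, Prod.dist_eq]
    simp only [dist_self]
    refine max_le (by positivity) (max_le ?_ ?_)
    · rw [q1, q1, Real.dist_eq]; linarith
    · rw [dist_eq_norm]
      refine (abs_le_norm_fun hn fun i => ?_).trans (by linarith [abs_nonneg (uu b1 p (x, t) - uu b1 p (x, s))])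
      simp only [Pi.sub_apply, ← q2]
      exact Finset.single_le_sum (f := fun i => |uu1 b1 p i (x, t) - uu1 b1 p i (x, s)|)
        (fun i _ => abs_nonneg _) (Finset.mem_univ i)

open Set MeasureTheory Filter Topology

/-! ## Calculus of directional derivatives -/

/-- directional derivative -/
noncomputable def dd {d : ℕ} (a : Esp d) (g : Esp d → ℝ) (z : Esp d) : ℝ := fderiv ℝ g z a

abbrev Sm {d : ℕ} (g : Esp d → ℝ) : Prop := ContDiff ℝ (⊤ : ℕ∞) g

section ddcalc
variable {d : ℕ} {g h : Esp d → ℝ} {a b : Esp d}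

theorem Sm.da (hg : Sm g) (z : Esp d) : DifferentiableAt ℝ g z := hg.differentiable (by norm_num) z

theorem Sm.dd (hg : Sm g) (a : Esp d) : Sm (dd a g) := by
  have : ContDiff ℝ (⊤ : ℕ∞) (fderiv ℝ g) := hg.fderiv_right (by norm_cast)
  exact this.clm_apply contDiff_const

theorem dd_mul (hg : Sm g) (hh : Sm h) (a z : Esp d) :
    dd a (fun z => g z * h z) z = dd a g z * h z + g z * dd a h z := by
  unfold dd
  rw [fderiv_fun_mul (hg.da z) (hh.da z)]
  simp; ring

theorem dd_add (hg : Sm g) (hh : Sm h) (a z : Esp d) :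
    dd a (fun z => g z + h z) z = dd a g z + dd a h z := by
  unfold dd
  rw [fderiv_fun_add (hg.da z) (hh.da z)]
  simp

theorem dd_cmul (hg : Sm g) (c : ℝ) (a z : Esp d) :
    dd a (fun z => c * g z) z = c * dd a g z := by
  unfold dd
  rw [fderiv_const_mul (hg.da z)]
  simp

theorem dd_comm (hg : Sm g) (a b z : Esp d) : dd a (dd b g) z = dd b (dd a g) z := by
  have h1 : DifferentiableAt ℝ (fderiv ℝ g) z := by
    have : ContDiff ℝ (⊤ : ℕ∞) (fderiv ℝ g) := hg.fderiv_right (by norm_cast)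
    exact this.differentiable (by norm_num) z
  have key : ∀ a b : Esp d, dd a (dd b g) z = fderiv ℝ (fderiv ℝ g) z a b := by
    intro a b
    unfold dd
    rw [fderiv_clm_apply h1 (differentiableAt_const b)]
    simp
  rw [key, key]
  exact (hg.contDiffAt.isSymmSndFDerivAt (by simp; norm_cast)).eq a b

theorem dd_zero_of_ev {z : Esp d} (h : g =ᶠ[𝓝 z] fun _ => 0) (a : Esp d) :
    dd a g =ᶠ[𝓝 z] fun _ => 0 := by
  filter_upwards [h.fderiv (𝕜 := ℝ)] with y hy
  simp [dd, hy]

theorem dd_cs (hg : HasCompactSupport g) (a : Esp d) : HasCompactSupport (dd a g) := by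
  refine (hg.fderiv ℝ).mono' ?_
  intro x hx
  by_contra hc
  have : fderiv ℝ g x = 0 := image_eq_zero_of_notMem_tsupport hc
  exact hx (by simp [dd, this])

theorem dd_int (hg : Sm g) (hc : HasCompactSupport g) (a : Esp d) : Integrable (dd a g) :=
  (hg.dd a).continuous.integrable_of_hasCompactSupport (dd_cs hc a)

instance esp_haar (d : ℕ) : (volume : Measure (Esp d)).IsAddHaarMeasure :=
  Measure.prod.instIsAddHaarMeasure (volume : Measure (Fin d → ℝ)) (volume : Measure ℝ)

theorem int_dd (hg : Sm g) (hc : HasCompactSupport g) (a : Esp d) : ∫ z, dd a g z = 0 := by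
  have := integral_mul_fderiv_eq_neg_fderiv_mul_of_integrable (μ := (volume : Measure (Esp d)))
    (f := fun _ => (1 : ℝ)) (g := g) (v := a) (by simp) (by simp only [one_mul]; exact dd_int hg hc a)
    (by simpa using hg.continuous.integrable_of_hasCompactSupport hc)
    (fun x _ => differentiableAt_const _) (fun x _ => hg.da x)
  simpa [dd] using this

/-- null integrand -/
def Null0 (n : Esp d → ℝ) : Prop := Integrable n ∧ ∫ z, n z = 0

theorem Null0.add {m n : Esp d → ℝ} (hm : Null0 m) (hn : Null0 n) : Null0 fun z => m z + n z :=
  ⟨hm.1.add hn.1, by rw [integral_add hm.1 hn.1, hm.2, hn.2, add_zero]⟩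

theorem Null0.cmul {m : Esp d → ℝ} (hm : Null0 m) (c : ℝ) : Null0 fun z => c * m z :=
  ⟨hm.1.const_mul c, by rw [integral_const_mul, hm.2, mul_zero]⟩

theorem Null0.sum {ι : Type*} (s : Finset ι) {m : ι → Esp d → ℝ} (hm : ∀ i, Null0 (m i)) :
    Null0 fun z => ∑ i ∈ s, m i z :=
  ⟨integrable_finsetSum s fun i _ => (hm i).1, by
    rw [integral_finsetSum s fun i _ => (hm i).1]; simp [(hm _).2]⟩

theorem null_dd (hg : Sm g) (hc : HasCompactSupport g) (a : Esp d) : Null0 (dd a g) :=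
  ⟨dd_int hg hc a, int_dd hg hc a⟩

theorem Null0.congr {m n : Esp d → ℝ} (hm : Null0 m) (h : ∀ z, n z = m z) : Null0 n := by
  rw [funext h]; exact hm

/-- the five integrations by parts -/
theorem null1 {v : Esp d → ℝ} (hv : Sm v) (hc : HasCompactSupport v) (a t : Esp d) :
    Null0 fun z => dd a (dd a v) z * dd t v z := by
  have v1 := hv.dd a
  have v2 := hv.dd t
  have n1 := null_dd (v1.mul v2) ((dd_cs hc a).mul_right) a
  have n2 := null_dd (v1.mul v1) ((dd_cs hc a).mul_right) t
  refine (n1.add (n2.cmul (-1/2))).congr fun z => ?_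
  rw [dd_mul v1 v2, dd_mul v1 v1, dd_comm hv a t]
  ring

theorem null2 {v φ : Esp d → ℝ} (hv : Sm v) (hφ : Sm φ) (hc : HasCompactSupport v) (a b : Esp d) :
    Null0 fun z => dd a (dd a v) z * (dd b φ z * dd b v z) + dd a (dd b φ) z * dd a v z * dd b v z
      - 1 / 2 * dd b (dd b φ) z * (dd a v z) ^ 2 := by
  have v1 := hv.dd a
  have v2 := hv.dd b
  have f1 := hφ.dd b
  have n1 := null_dd (v1.mul (f1.mul v2)) ((dd_cs hc a).mul_right) a
  have n2 := null_dd (f1.mul (v1.mul v1)) (((dd_cs hc a).mul_right).mul_left) b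
  refine (n1.add (n2.cmul (-1/2))).congr fun z => ?_
  have e1 := dd_mul v1 (f1.mul v2) a z
  have e2 := dd_mul f1 v2 a z
  have e3 := dd_mul f1 (v1.mul v1) b z
  have e4 := dd_mul v1 v1 b z
  rw [e1, e2, e3, e4, dd_comm hv a b]
  ring

theorem null3 {v q : Esp d → ℝ} (hv : Sm v) (hq : Sm q) (hc : HasCompactSupport v) (a : Esp d) :
    Null0 fun z => q z * v z * dd a v z + 1 / 2 * dd a q z * (v z) ^ 2 := by
  have n1 := null_dd (hq.mul (hv.mul hv)) (hc.mul_right.mul_left) a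
  refine (n1.cmul (1/2)).congr fun z => ?_
  have e1 := dd_mul hq (hv.mul hv) a z
  have e2 := dd_mul hv hv a z
  rw [e1, e2]
  ring

theorem null5 {v q : Esp d → ℝ} (hv : Sm v) (hq : Sm q) (hc : HasCompactSupport v) (a : Esp d) :
    Null0 fun z => q z * v z * dd a (dd a v) z + q z * (dd a v z) ^ 2 + dd a q z * v z * dd a v z := by
  have v1 := hv.dd a
  have n1 := null_dd (hq.mul (hv.mul v1)) (hc.mul_right.mul_left) a
  refine n1.congr fun z => ?_
  have e1 := dd_mul hq (hv.mul v1) a z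
  have e2 := dd_mul hv v1 a z
  rw [e1, e2]
  ring

end ddcalc

/-! ## Abstract Carleman inequality -/

/-- squared gradient of the weight -/
noncomputable def gsq {d : ℕ} (φ : Esp d → ℝ) (z : Esp d) : ℝ := ∑ i, dd (ex i) φ z ^ 2

noncomputable def lapl {d : ℕ} (φ : Esp d → ℝ) (z : Esp d) : ℝ := ∑ i, dd (ex i) (dd (ex i) φ) z

/-- conjugated heat operator -/
noncomputable def conj {d : ℕ} (φ : Esp d → ℝ) (τ : ℝ) (v : Esp d → ℝ) (z : Esp d) : ℝ :=
  dd et v z - lapl v z + 2 * τ * ∑ i, dd (ex i) φ z * dd (ex i) v z - τ ^ 2 * gsq φ z * v z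
    + τ * lapl φ z * v z - τ * dd et φ z * v z

theorem gsq_sm {d : ℕ} {φ : Esp d → ℝ} (h : Sm φ) : Sm (gsq φ) := by
  unfold gsq
  exact ContDiff.sum fun i _ => (h.dd _).pow 2

theorem lapl_sm {d : ℕ} {φ : Esp d → ℝ} (h : Sm φ) : Sm (lapl φ) := by
  unfold lapl
  exact ContDiff.sum fun i _ => (h.dd _).dd _

/-- algebraic core of the Carleman computation -/
theorem carleman_alg {d : ℕ} (τ T v vt g ft κ gt ftt : ℝ) (V V2 F k GF FF : Fin d → ℝ) (H : Fin d → Fin d → ℝ)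
    (hT : T = ∑ i, H i i) :
    4 * τ * ∑ i, ∑ j, H i j * V i * V j + 2 * τ * (κ - T) * ∑ i, V i ^ 2
      + τ ^ 3 * (2 * ∑ j, GF j - 2 * κ * g) * v ^ 2
      + τ ^ 2 * (gt + 2 * ∑ j, FF j - 2 * κ * ft - κ ^ 2) * v ^ 2
      + τ * ftt * v ^ 2 + 2 * τ * v * ∑ i, k i * V i
    ≤ (vt - ∑ i, V2 i + 2 * τ * ∑ i, F i * V i - τ ^ 2 * g * v - τ * ft * v) ^ 2
      + (2 * ∑ i, V2 i * vt + 4 * τ * ∑ i, ∑ j, (V2 i * (F j * V j) + H i j * V i * V j - 1 / 2 * H j j * V i ^ 2)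
      + 2 * (τ ^ 2 * (g * v * vt + 1 / 2 * gt * v ^ 2) + τ * (ft * v * vt + 1 / 2 * ftt * v ^ 2))
      + 4 * τ * (τ ^ 2 * ∑ j, (g * F j * v * V j + 1 / 2 * GF j * v ^ 2)
        + τ * ∑ j, (ft * F j * v * V j + 1 / 2 * FF j * v ^ 2))
      + 2 * τ * ∑ i, (κ * v * V2 i + κ * V i ^ 2 + k i * v * V i)) := by
  have e1 : ∑ i, ∑ j, (V2 i * (F j * V j) + H i j * V i * V j - 1 / 2 * H j j * V i ^ 2)
      = (∑ i, V2 i) * (∑ j, F j * V j) + ∑ i, ∑ j, H i j * V i * V j - 1 / 2 * T * ∑ i, V i ^ 2 := by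
    simp only [Finset.sum_add_distrib, Finset.sum_sub_distrib]
    rw [hT, Finset.sum_mul_sum]
    congr 1
    rw [Finset.mul_sum]
    refine Finset.sum_congr rfl fun i _ => ?_
    rw [Finset.mul_sum, Finset.sum_mul]
  have e2 : ∑ i, V2 i * vt = (∑ i, V2 i) * vt := by rw [Finset.sum_mul]
  have e3 : ∀ c : ℝ, ∀ B : Fin d → ℝ, ∑ j, (c * F j * v * V j + 1 / 2 * B j * v ^ 2)
      = c * v * ∑ j, F j * V j + 1 / 2 * v ^ 2 * ∑ j, B j := by
    intro c B
    rw [Finset.sum_add_distrib, Finset.mul_sum, Finset.mul_sum]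
    congr 1 <;> exact Finset.sum_congr rfl fun i _ => by ring
  have e4 : ∑ i, (κ * v * V2 i + κ * V i ^ 2 + k i * v * V i)
      = κ * v * ∑ i, V2 i + κ * ∑ i, V i ^ 2 + v * ∑ i, k i * V i := by
    simp only [Finset.sum_add_distrib, Finset.mul_sum]
    congr 1
    exact Finset.sum_congr rfl fun i _ => by ring
  rw [e1, e2, e3, e3, e4]
  generalize ∑ i, V2 i = L
  generalize ∑ j, F j * V j = FV
  generalize ∑ i, ∑ j, H i j * V i * V j = HH
  generalize ∑ i, V i ^ 2 = VV
  generalize ∑ j, GF j = GG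
  generalize ∑ j, FF j = F2
  generalize ∑ i, k i * V i = kk
  nlinarith [sq_nonneg (-L - (τ ^ 2 * g + τ * ft) * v - τ * κ * v), sq_nonneg (vt + 2 * τ * FV)]

open Set MeasureTheory Filter Topology

/-- the sum of null integrands -/
noncomputable def nullF {d : ℕ} (φ κ : Esp d → ℝ) (τ : ℝ) (v : Esp d → ℝ) (z : Esp d) : ℝ :=
  (2 * ∑ i, dd (ex i) (dd (ex i) v) z * dd et v z
      + 4 * τ * ∑ i, ∑ j, (dd (ex i) (dd (ex i) v) z * (dd (ex j) φ z * dd (ex j) v z)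
          + dd (ex i) (dd (ex j) φ) z * dd (ex i) v z * dd (ex j) v z
          - 1 / 2 * dd (ex j) (dd (ex j) φ) z * dd (ex i) v z ^ 2)
      + 2 * (τ ^ 2 * (gsq φ z * v z * dd et v z + 1 / 2 * dd et (gsq φ) z * v z ^ 2)
          + τ * (dd et φ z * v z * dd et v z + 1 / 2 * dd et (dd et φ) z * v z ^ 2))
      + 4 * τ * (τ ^ 2 * ∑ j, (gsq φ z * dd (ex j) φ z * v z * dd (ex j) v z
            + 1 / 2 * dd (ex j) (fun z => gsq φ z * dd (ex j) φ z) z * v z ^ 2)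
        + τ * ∑ j, (dd et φ z * dd (ex j) φ z * v z * dd (ex j) v z
            + 1 / 2 * dd (ex j) (fun z => dd et φ z * dd (ex j) φ z) z * v z ^ 2))
      + 2 * τ * ∑ i, (κ z * v z * dd (ex i) (dd (ex i) v) z + κ z * dd (ex i) v z ^ 2
          + dd (ex i) κ z * v z * dd (ex i) v z))

theorem carleman_null {d : ℕ} {φ κ v : Esp d → ℝ} (hφ : Sm φ) (hκ : Sm κ) (hv : Sm v)
    (hc : HasCompactSupport v) (τ : ℝ) :
    Null0 (nullF φ κ τ v) := by
  unfold nullF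
  refine Null0.add (Null0.add (Null0.add (Null0.add ?_ ?_) ?_) ?_) ?_
  · exact (Null0.sum _ fun i => null1 hv hc (ex i) et).cmul 2
  · exact (Null0.sum _ fun i => Null0.sum _ fun j => null2 hv hφ hc (ex i) (ex j)).cmul (4 * τ)
  · exact Null0.cmul (Null0.add ((null3 hv (gsq_sm hφ) hc et).cmul _)
      ((null3 hv (hφ.dd et) hc et).cmul _)) 2
  · refine Null0.cmul (Null0.add (Null0.cmul (Null0.sum _ fun j => ?_) _)
      (Null0.cmul (Null0.sum _ fun j => ?_) _)) (4 * τ)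
    · exact null3 hv ((gsq_sm hφ).mul (hφ.dd (ex j))) hc (ex j)
    · exact null3 hv ((hφ.dd et).mul (hφ.dd (ex j))) hc (ex j)
  · exact (Null0.sum _ fun i => null5 hv hκ hc (ex i)).cmul (2 * τ)

theorem bdd_on_compact {d : ℕ} {K : Set (Esp d)} (hK : IsCompact K) {g : Esp d → ℝ}
    (hg : Continuous g) : ∃ B, 0 ≤ B ∧ ∀ z ∈ K, |g z| ≤ B := by
  obtain ⟨B, hB⟩ := hK.exists_bound_of_continuousOn hg.continuousOn
  exact ⟨|B|, abs_nonneg _, fun z hz => (hB z hz).trans (le_abs_self B)⟩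

/-- arithmetic end of the pointwise Carleman estimate -/
theorem carleman_end {c0 c1 B τ v VV HH a3 a2 a1 k2 kv l P X T N : ℝ} (hc0 : 0 < c0) (hc1 : 0 < c1)
    (hB : 0 ≤ B) (hτ1 : 1 ≤ τ)
    (hτ : 2 * (4 * B + B * (2 / c1)) ≤ c0 * τ)
    (h1 : c1 * VV ≤ HH) (h2 : c0 ≤ a3) (ha2 : |a2| ≤ B) (ha1 : |a1| ≤ B) (hk2 : |k2| ≤ B)
    (hl : |l| ≤ B) (hk : |2 * v * kv| ≤ c1 / 2 * VV + 2 / c1 * k2 * v ^ 2)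
    (hX : X = P - τ * T * v) (hT : T ^ 2 = l)
    (hmain : τ * HH + τ ^ 3 * a3 * v ^ 2 + τ ^ 2 * a2 * v ^ 2 + τ * a1 * v ^ 2 + 2 * τ * v * kv
      ≤ X ^ 2 + N) :
    c0 / 2 * (τ ^ 3 * v ^ 2) + c1 / 2 * (τ * VV) ≤ 2 * P ^ 2 + N := by
  have hτ0 : 0 < τ := by linarith
  have e1 : X ^ 2 ≤ 2 * P ^ 2 + 2 * τ ^ 2 * B * v ^ 2 := by
    have : X ^ 2 ≤ 2 * P ^ 2 + 2 * (τ * T * v) ^ 2 := by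
      rw [hX]; nlinarith [sq_nonneg (P + τ * T * v)]
    have h3 : (τ * T * v) ^ 2 = τ ^ 2 * v ^ 2 * l := by rw [← hT]; ring
    have h4 : τ ^ 2 * v ^ 2 * l ≤ τ ^ 2 * v ^ 2 * B := by
      gcongr; exact (le_abs_self _).trans hl
    linarith
  have e2 : τ ^ 3 * c0 * v ^ 2 ≤ τ ^ 3 * a3 * v ^ 2 := by gcongr
  have e3 : - (τ ^ 2 * B * v ^ 2) ≤ τ ^ 2 * a2 * v ^ 2 := by
    have : -B ≤ a2 := (abs_le.1 ha2).1
    have : τ ^ 2 * (-B) * v ^ 2 ≤ τ ^ 2 * a2 * v ^ 2 := by gcongr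
    linarith
  have e4 : - (τ ^ 2 * B * v ^ 2) ≤ τ * a1 * v ^ 2 := by
    have : -B ≤ a1 := (abs_le.1 ha1).1
    have h5 : τ * (-B) * v ^ 2 ≤ τ * a1 * v ^ 2 := by gcongr
    have h6 : τ * B * v ^ 2 ≤ τ ^ 2 * B * v ^ 2 := by
      have : τ ≤ τ ^ 2 := by nlinarith
      gcongr
    linarith
  have e5 : - (τ * (c1 / 2 * VV)) - τ ^ 2 * (B * (2 / c1)) * v ^ 2 ≤ 2 * τ * v * kv := by
    have h7 : -(c1 / 2 * VV + 2 / c1 * k2 * v ^ 2) ≤ 2 * v * kv := (abs_le.1 hk).1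
    have h8 : 2 / c1 * k2 * v ^ 2 ≤ 2 / c1 * B * v ^ 2 := by
      gcongr; exact (le_abs_self _).trans hk2
    have h9 := mul_le_mul_of_nonneg_left h7 hτ0.le
    have h10 := mul_le_mul_of_nonneg_left h8 hτ0.le
    have h11 : τ * (2 / c1 * B * v ^ 2) ≤ τ ^ 2 * (2 / c1 * B * v ^ 2) := by
      have : τ ≤ τ ^ 2 := by nlinarith
      gcongr
    linarith
  have e6 : τ * (c1 * VV) ≤ τ * HH := by gcongr
  have e7 : τ ^ 2 * v ^ 2 * (2 * (4 * B + B * (2 / c1))) ≤ τ ^ 2 * v ^ 2 * (c0 * τ) := by gcongr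
  nlinarith

theorem carleman_pt {d : ℕ} {φ κ v : Esp d → ℝ} {z : Esp d} {c0 c1 B τ : ℝ} (hc0 : 0 < c0) (hc1 : 0 < c1)
    (hB0 : 0 ≤ B) (hτ1 : 1 ≤ τ) (hτ2 : 2 * (4 * B + B * (2 / c1)) ≤ c0 * τ)
    (H1 : ∀ ξ : Fin d → ℝ, c1 * ∑ i, ξ i ^ 2 ≤
      4 * ∑ i, ∑ j, dd (ex i) (dd (ex j) φ) z * ξ i * ξ j + 2 * (κ z - lapl φ z) * ∑ i, ξ i ^ 2)
    (H2 : c0 ≤ 2 * ∑ j, dd (ex j) (fun z => gsq φ z * dd (ex j) φ z) z - 2 * κ z * gsq φ z)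
    (b2 : |dd et (gsq φ) z
    + 2 * ∑ j, dd (ex j) (fun z => dd et φ z * dd (ex j) φ z) z - 2 * κ z * dd et φ z - κ z ^ 2| ≤ B)
    (b1 : |dd et (dd et φ) z| ≤ B) (bk : |∑ i, dd (ex i) κ z ^ 2| ≤ B)
    (bl : |lapl φ z ^ 2| ≤ B) :
    min (c0 / 2) (c1 / 2) * (τ ^ 3 * v z ^ 2 + τ * ∑ i, dd (ex i) v z ^ 2) ≤
      2 * conj φ τ v z ^ 2 + nullF φ κ τ v z := by
  have hVV : 0 ≤ ∑ i, dd (ex i) v z ^ 2 := Finset.sum_nonneg fun i _ => sq_nonneg _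
  have main := carleman_alg τ (lapl φ z) (v z) (dd et v z) (gsq φ z) (dd et φ z) (κ z)
    (dd et (gsq φ) z) (dd et (dd et φ) z) (fun i => dd (ex i) v z)
    (fun i => dd (ex i) (dd (ex i) v) z) (fun i => dd (ex i) φ z) (fun i => dd (ex i) κ z)
    (fun j => dd (ex j) (fun z => gsq φ z * dd (ex j) φ z) z)
    (fun j => dd (ex j) (fun z => dd et φ z * dd (ex j) φ z) z)
    (fun i j => dd (ex i) (dd (ex j) φ) z) rfl
  have hkV : |2 * v z * ∑ i, dd (ex i) κ z * dd (ex i) v z| ≤ c1 / 2 * (∑ i, dd (ex i) v z ^ 2)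
      + 2 / c1 * (∑ i, dd (ex i) κ z ^ 2) * v z ^ 2 := by
    rw [Finset.mul_sum, Finset.mul_sum, Finset.mul_sum, Finset.sum_mul, ← Finset.sum_add_distrib]
    refine (Finset.abs_sum_le_sum_abs _ _).trans (Finset.sum_le_sum fun i _ => ?_)
    generalize dd (ex i) κ z = k
    generalize dd (ex i) v z = w
    have : c1 / 2 * w ^ 2 + 2 / c1 * k ^ 2 * v z ^ 2 - 2 * v z * (k * w)
      = c1 / 2 * (w - 2 / c1 * k * v z) ^ 2 := by field_simp; ring
    have h2 : c1 / 2 * w ^ 2 + 2 / c1 * k ^ 2 * v z ^ 2 + 2 * v z * (k * w)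
      = c1 / 2 * (w + 2 / c1 * k * v z) ^ 2 := by field_simp; ring
    have : 0 ≤ c1 / 2 * (w - 2 / c1 * k * v z) ^ 2 := by positivity
    have : 0 ≤ c1 / 2 * (w + 2 / c1 * k * v z) ^ 2 := by positivity
    rw [abs_le]; constructor <;> linarith
  have hend := carleman_end (N := nullF φ κ τ v z) (P := conj φ τ v z) (T := lapl φ z) (l := lapl φ z ^ 2)
    (v := v z) (τ := τ) (X := dd et v z - ∑ i, dd (ex i) (dd (ex i) v) z
      + 2 * τ * ∑ i, dd (ex i) φ z * dd (ex i) v z - τ ^ 2 * gsq φ z * v z - τ * dd et φ z * v z)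
    hc0 hc1 hB0 hτ1 hτ2
    (H1 fun i => dd (ex i) v z) H2 b2
    b1 bk
    bl hkV (by unfold conj lapl; ring) rfl ?_
  · have q1 : min (c0 / 2) (c1 / 2) * (τ ^ 3 * v z ^ 2) ≤ c0 / 2 * (τ ^ 3 * v z ^ 2) := by
      gcongr; exact min_le_left _ _
    have q2 : min (c0 / 2) (c1 / 2) * (τ * ∑ i, dd (ex i) v z ^ 2) ≤ c1 / 2 * (τ * ∑ i, dd (ex i) v z ^ 2) := by
      gcongr; exact min_le_right _ _
    linarith
  · refine le_trans (le_of_eq ?_) main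
    ring

theorem carleman_int {d : ℕ} {φ κ v : Esp d → ℝ} (hφ : Sm φ) (hκ : Sm κ) (hv : Sm v) {K : Set (Esp d)}
    (hK : IsCompact K) (hsupp : tsupport v ⊆ K) {m τ : ℝ}
    (hptK : ∀ z ∈ K, m * (τ ^ 3 * v z ^ 2 + τ * ∑ i, dd (ex i) v z ^ 2) ≤
      2 * conj φ τ v z ^ 2 + nullF φ κ τ v z) :
    m * ∫ z, (τ ^ 3 * v z ^ 2 + τ * ∑ i, dd (ex i) v z ^ 2) ≤ 2 * ∫ z, conj φ τ v z ^ 2 := by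
  have hcs : HasCompactSupport v := hK.of_isClosed_subset (isClosed_tsupport v) hsupp
  have hN := carleman_null hφ hκ hv hcs τ
  have hconj_c : Continuous (conj φ τ v) := by
    have g1 := (hv.dd et).continuous
    have g2 := (lapl_sm hv).continuous
    have g3 := fun i => (hφ.dd (ex i)).continuous
    have g4 := fun i => (hv.dd (ex i)).continuous
    have g5 := (gsq_sm hφ).continuous
    have g6 := hv.continuous
    have g7 := (lapl_sm hφ).continuous
    have g8 := (hφ.dd et).continuous
    unfold conj
    fun_prop
  have hzero : ∀ z, z ∉ K → v z = 0 ∧ (∀ a, dd a v z = 0) ∧ (∀ a b, dd a (dd b v) z = 0) := by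
    intro z hz
    have e1 := notMem_tsupport_iff_eventuallyEq.1 (fun hc => hz (hsupp hc) : z ∉ tsupport v)
    have e2 := fun a => dd_zero_of_ev e1 a
    exact ⟨e1.self_of_nhds, fun a => (e2 a).self_of_nhds,
      fun a b => (dd_zero_of_ev (e2 b) a).self_of_nhds⟩
  have hpt : ∀ z, m * (τ ^ 3 * v z ^ 2 + τ * ∑ i, dd (ex i) v z ^ 2) ≤ 2 * conj φ τ v z ^ 2 + nullF φ κ τ v z := by
    intro z
    by_cases hz : z ∈ K
    · exact hptK z hz
    · obtain ⟨z0, z1, z2⟩ := hzero z hz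
      simp [nullF, z0, z1, z2, conj, lapl]
  have hI1 : Integrable fun z => conj φ τ v z ^ 2 := by
    refine Continuous.integrable_of_hasCompactSupport (hconj_c.pow 2)
      (HasCompactSupport.intro hK fun z hz => ?_)
    obtain ⟨z0, z1, z2⟩ := hzero z hz
    simp [z0, z1, z2, conj, lapl]
  have hI2 : Integrable fun z => (τ ^ 3 * v z ^ 2 + τ * ∑ i, dd (ex i) v z ^ 2) := by
    refine Continuous.integrable_of_hasCompactSupport ?_ (HasCompactSupport.intro hK fun z hz => ?_)
    · have g4 := fun i => (hv.dd (ex i)).continuous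
      have g6 := hv.continuous
      fun_prop
    · obtain ⟨z0, z1, z2⟩ := hzero z hz
      simp [z0, z1]
  have hIneq := integral_mono (hI2.const_mul m) ((hI1.const_mul 2).add hN.1) hpt
  rw [integral_const_mul] at hIneq
  simp only [Pi.add_apply] at hIneq
  rw [integral_add (hI1.const_mul 2) hN.1, hN.2, add_zero, integral_const_mul] at hIneq
  exact hIneq

theorem carleman_abs {d : ℕ} {φ κ : Esp d → ℝ} (hφ : Sm φ) (hκ : Sm κ) {K : Set (Esp d)}
    (hK : IsCompact K) {c0 c1 : ℝ} (hc0 : 0 < c0) (hc1 : 0 < c1)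
    (H1 : ∀ z ∈ K, ∀ ξ : Fin d → ℝ, c1 * ∑ i, ξ i ^ 2 ≤
      4 * ∑ i, ∑ j, dd (ex i) (dd (ex j) φ) z * ξ i * ξ j + 2 * (κ z - lapl φ z) * ∑ i, ξ i ^ 2)
    (H2 : ∀ z ∈ K, c0 ≤ 2 * ∑ j, dd (ex j) (fun z => gsq φ z * dd (ex j) φ z) z - 2 * κ z * gsq φ z) :
    ∃ C τ0 : ℝ, 0 < C ∧ 1 ≤ τ0 ∧ ∀ τ, τ0 ≤ τ → ∀ v : Esp d → ℝ, Sm v → tsupport v ⊆ K →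
      ∫ z, (τ ^ 3 * v z ^ 2 + τ * ∑ i, dd (ex i) v z ^ 2) ≤ C * ∫ z, conj φ τ v z ^ 2 := by
  obtain ⟨B2, hB2, b2⟩ := bdd_on_compact hK (g := fun z => dd et (gsq φ) z
    + 2 * ∑ j, dd (ex j) (fun z => dd et φ z * dd (ex j) φ z) z - 2 * κ z * dd et φ z - κ z ^ 2) (by
      have h1 := ((gsq_sm hφ).dd et).continuous
      have h2 := fun j => (Sm.dd ((hφ.dd et).mul (hφ.dd (ex j))) (ex j)).continuous
      have h3 := hκ.continuous
      have h4 := (hφ.dd et).continuous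
      fun_prop)
  obtain ⟨B1, hB1, b1⟩ := bdd_on_compact hK (g := dd et (dd et φ)) ((hφ.dd et).dd et).continuous
  obtain ⟨Bk, hBk, bk⟩ := bdd_on_compact hK (g := fun z => ∑ i, dd (ex i) κ z ^ 2) (by
      have h2 := fun j => (hκ.dd (ex j)).continuous
      fun_prop)
  obtain ⟨Bl, hBl, bl⟩ := bdd_on_compact hK (g := fun z => lapl φ z ^ 2) (by
      have h2 := (lapl_sm hφ).continuous
      fun_prop)
  obtain ⟨B, hB⟩ : ∃ B, B = B2 + B1 + Bk + Bl := ⟨_, rfl⟩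
  have hB0 : 0 ≤ B := by rw [hB]; positivity
  obtain ⟨m, hm⟩ : ∃ m, m = min (c0 / 2) (c1 / 2) := ⟨_, rfl⟩
  have hm0 : 0 < m := hm ▸ lt_min (by positivity) (by positivity)
  refine ⟨2 / m, max 1 (2 * (4 * B + B * (2 / c1)) / c0), by positivity, le_max_left _ _,
    fun τ hτ v hv hsupp => ?_⟩
  have hτ1 : 1 ≤ τ := (le_max_left _ _).trans hτ
  have hτ2 : 2 * (4 * B + B * (2 / c1)) ≤ c0 * τ := by
    have := (le_max_right _ _).trans hτ
    rw [div_le_iff₀ hc0] at this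
    linarith
  rw [div_mul_eq_mul_div, le_div_iff₀ hm0, mul_comm]
  refine carleman_int hφ hκ hv hK hsupp fun z hz => ?_
  rw [hm]
  exact carleman_pt hc0 hc1 hB0 hτ1 hτ2 (H1 z hz) (H2 z hz) ((b2 z hz).trans (by linarith))
        ((b1 z hz).trans (by linarith)) ((bk z hz).trans (by linarith)) ((bl z hz).trans (by linarith))

open Set MeasureTheory Filter Topology

theorem dd_exp {d : ℕ} {φ : Esp d → ℝ} (hφ : Sm φ) (τ : ℝ) (a z : Esp d) :
    dd a (fun z => Real.exp (τ * φ z)) z = τ * dd a φ z * Real.exp (τ * φ z) := by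
  unfold dd
  rw [fderiv_exp ((hφ.da z).const_mul τ), fderiv_const_mul (hφ.da z)]
  simp; ring

theorem exp_sm {d : ℕ} {φ : Esp d → ℝ} (hφ : Sm φ) (τ : ℝ) : Sm fun z => Real.exp (τ * φ z) :=
  (contDiff_const.mul hφ).exp

theorem dd_v {d : ℕ} {φ w : Esp d → ℝ} (hφ : Sm φ) (hw : Sm w) (τ : ℝ) (a : Esp d) :
    dd a (fun z => Real.exp (τ * φ z) * w z)
      = fun z => Real.exp (τ * φ z) * (dd a w z + τ * (dd a φ z * w z)) := by
  funext z
  rw [dd_mul (exp_sm hφ τ) hw, dd_exp hφ]; ring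

theorem dd_vv {d : ℕ} {φ w : Esp d → ℝ} (hφ : Sm φ) (hw : Sm w) (τ : ℝ) (a z : Esp d) :
    dd a (dd a (fun z => Real.exp (τ * φ z) * w z)) z
      = Real.exp (τ * φ z) * (dd a (dd a w) z + 2 * τ * (dd a φ z * dd a w z)
        + τ ^ 2 * dd a φ z ^ 2 * w z + τ * dd a (dd a φ) z * w z) := by
  rw [dd_v hφ hw τ a]
  have s1 : Sm fun z => dd a φ z * w z := (hφ.dd a).mul hw
  have s2 : Sm fun z => τ * (dd a φ z * w z) := contDiff_const.mul s1
  rw [dd_mul (exp_sm hφ τ) ((hw.dd a).add s2), dd_exp hφ]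
  rw [dd_add (hw.dd a) s2, dd_cmul s1, dd_mul (hφ.dd a) hw]
  ring

theorem conj_v {d : ℕ} {φ w : Esp d → ℝ} (hφ : Sm φ) (hw : Sm w) (τ : ℝ) (z : Esp d) :
    conj φ τ (fun z => Real.exp (τ * φ z) * w z) z
      = Real.exp (τ * φ z) * (dd et w z - lapl w z) := by
  have e1 : lapl (fun z => Real.exp (τ * φ z) * w z) z = Real.exp (τ * φ z) *
      (lapl w z + 2 * τ * (∑ i, dd (ex i) φ z * dd (ex i) w z) + τ ^ 2 * gsq φ z * w z
        + τ * lapl φ z * w z) := by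
    unfold lapl gsq
    simp only [dd_vv hφ hw]
    rw [← Finset.mul_sum]
    congr 1
    simp only [Finset.sum_add_distrib, ← Finset.mul_sum, ← Finset.sum_mul]
  have e2 : ∑ i, dd (ex i) φ z * dd (ex i) (fun z => Real.exp (τ * φ z) * w z) z
      = Real.exp (τ * φ z) * ((∑ i, dd (ex i) φ z * dd (ex i) w z) + τ * gsq φ z * w z) := by
    unfold gsq
    rw [Finset.mul_sum, Finset.sum_mul, ← Finset.sum_add_distrib, Finset.mul_sum]
    refine Finset.sum_congr rfl fun i _ => ?_
    rw [dd_v hφ hw]; ring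
  unfold conj
  rw [e1, e2, dd_v hφ hw]
  ring

theorem carleman_w {d : ℕ} {φ κ : Esp d → ℝ} (hφ : Sm φ) (hκ : Sm κ) {K : Set (Esp d)}
    (hK : IsCompact K) {c0 c1 : ℝ} (hc0 : 0 < c0) (hc1 : 0 < c1)
    (H1 : ∀ z ∈ K, ∀ ξ : Fin d → ℝ, c1 * ∑ i, ξ i ^ 2 ≤
      4 * ∑ i, ∑ j, dd (ex i) (dd (ex j) φ) z * ξ i * ξ j + 2 * (κ z - lapl φ z) * ∑ i, ξ i ^ 2)
    (H2 : ∀ z ∈ K, c0 ≤ 2 * ∑ j, dd (ex j) (fun z => gsq φ z * dd (ex j) φ z) z - 2 * κ z * gsq φ z) :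
    ∃ C τ0 : ℝ, 0 < C ∧ 1 ≤ τ0 ∧ ∀ τ, τ0 ≤ τ → ∀ w : Esp d → ℝ, Sm w → tsupport w ⊆ K →
      ∫ z, Real.exp (2 * τ * φ z) * (τ ^ 3 * w z ^ 2 + τ * ∑ i, dd (ex i) w z ^ 2)
        ≤ C * ∫ z, Real.exp (2 * τ * φ z) * (dd et w z - lapl w z) ^ 2 := by
  obtain ⟨C, τ0, hC, hτ0, H⟩ := carleman_abs hφ hκ hK hc0 hc1 H1 H2
  obtain ⟨B, hB, b⟩ := bdd_on_compact hK (gsq_sm hφ).continuous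
  refine ⟨(2 + 2 * B) * C, τ0, by positivity, hτ0, fun τ hτ w hw hsupp => ?_⟩
  have hE : ∀ z, Real.exp (2 * τ * φ z) = Real.exp (τ * φ z) ^ 2 := by
    intro z; rw [sq, ← Real.exp_add]; ring_nf
  have hτp : 0 < τ := by linarith
  have hv : Sm fun z => Real.exp (τ * φ z) * w z := (exp_sm hφ τ).mul hw
  have hsv : tsupport (fun z => Real.exp (τ * φ z) * w z) ⊆ K :=
    (tsupport_mul_subset_right).trans hsupp
  have h1 := H τ hτ _ hv hsv
  have e1 : (fun z => conj φ τ (fun z => Real.exp (τ * φ z) * w z) z ^ 2)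
      = fun z => Real.exp (2 * τ * φ z) * (dd et w z - lapl w z) ^ 2 := by
    funext z; rw [conj_v hφ hw, hE]; ring
  rw [e1] at h1
  have hzero : ∀ z, z ∉ K → w z = 0 ∧ ∀ a, dd a w z = 0 := by
    intro z hz
    have e1 := notMem_tsupport_iff_eventuallyEq.1 (fun hc => hz (hsupp hc) : z ∉ tsupport w)
    exact ⟨e1.self_of_nhds, fun a => (dd_zero_of_ev e1 a).self_of_nhds⟩
  rw [mul_assoc]
  refine le_trans ?_ (mul_le_mul_of_nonneg_left h1 (by positivity))
  rw [← integral_const_mul]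
  have cE : Continuous fun z : Esp d => Real.exp (τ * φ z) := (exp_sm hφ τ).continuous
  have g3 := fun i => (hφ.dd (ex i)).continuous
  have g4 := fun i => (hw.dd (ex i)).continuous
  have g6 := hw.continuous
  have hdv : ∀ i, ∀ z, dd (ex i) (fun z => Real.exp (τ * φ z) * w z) z
    = Real.exp (τ * φ z) * (dd (ex i) w z + τ * (dd (ex i) φ z * w z)) :=
    fun i z => congrFun (dd_v hφ hw τ (ex i)) z
  simp only [hdv, hE]
  refine integral_mono ?_ ?_ ?_
  · refine Continuous.integrable_of_hasCompactSupport ?_ (HasCompactSupport.intro hK fun z hz => ?_)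
    · fun_prop
    · obtain ⟨z0, z1⟩ := hzero z hz
      simp [z0, z1]
  · refine Continuous.integrable_of_hasCompactSupport ?_ (HasCompactSupport.intro hK fun z hz => ?_)
    · fun_prop
    · obtain ⟨z0, z1⟩ := hzero z hz
      simp [z0, z1]
  · intro z
    simp only
    by_cases hz : z ∈ K
    · have hb := (le_abs_self _).trans (b z hz)
      set E := Real.exp (τ * φ z)
      have k1 : E ^ 2 * ∑ i, dd (ex i) w z ^ 2 ≤
          2 * ∑ i, (E * (dd (ex i) w z + τ * (dd (ex i) φ z * w z))) ^ 2
            + 2 * τ ^ 2 * (E * w z) ^ 2 * gsq φ z := by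
        unfold gsq
        rw [Finset.mul_sum, Finset.mul_sum, Finset.mul_sum, ← Finset.sum_add_distrib]
        refine Finset.sum_le_sum fun i _ => ?_
        nlinarith [sq_nonneg (E * dd (ex i) w z + 2 * E * τ * (dd (ex i) φ z * w z))]
      have k2 : 2 * τ ^ 2 * (E * w z) ^ 2 * gsq φ z ≤ 2 * τ ^ 2 * (E * w z) ^ 2 * B := by gcongr
      have k3 := mul_le_mul_of_nonneg_left (k1.trans (add_le_add_right k2 _)) hτp.le
      have k4 : 0 ≤ ∑ i, (E * (dd (ex i) w z + τ * (dd (ex i) φ z * w z))) ^ 2 :=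
        Finset.sum_nonneg fun i _ => sq_nonneg _
      have k5 : 0 ≤ B * τ * ∑ i, (E * (dd (ex i) w z + τ * (dd (ex i) φ z * w z))) ^ 2 := by positivity
      have k6 : 0 ≤ τ ^ 3 * (E * w z) ^ 2 := by positivity
      nlinarith
    · obtain ⟨z0, z1⟩ := hzero z hz
      simp [z0, z1]

open Set MeasureTheory Filter Topology

/-! ## The concrete weight -/

/-- squared spatial distance -/
noncomputable def ss {d : ℕ} (y : Fin d → ℝ) (z : Esp d) : ℝ := ∑ i, (z.1 i - y i) ^ 2

noncomputable def ps {d : ℕ} (y : Fin d → ℝ) (t0 c : ℝ) (z : Esp d) : ℝ := ss y z + c * (z.2 - t0) ^ 2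

noncomputable def wt {d : ℕ} (y : Fin d → ℝ) (t0 c l : ℝ) (z : Esp d) : ℝ :=
  Real.exp (-l * ps y t0 c z)

section wt
variable {d : ℕ} (y : Fin d → ℝ) (t0 c l : ℝ)

theorem ss_sm : Sm (ss y) := by unfold ss Sm; fun_prop

theorem ps_sm : Sm (ps y t0 c) := by
  have h : ContDiff ℝ (⊤ : ℕ∞) (ss y) := ss_sm y
  unfold ps Sm; fun_prop

theorem wt_sm : Sm (wt y t0 c l) := exp_sm (ps_sm y t0 c) (-l)

theorem dd_X (i j : Fin d) (z : Esp d) :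
    dd (ex i) (fun z => z.1 j - y j) z = if j = i then 1 else 0 := by
  have h : HasFDerivAt (fun z : Esp d => z.1 j - y j)
      ((ContinuousLinearMap.proj (R := ℝ) (φ := fun _ : Fin d => ℝ) j).comp
        (ContinuousLinearMap.fst ℝ (Fin d → ℝ) ℝ)) z := by
    exact (ContinuousLinearMap.hasFDerivAt ((ContinuousLinearMap.proj (R := ℝ) (φ := fun _ : Fin d => ℝ) j).comp
        (ContinuousLinearMap.fst ℝ (Fin d → ℝ) ℝ))).sub_const _
  unfold dd
  rw [h.fderiv]
  simp [ex, Pi.single_apply]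

theorem X_sm (j : Fin d) : Sm fun z : Esp d => z.1 j - y j := by unfold Sm; fun_prop

theorem dd_sum {ι : Type*} (s : Finset ι) {g : ι → Esp d → ℝ} (hg : ∀ i, Sm (g i)) (a z : Esp d) :
    dd a (fun z => ∑ i ∈ s, g i z) z = ∑ i ∈ s, dd a (g i) z := by
  unfold dd
  rw [fderiv_fun_sum fun i _ => (hg i).da z]
  simp

theorem dd_ss (i : Fin d) (z : Esp d) : dd (ex i) (ss y) z = 2 * (z.1 i - y i) := by
  have : ss y = fun z => ∑ i, (z.1 i - y i) * (z.1 i - y i) := by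
    funext z; unfold ss; exact Finset.sum_congr rfl fun i _ => by ring
  rw [this, dd_sum _ fun j => (X_sm y j).mul (X_sm y j)]
  simp only [dd_mul (X_sm y _) (X_sm y _), dd_X]
  simp only [ite_mul, mul_ite, one_mul, mul_one, zero_mul, mul_zero, Finset.sum_add_distrib,
    Finset.sum_ite_eq', Finset.mem_univ, if_true]
  ring

theorem dd_ps (i : Fin d) (z : Esp d) : dd (ex i) (ps y t0 c) z = 2 * (z.1 i - y i) := by
  have h2 : HasFDerivAt (fun z : Esp d => c * (z.2 - t0) ^ 2)
      ((c * (2 * (z.2 - t0))) • (ContinuousLinearMap.snd ℝ (Fin d → ℝ) ℝ)) z := by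
    have h0 : HasDerivAt (fun t : ℝ => c * (t - t0) ^ 2) (c * (2 * (z.2 - t0))) z.2 := by
      have := (((hasDerivAt_id z.2).sub_const t0).pow 2).const_mul c
      simpa using this
    exact h0.comp_hasFDerivAt z hasFDerivAt_snd
  have e2 : dd (ex i) (fun z : Esp d => c * (z.2 - t0) ^ 2) z = 0 := by
    unfold dd; rw [h2.fderiv]; simp [ex]
  have : dd (ex i) (ps y t0 c) z = dd (ex i) (ss y) z + dd (ex i) (fun z : Esp d => c * (z.2 - t0) ^ 2) z :=
    dd_add (ss_sm y) (by unfold Sm; fun_prop) (ex i) z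
  rw [this, e2, dd_ss, add_zero]

theorem dd_wt (i : Fin d) :
    dd (ex i) (wt y t0 c l) = fun z => (-2 * l) * ((z.1 i - y i) * wt y t0 c l z) := by
  funext z
  have := dd_exp (ps_sm y t0 c) (-l) (ex i) z
  rw [dd_ps] at this
  unfold wt
  rw [this]; ring

theorem dd_dd_wt (i j : Fin d) (z : Esp d) :
    dd (ex i) (dd (ex j) (wt y t0 c l)) z =
      (4 * l ^ 2 * (z.1 i - y i) * (z.1 j - y j) - 2 * l * (if j = i then 1 else 0)) * wt y t0 c l z := by
  rw [dd_wt, dd_cmul ((X_sm y j).mul (wt_sm y t0 c l)), dd_mul (X_sm y j) (wt_sm y t0 c l), dd_X, dd_wt]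
  ring

theorem lapl_wt (z : Esp d) :
    lapl (wt y t0 c l) z = (4 * l ^ 2 * ss y z - 2 * l * d) * wt y t0 c l z := by
  unfold lapl ss
  simp only [dd_dd_wt]
  rw [← Finset.sum_mul]
  congr 1
  simp [Finset.sum_sub_distrib, Finset.mul_sum]
  congr 1
  · exact Finset.sum_congr rfl fun i _ => by ring
  · ring

theorem gsq_wt : gsq (wt y t0 c l) = fun z => 4 * l ^ 2 * (ss y z * (wt y t0 c l z * wt y t0 c l z)) := by
  funext z
  unfold gsq ss
  simp only [dd_wt]
  rw [Finset.sum_mul, Finset.mul_sum]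
  exact Finset.sum_congr rfl fun i _ => by ring

theorem hess_wt (z : Esp d) (ξ : Fin d → ℝ) :
    ∑ i, ∑ j, dd (ex i) (dd (ex j) (wt y t0 c l)) z * ξ i * ξ j
      = (4 * l ^ 2 * (∑ i, (z.1 i - y i) * ξ i) ^ 2 - 2 * l * ∑ i, ξ i ^ 2) * wt y t0 c l z := by
  simp only [dd_dd_wt]
  have : ∀ i j : Fin d, (4 * l ^ 2 * (z.1 i - y i) * (z.1 j - y j) - 2 * l * (if j = i then 1 else 0))
      * wt y t0 c l z * ξ i * ξ j = 4 * l ^ 2 * wt y t0 c l z * (((z.1 i - y i) * ξ i) * ((z.1 j - y j) * ξ j))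
        - (if j = i then 2 * l * wt y t0 c l z * ξ i ^ 2 else 0) := by
    intro i j
    split_ifs with h
    · subst h; ring
    · ring
  simp only [this, Finset.sum_sub_distrib, ← Finset.mul_sum, Finset.sum_ite_eq', Finset.mem_univ, if_true,
    ← Finset.sum_mul]
  ring

theorem div_wt (z : Esp d) :
    ∑ j, dd (ex j) (fun z => gsq (wt y t0 c l) z * dd (ex j) (wt y t0 c l) z) z
      = -8 * l ^ 3 * wt y t0 c l z ^ 3 * ((2 + d) * ss y z - 6 * l * ss y z ^ 2) := by
  have key : ∀ j, dd (ex j) (fun z => gsq (wt y t0 c l) z * dd (ex j) (wt y t0 c l) z) z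
     = -8 * l ^ 3 * wt y t0 c l z ^ 3 * (2 * (z.1 j - y j) ^ 2 + ss y z
        - 6 * l * ss y z * (z.1 j - y j) ^ 2) := by
    intro j
    have W := wt_sm y t0 c l
    rw [dd_mul (gsq_sm W) (W.dd (ex j)), dd_dd_wt, gsq_wt,
      dd_cmul ((ss_sm y).mul (W.mul W)), dd_mul (ss_sm y) (W.mul W), dd_mul W W, dd_ss, dd_wt]
    simp only [if_true]
    ring
  simp only [key]
  rw [← Finset.mul_sum]
  congr 1
  simp only [Finset.sum_sub_distrib, Finset.sum_add_distrib, ← Finset.mul_sum]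
  simp only [Finset.sum_const, Finset.card_univ, Fintype.card_fin, nsmul_eq_mul]
  have : ∑ i, (z.1 i - y i) ^ 2 = ss y z := rfl
  rw [this]; ring

end wt

theorem carleman_conc {d : ℕ} (y : Fin d → ℝ) (t0 c l : ℝ) {K : Set (Esp d)} (hK : IsCompact K) {r0 : ℝ}
    (hl : 0 < l) (hr0 : 0 < r0) (hlr : 2 ≤ l * r0) (hs : ∀ z ∈ K, r0 ≤ ss y z) :
    ∃ C τ0 : ℝ, 0 < C ∧ 1 ≤ τ0 ∧ ∀ τ, τ0 ≤ τ → ∀ w : Esp d → ℝ, Sm w → tsupport w ⊆ K →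
      ∫ z, Real.exp (2 * τ * wt y t0 c l z) * (τ ^ 3 * w z ^ 2 + τ * ∑ i, dd (ex i) w z ^ 2)
        ≤ C * ∫ z, Real.exp (2 * τ * wt y t0 c l z) * (dd et w z - lapl w z) ^ 2 := by
  obtain ⟨B, hB, b⟩ := bdd_on_compact hK (ps_sm y t0 c).continuous
  have W := wt_sm y t0 c l
  have hw0 : ∀ z ∈ K, Real.exp (-l * B) ≤ wt y t0 c l z := by
    intro z hz
    refine Real.exp_le_exp.2 ?_
    have := (le_abs_self _).trans (b z hz)
    nlinarith
  have hp : 0 < Real.exp (-l * B) := Real.exp_pos _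
  set f0 := Real.exp (-l * B)
  refine carleman_w (κ := fun z => lapl (wt y t0 c l) z + 5 * l * wt y t0 c l z) W
    ((lapl_sm W).add (contDiff_const.mul W)) hK (c0 := l ^ 3 * f0 ^ 3 * r0 * 56) (c1 := 2 * l * f0)
    (by positivity) (by positivity) ?_ ?_
  · intro z hz ξ
    rw [hess_wt]
    have h1 := hw0 z hz
    have h2 : 0 ≤ ∑ i, ξ i ^ 2 := Finset.sum_nonneg fun i _ => sq_nonneg _
    have h3 : 2 * l * f0 * ∑ i, ξ i ^ 2 ≤ 2 * l * wt y t0 c l z * ∑ i, ξ i ^ 2 := by gcongr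
    have h4 : 0 ≤ 16 * l ^ 2 * (∑ i, (z.1 i - y i) * ξ i) ^ 2 * wt y t0 c l z :=
      mul_nonneg (by positivity) (hp.le.trans h1)
    nlinarith
  · intro z hz
    rw [div_wt, gsq_wt, lapl_wt]
    have h1 := hw0 z hz
    have h2 := hs z hz
    have h3 : 56 ≤ 64 * l * ss y z - 72 := by
      have : l * r0 ≤ l * ss y z := by gcongr
      linarith
    have h4 : l ^ 3 * f0 ^ 3 * r0 * 56 ≤ l ^ 3 * wt y t0 c l z ^ 3 * ss y z * (64 * l * ss y z - 72) := by
      have : 0 < ss y z := by linarith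
      have h0 : 0 < wt y t0 c l z := by linarith
      gcongr
    refine h4.trans (le_of_eq ?_)
    ring

open Set MeasureTheory Filter Topology

/-! ## Mollification -/

/-- convolution -/
noncomputable def cv {d : ℕ} (η g : Esp d → ℝ) : Esp d → ℝ :=
  convolution η g (ContinuousLinearMap.lsmul ℝ ℝ) volume

theorem cv_apply {d : ℕ} (η g : Esp d → ℝ) (z : Esp d) : cv η g z = ∫ y, η y * g (z - y) := rfl

theorem ld_meas {d : ℕ} {w w' : Esp d → ℝ} {a : Esp d} (hw : Continuous w)
    (h : ∀ z, HasLineDerivAt ℝ w (w' z) z a) : Measurable w' := by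
  have : w' = fun z => lineDeriv ℝ w z a := funext fun z => (h z).lineDeriv.symm
  rw [this]
  exact measurable_lineDeriv hw

theorem cv_int {d : ℕ} {η g : Esp d → ℝ} (hη : Integrable η) (hg : Measurable g) {C : ℝ}
    (hC : ∀ z, |g z| ≤ C) (z : Esp d) : Integrable fun y => η y * g (z - y) := by
  refine hη.mul_bdd (c := C) ?_ ?_
  · exact (hg.comp (measurable_const.sub measurable_id)).aestronglyMeasurable
  · exact Eventually.of_forall fun y => hC _

theorem cv_ld {d : ℕ} {η w w' : Esp d → ℝ} {a : Esp d} (hη : Integrable η) (hw : Continuous w)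
    (h : ∀ z, HasLineDerivAt ℝ w (w' z) z a) {C C' : ℝ} (hC : ∀ z, |w z| ≤ C) (hC' : ∀ z, |w' z| ≤ C')
    (z : Esp d) : HasLineDerivAt ℝ (cv η w) (cv η w' z) z a := by
  have hm := ld_meas hw h
  have key := hasDerivAt_integral_of_dominated_loc_of_deriv_le (μ := (volume : Measure (Esp d)))
    (F := fun (r : ℝ) y => η y * w (z + r • a - y)) (F' := fun (r : ℝ) y => η y * w' (z + r • a - y))
    (x₀ := 0) (s := univ) (bound := fun y => |η y| * C') univ_mem
    (Eventually.of_forall fun r => (cv_int hη hw.measurable hC _).aestronglyMeasurable)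
    (cv_int hη hw.measurable hC _) (cv_int hη hm hC' _).aestronglyMeasurable
    (Eventually.of_forall fun y r _ => by
      rw [Real.norm_eq_abs, abs_mul]
      exact mul_le_mul_of_nonneg_left (hC' _) (abs_nonneg _))
    (hη.abs.mul_const C')
    (Eventually.of_forall fun y r _ => by
      have := (ld_add h (z - y) r).const_mul (η y)
      simp only [add_sub_right_comm]
      exact this)
  have k2 := key.2
  simp only [zero_smul, add_zero] at k2
  exact k2

theorem cv_sm {d : ℕ} {η w : Esp d → ℝ} (hη : Sm η) (hc : HasCompactSupport η) (hw : Continuous w) :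
    Sm (cv η w) :=
  hc.contDiff_convolution_left _ hη hw.locallyIntegrable

theorem cv_dd {d : ℕ} {η w w' : Esp d → ℝ} {a : Esp d} (hη : Sm η) (hc : HasCompactSupport η)
    (hw : Continuous w)
    (h : ∀ z, HasLineDerivAt ℝ w (w' z) z a) {C C' : ℝ} (hC : ∀ z, |w z| ≤ C) (hC' : ∀ z, |w' z| ≤ C') :
    dd a (cv η w) = cv η w' := by
  funext z
  have h1 := cv_ld (hη.continuous.integrable_of_hasCompactSupport hc) hw h hC hC' z
  have h2 := ((cv_sm hη hc hw).da z).hasFDerivAt.hasLineDerivAt a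
  unfold dd
  rw [← h2.lineDeriv, h1.lineDeriv]

theorem cv_bd {d : ℕ} {η g : Esp d → ℝ} (hη : Integrable η) (h0 : ∀ z, 0 ≤ η z) (h1 : ∫ z, η z = 1)
    {C : ℝ} (hC : ∀ z, |g z| ≤ C) (z : Esp d) : |cv η g z| ≤ C := by
  rw [cv_apply]
  have : ‖∫ y, η y * g (z - y)‖ ≤ ∫ y, η y * C := by
    refine norm_integral_le_of_norm_le (hη.mul_const C) (Eventually.of_forall fun y => ?_)
    rw [Real.norm_eq_abs, abs_mul, abs_of_nonneg (h0 y)]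
    exact mul_le_mul_of_nonneg_left (hC _) (h0 y)
  rwa [integral_mul_const, h1, one_mul] at this

/-- data of a rough function for the Carleman inequality -/
structure Rough {d : ℕ} (C : ℝ) (w : Esp d → ℝ) (w1 w2 : Fin d → Esp d → ℝ) (wt' G : Esp d → ℝ) : Prop where
  hc : Continuous w
  hc1 : ∀ i, Continuous (w1 i)
  hG : Continuous G
  h1 : ∀ i z, HasLineDerivAt ℝ w (w1 i z) z (ex i)
  h2 : ∀ i z, HasLineDerivAt ℝ (w1 i) (w2 i z) z (ex i)
  ht : ∀ z, HasLineDerivAt ℝ w (wt' z) z et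
  heq : ∀ z, G z = wt' z - ∑ i, w2 i z
  b0 : ∀ z, |w z| ≤ C
  b1 : ∀ i z, |w1 i z| ≤ C
  b2 : ∀ i z, |w2 i z| ≤ C
  bt : ∀ z, |wt' z| ≤ C
  bG : ∀ z, |G z| ≤ C

theorem rough_moll {d : ℕ} {C : ℝ} {w : Esp d → ℝ} {w1 w2 : Fin d → Esp d → ℝ} {wt' G : Esp d → ℝ}
    (hr : Rough C w w1 w2 wt' G) {η : Esp d → ℝ} (hη : Sm η) (hc : HasCompactSupport η) :
    (∀ i, dd (ex i) (cv η w) = cv η (w1 i)) ∧ ∀ z, dd et (cv η w) z - lapl (cv η w) z = cv η G z := by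
  have e1 : ∀ i, dd (ex i) (cv η w) = cv η (w1 i) := fun i => cv_dd hη hc hr.hc (hr.h1 i) hr.b0 (hr.b1 i)
  have hi : Integrable η := hη.continuous.integrable_of_hasCompactSupport hc
  refine ⟨e1, fun z => ?_⟩
  unfold lapl
  have e2 : ∀ i, dd (ex i) (cv η (w1 i)) = cv η (w2 i) :=
    fun i => cv_dd hη hc (hr.hc1 i) (hr.h2 i) (hr.b1 i) (hr.b2 i)
  simp only [e1, e2, cv_dd hη hc hr.hc hr.ht hr.b0 hr.bt, cv_apply]
  have m2 : ∀ i, Measurable (w2 i) := fun i => ld_meas (hr.hc1 i) (hr.h2 i)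
  have mt : Measurable wt' := ld_meas hr.hc hr.ht
  rw [← integral_finsetSum _ fun i _ => cv_int hi (m2 i) (hr.b2 i) z,
    ← integral_sub (cv_int hi mt hr.bt z) (integrable_finsetSum _ fun i _ => cv_int hi (m2 i) (hr.b2 i) z)]
  congr 1
  funext y
  rw [hr.heq, mul_sub, Finset.mul_sum]

theorem carleman_rough {d : ℕ} {φ : Esp d → ℝ} (hφ : Sm φ) {K : Set (Esp d)} (hK : IsCompact K) {A τ δ : ℝ}
    (hδ : 0 < δ)
    (H : ∀ w : Esp d → ℝ, Sm w → tsupport w ⊆ K →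
      ∫ z, Real.exp (2 * τ * φ z) * (τ ^ 3 * w z ^ 2 + τ * ∑ i, dd (ex i) w z ^ 2)
        ≤ A * ∫ z, Real.exp (2 * τ * φ z) * (dd et w z - lapl w z) ^ 2)
    {C : ℝ} {w : Esp d → ℝ} {w1 w2 : Fin d → Esp d → ℝ} {wt' G : Esp d → ℝ}
    (hr : Rough C w w1 w2 wt' G) (hsupp : ∀ z z', w z' ≠ 0 → dist z z' < δ → z ∈ K) :
    ∫ z, Real.exp (2 * τ * φ z) * (τ ^ 3 * w z ^ 2 + τ * ∑ i, w1 i z ^ 2)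
        ≤ A * ∫ z, Real.exp (2 * τ * φ z) * G z ^ 2 := by
  have hdn : ∀ n : ℕ, 0 < δ / (n + 1 : ℝ) := fun n => by positivity
  let b : ℕ → ContDiffBump (0 : Esp d) := fun n => ⟨δ / (n + 1 : ℝ) / 2, δ / (n + 1 : ℝ),
    half_pos (hdn n), half_lt_self (hdn n)⟩
  have hb0 : Tendsto (fun n => (b n).rOut) atTop (𝓝 0) := by
    show Tendsto (fun n : ℕ => δ / ((n : ℝ) + 1)) atTop (𝓝 0)
    have := (tendsto_one_div_add_atTop_nhds_zero_nat (𝕜 := ℝ)).const_mul δ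
    simpa [div_eq_mul_inv] using this
  let η : ℕ → Esp d → ℝ := fun n => (b n).normed volume
  have hη : ∀ n, Sm (η n) := fun n => (b n).contDiff_normed
  have hc : ∀ n, HasCompactSupport (η n) := fun n => (b n).hasCompactSupport_normed
  have hi : ∀ n, Integrable (η n) := fun n => (hη n).continuous.integrable_of_hasCompactSupport (hc n)
  have h0 : ∀ n z, 0 ≤ η n z := fun n z => (b n).nonneg_normed z
  have h1 : ∀ n, ∫ z, η n z = 1 := fun n => (b n).integral_normed
  have htend : ∀ {g : Esp d → ℝ}, Continuous g → ∀ z, Tendsto (fun n => cv (η n) g z) atTop (𝓝 (g z)) :=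
    fun hg z => ContDiffBump.convolution_tendsto_right_of_continuous hb0 hg z
  have hsm : ∀ n, Sm (cv (η n) w) := fun n => cv_sm (hη n) (hc n) hr.hc
  have hts : ∀ n, tsupport (cv (η n) w) ⊆ K := by
    intro n
    refine closure_minimal (fun z hz => ?_) hK.isClosed
    by_contra hzK
    refine hz ?_
    rw [cv_apply]
    refine integral_eq_zero_of_ae (Eventually.of_forall fun y => ?_)
    by_contra hy
    have hy1 : η n y ≠ 0 := fun hh => hy (by simp [hh])
    have hy2 : w (z - y) ≠ 0 := fun hh => hy (by simp [hh])
    refine hzK (hsupp z (z - y) hy2 ?_)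
    have : y ∈ Metric.ball (0 : Esp d) (b n).rOut := by
      rw [← (b n).support_normed_eq (μ := volume)]; exact hy1
    rw [mem_ball_zero_iff] at this
    rw [dist_eq_norm, sub_sub_cancel]
    refine this.trans_le ?_
    show δ / ((n : ℝ) + 1) ≤ δ
    exact div_le_self hδ.le (by linarith [(Nat.cast_nonneg n : (0 : ℝ) ≤ n)])
  have hfac := fun n => rough_moll hr (hη n) (hc n)
  have hin := fun n => H _ (hsm n) (hts n)
  simp only [(hfac _).1, (hfac _).2] at hin
  have hzero : ∀ n z, z ∉ K → cv (η n) w z = 0 ∧ (∀ i, cv (η n) (w1 i) z = 0) ∧ cv (η n) G z = 0 := by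
    intro n z hz
    have e1 := notMem_tsupport_iff_eventuallyEq.1 (fun hcc => hz (hts n hcc) : z ∉ tsupport _)
    refine ⟨e1.self_of_nhds, fun i => ?_, ?_⟩
    · rw [← (hfac n).1 i]; exact (dd_zero_of_ev e1 (ex i)).self_of_nhds
    · rw [← (hfac n).2 z, (dd_zero_of_ev e1 et).self_of_nhds]
      unfold lapl
      rw [Finset.sum_eq_zero fun i _ => ?_, sub_zero]
      exact (dd_zero_of_ev (dd_zero_of_ev e1 (ex i)) (ex i)).self_of_nhds
  have cE : Continuous fun z : Esp d => Real.exp (2 * τ * φ z) := (exp_sm hφ (2 * τ)).continuous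
  have dct : ∀ (F : ℕ → Esp d → ℝ) (F0 : Esp d → ℝ) (D : ℝ), (∀ n, Continuous (F n)) →
      (∀ n z, z ∉ K → F n z = 0) → (∀ n z, |F n z| ≤ D) → (∀ z, Tendsto (fun n => F n z) atTop (𝓝 (F0 z))) →
      Tendsto (fun n => ∫ z, Real.exp (2 * τ * φ z) * F n z) atTop
        (𝓝 (∫ z, Real.exp (2 * τ * φ z) * F0 z)) := by
    intro F F0 D hF hF0 hFD hlim
    have hD : 0 ≤ D := (abs_nonneg _).trans (hFD 0 0)
    refine tendsto_integral_of_dominated_convergence (K.indicator fun z => Real.exp (2 * τ * φ z) * D)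
      (fun n => (cE.mul (hF n)).aestronglyMeasurable) ?_ ?_ ?_
    · rw [integrable_indicator_iff hK.measurableSet]
      exact (cE.mul continuous_const).continuousOn.integrableOn_compact hK
    · intro n
      refine Eventually.of_forall fun z => ?_
      by_cases hz : z ∈ K
      · rw [indicator_of_mem hz, Real.norm_eq_abs, abs_mul, abs_of_pos (Real.exp_pos _)]
        exact mul_le_mul_of_nonneg_left (hFD n z) (Real.exp_pos _).le
      · rw [indicator_of_notMem hz, hF0 n z hz]; simp
    · exact Eventually.of_forall fun z => (hlim z).const_mul _
  have bw : ∀ n z, |cv (η n) w z| ≤ C := fun n z => cv_bd (hi n) (h0 n) (h1 n) hr.b0 z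
  have bw1 : ∀ n i z, |cv (η n) (w1 i) z| ≤ C := fun n i z => cv_bd (hi n) (h0 n) (h1 n) (hr.b1 i) z
  have bG : ∀ n z, |cv (η n) G z| ≤ C := fun n z => cv_bd (hi n) (h0 n) (h1 n) hr.bG z
  have sqb : ∀ x : ℝ, |x| ≤ C → |x ^ 2| ≤ C ^ 2 := by
    intro x hx
    rw [abs_pow]; exact pow_le_pow_left₀ (abs_nonneg _) hx 2
  have cw : ∀ n, Continuous (cv (η n) w) := fun n => (hsm n).continuous
  have cw1 : ∀ n i, Continuous (cv (η n) (w1 i)) := fun n i => (cv_sm (hη n) (hc n) (hr.hc1 i)).continuous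
  have cG : ∀ n, Continuous (cv (η n) G) := fun n => (cv_sm (hη n) (hc n) hr.hG).continuous
  have L := dct (fun n z => τ ^ 3 * cv (η n) w z ^ 2 + τ * ∑ i, cv (η n) (w1 i) z ^ 2)
    (fun z => τ ^ 3 * w z ^ 2 + τ * ∑ i, w1 i z ^ 2) (|τ ^ 3| * C ^ 2 + |τ| * ∑ _i : Fin d, C ^ 2)
    (fun n => by have := cw n; have := cw1 n; fun_prop)
    (fun n z hz => by obtain ⟨z0, z1, z2⟩ := hzero n z hz; simp [z0, z1])
    (fun n z => by
      refine (abs_add_le _ _).trans (add_le_add ?_ ?_)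
      · rw [abs_mul]; exact mul_le_mul_of_nonneg_left (sqb _ (bw n z)) (abs_nonneg _)
      · rw [abs_mul]
        refine mul_le_mul_of_nonneg_left ((Finset.abs_sum_le_sum_abs _ _).trans
          (Finset.sum_le_sum fun i _ => sqb _ (bw1 n i z))) (abs_nonneg _))
    (fun z => (((htend hr.hc z).pow 2).const_mul _).add
      ((tendsto_finsetSum _ fun i _ => (htend (hr.hc1 i) z).pow 2).const_mul _))
  have R := dct (fun n z => cv (η n) G z ^ 2) (fun z => G z ^ 2) (C ^ 2) (fun n => (cG n).pow 2)
    (fun n z hz => by obtain ⟨z0, z1, z2⟩ := hzero n z hz; simp [z2])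
    (fun n z => sqb _ (bG n z)) (fun z => (htend hr.hG z).pow 2)
  exact le_of_tendsto_of_tendsto' L (R.const_mul A) hin

open Set MeasureTheory Filter Topology

/-! ## Unique continuation: the core step -/

theorem ld_mul {d : ℕ} {χ g : Esp d → ℝ} {a z : Esp d} {g' : ℝ} (hχ : Sm χ)
    (h : HasLineDerivAt ℝ g g' z a) :
    HasLineDerivAt ℝ (fun z => χ z * g z) (dd a χ z * g z + χ z * g') z a := by
  have h1 : HasLineDerivAt ℝ χ (dd a χ z) z a := (hχ.da z).hasFDerivAt.hasLineDerivAt a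
  unfold HasLineDerivAt at *
  have := h1.fun_mul h
  simpa using this

theorem ld_plus {d : ℕ} {f g : Esp d → ℝ} {a z : Esp d} {f' g' : ℝ} (hf : HasLineDerivAt ℝ f f' z a)
    (h : HasLineDerivAt ℝ g g' z a) :
    HasLineDerivAt ℝ (fun z => f z + g z) (f' + g') z a := by
  unfold HasLineDerivAt at *
  exact hf.add h

theorem chi_bound {d : ℕ} {χ : Esp d → ℝ} (hχ : Sm χ) (hc : HasCompactSupport χ) :
    ∃ M, 0 ≤ M ∧ ∀ z, |χ z| ≤ M ∧ |dd et χ z| ≤ M ∧ (∀ i, |dd (ex i) χ z| ≤ M) ∧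
      ∀ i, |dd (ex i) (dd (ex i) χ) z| ≤ M := by
  have c1 := hχ.continuous
  have c2 := (hχ.dd et).continuous
  have c3 := fun i => (hχ.dd (ex i)).continuous
  have c4 := fun i => ((hχ.dd (ex i)).dd (ex i)).continuous
  obtain ⟨M, hM⟩ := HasCompactSupport.exists_bound_of_continuous
    (f := fun z => |χ z| + |dd et χ z| + ∑ i, |dd (ex i) χ z| + ∑ i, |dd (ex i) (dd (ex i) χ) z|)
    (HasCompactSupport.intro (K := tsupport χ) hc fun z hz => by
      have e1 := notMem_tsupport_iff_eventuallyEq.1 hz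
      have e2 := fun a => (dd_zero_of_ev e1 a)
      simp [e1.self_of_nhds, (e2 _).self_of_nhds, (dd_zero_of_ev (e2 _) _).self_of_nhds])
    (by fun_prop)
  have p3 : ∀ z, 0 ≤ ∑ i, |dd (ex i) χ z| := fun z => Finset.sum_nonneg fun i _ => abs_nonneg _
  have p4 : ∀ z, 0 ≤ ∑ i, |dd (ex i) (dd (ex i) χ) z| := fun z => Finset.sum_nonneg fun i _ => abs_nonneg _
  have hM' : ∀ z, |χ z| + |dd et χ z| + ∑ i, |dd (ex i) χ z| + ∑ i, |dd (ex i) (dd (ex i) χ) z| ≤ M :=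
    fun z => (le_abs_self _).trans (hM z)
  have q1 := fun z => abs_nonneg (χ z)
  have q2 := fun z => abs_nonneg (dd et χ z)
  refine ⟨M, ?_, fun z => ⟨?_, ?_, fun i => ?_, fun i => ?_⟩⟩
  · linarith [hM' 0, q1 0, q2 0, p3 0, p4 0]
  · linarith [hM' z, q1 z, q2 z, p3 z, p4 z]
  · linarith [hM' z, q1 z, q2 z, p3 z, p4 z]
  · have := Finset.single_le_sum (f := fun i => |dd (ex i) χ z|) (fun i _ => abs_nonneg _) (Finset.mem_univ i)
    linarith [hM' z, q1 z, q2 z, p3 z, p4 z]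
  · have := Finset.single_le_sum (f := fun i => |dd (ex i) (dd (ex i) χ) z|) (fun i _ => abs_nonneg _)
      (Finset.mem_univ i)
    linarith [hM' z, q1 z, q2 z, p3 z, p4 z]

theorem rough_mul {d : ℕ} {C : ℝ} {W : Esp d → ℝ} {W1 W2 : Fin d → Esp d → ℝ} {Wt F : Esp d → ℝ}
    (hr : Rough C W W1 W2 Wt F) {χ : Esp d → ℝ} (hχ : Sm χ) (hc : HasCompactSupport χ) :
    ∃ C', Rough C' (fun z => χ z * W z) (fun i z => dd (ex i) χ z * W z + χ z * W1 i z)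
      (fun i z => (dd (ex i) (dd (ex i) χ) z * W z + dd (ex i) χ z * W1 i z)
        + (dd (ex i) χ z * W1 i z + χ z * W2 i z))
      (fun z => dd et χ z * W z + χ z * Wt z)
      (fun z => (dd et χ z - lapl χ z) * W z - 2 * (∑ i, dd (ex i) χ z * W1 i z) + χ z * F z) := by
  obtain ⟨M, hM0, hM⟩ := chi_bound hχ hc
  have hC : 0 ≤ C := (abs_nonneg _).trans (hr.b0 0)
  have c1 := hχ.continuous
  have c2 := (hχ.dd et).continuous
  have c3 := fun i => (hχ.dd (ex i)).continuous
  have c4 := (lapl_sm hχ).continuous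
  have d1 := hr.hc
  have d2 := hr.hc1
  have d3 := hr.hG
  have mm : ∀ a b : ℝ, |a| ≤ M → |b| ≤ C → |a * b| ≤ M * C := fun a b ha hb => by
    rw [abs_mul]; exact mul_le_mul ha hb (abs_nonneg _) hM0
  have hMC : 0 ≤ M * C := by positivity
  have hd : (0 : ℝ) ≤ d := Nat.cast_nonneg d
  have hdM : 0 ≤ d * (M * C) := by positivity
  have B2 : ∀ i z, |(dd (ex i) (dd (ex i) χ) z * W z + dd (ex i) χ z * W1 i z)
        + (dd (ex i) χ z * W1 i z + χ z * W2 i z)| ≤ 4 * (M * C) := by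
    intro i z
    have a1 := mm _ _ ((hM z).2.2.2 i) (hr.b0 z)
    have a2 := mm _ _ ((hM z).2.2.1 i) (hr.b1 i z)
    have a3 := mm _ _ (hM z).1 (hr.b2 i z)
    rw [abs_le] at *; constructor <;> linarith
  have Bt : ∀ z, |dd et χ z * W z + χ z * Wt z| ≤ 2 * (M * C) := by
    intro z
    have a1 := mm _ _ ((hM z).2.1) (hr.b0 z)
    have a3 := mm _ _ (hM z).1 (hr.bt z)
    rw [abs_le] at *; constructor <;> linarith
  have E : ∀ z, (dd et χ z - lapl χ z) * W z - 2 * (∑ i, dd (ex i) χ z * W1 i z) + χ z * F z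
      = (dd et χ z * W z + χ z * Wt z) - ∑ i, ((dd (ex i) (dd (ex i) χ) z * W z + dd (ex i) χ z * W1 i z)
        + (dd (ex i) χ z * W1 i z + χ z * W2 i z)) := by
    intro z
    rw [hr.heq]
    simp only [Finset.sum_add_distrib, lapl, ← Finset.sum_mul, ← Finset.mul_sum]
    ring
  refine ⟨(4 * d + 4) * (M * C), ⟨by fun_prop, fun i => by have := d2 i; have := c3 i; fun_prop, ?_,
    fun i z => ld_mul hχ (hr.h1 i z), fun i z => ?_, fun z => ld_mul hχ (hr.ht z), E, ?_, ?_, ?_, ?_, ?_⟩⟩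
  · fun_prop
  · exact ld_plus (ld_mul (hχ.dd (ex i)) (hr.h1 i z)) (ld_mul hχ (hr.h2 i z))
  · intro z
    have := mm _ _ (hM z).1 (hr.b0 z)
    nlinarith
  · intro i z
    have a2 := mm _ _ ((hM z).2.2.1 i) (hr.b0 z)
    have a3 := mm _ _ (hM z).1 (hr.b1 i z)
    rw [abs_le] at *; constructor <;> nlinarith
  · intro i z
    refine (B2 i z).trans ?_
    nlinarith
  · intro z
    refine (Bt z).trans ?_
    nlinarith
  · intro z
    rw [E]
    refine (abs_sub _ _).trans ?_
    have h1 := Bt z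
    have h2 : |∑ i, ((dd (ex i) (dd (ex i) χ) z * W z + dd (ex i) χ z * W1 i z)
        + (dd (ex i) χ z * W1 i z + χ z * W2 i z))| ≤ d * (4 * (M * C)) := by
      refine (Finset.abs_sum_le_sum_abs _ _).trans ((Finset.sum_le_sum fun i _ => B2 i z).trans ?_)
      simp
    nlinarith

theorem ps_compact {d : ℕ} (y : Fin d → ℝ) (t0 : ℝ) {c : ℝ} (hc : 0 < c) (q : ℝ) :
    IsCompact {z : Esp d | ps y t0 c z ≤ q} := by
  have hcl : IsClosed {z : Esp d | ps y t0 c z ≤ q} :=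
    isClosed_le (ps_sm y t0 c).continuous continuous_const
  refine IsCompact.of_isClosed_subset (isCompact_Icc (a := ((fun i => y i - (|q| + 1), t0 - (|q| / c + 1)) : Esp d))
    (b := ((fun i => y i + (|q| + 1), t0 + (|q| / c + 1)) : Esp d))) hcl ?_
  intro z hz
  have hz : ps y t0 c z ≤ q := hz
  have hq := le_abs_self q
  unfold ps ss at hz
  have p1 : 0 ≤ ∑ i, (z.1 i - y i) ^ 2 := Finset.sum_nonneg fun i _ => sq_nonneg _
  have p2 : ∀ i, (z.1 i - y i) ^ 2 ≤ ∑ i, (z.1 i - y i) ^ 2 := fun i =>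
    Finset.single_le_sum (f := fun i => (z.1 i - y i) ^ 2) (fun i _ => sq_nonneg _) (Finset.mem_univ i)
  have p3 : 0 ≤ c * (z.2 - t0) ^ 2 := by positivity
  have A : ∀ x b : ℝ, 0 ≤ b → x ^ 2 ≤ b → |x| ≤ b + 1 := by
    intro x b hb h
    rw [← sq_abs] at h
    nlinarith [sq_nonneg (|x| - 1), abs_nonneg x]
  have a1 : ∀ i, |z.1 i - y i| ≤ |q| + 1 := fun i => A _ _ (abs_nonneg q) (by linarith [p2 i])
  have a2 : |z.2 - t0| ≤ |q| / c + 1 := A _ _ (by positivity) (by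
    rw [le_div_iff₀ hc]; linarith)
  refine ⟨⟨fun i => ?_, ?_⟩, fun i => ?_, ?_⟩
  · have := (abs_le.1 (a1 i)).1; simp only; linarith
  · have := (abs_le.1 a2).1; simp only; linarith
  · have := (abs_le.1 (a1 i)).2; simp only; linarith
  · have := (abs_le.1 a2).2; simp only; linarith

open Set MeasureTheory Filter Topology

/-- cut-off in terms of `ps` -/
noncomputable def chi {d : ℕ} (y : Fin d → ℝ) (t0 c q : ℝ) (z : Esp d) : ℝ :=
  Real.smoothTransition (3 - 4 * ps y t0 c z / q)

theorem chi_sm {d : ℕ} (y : Fin d → ℝ) (t0 c q : ℝ) : Sm (chi y t0 c q) := by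
  refine Real.smoothTransition.contDiff.comp ?_
  exact contDiff_const.sub ((contDiff_const.mul (ps_sm y t0 c)).div_const q)

theorem chi_one {d : ℕ} {y : Fin d → ℝ} {t0 c q : ℝ} (hq : 0 < q) {z : Esp d} (h : ps y t0 c z ≤ q / 2) :
    chi y t0 c q z = 1 := by
  refine Real.smoothTransition.one_of_one_le ?_
  have : 4 * ps y t0 c z / q ≤ 2 := by rw [div_le_iff₀ hq]; linarith
  linarith

theorem chi_zero {d : ℕ} {y : Fin d → ℝ} {t0 c q : ℝ} (hq : 0 < q) {z : Esp d} (h : 3 * q / 4 ≤ ps y t0 c z) :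
    chi y t0 c q z = 0 := by
  refine Real.smoothTransition.zero_of_nonpos ?_
  have : 3 ≤ 4 * ps y t0 c z / q := by rw [le_div_iff₀ hq]; linarith
  linarith

theorem sum_sq_bound {d : ℕ} {L a g : ℝ} {b : Fin d → ℝ} (hL : 0 ≤ L) (h : |g| ≤ L * (|a| + ∑ i, |b i|)) :
    g ^ 2 ≤ L ^ 2 * (d + 1) * (a ^ 2 + ∑ i, b i ^ 2) := by
  have h1 : (∑ i, |b i|) ^ 2 ≤ d * ∑ i, b i ^ 2 := by
    have := sq_sum_le_card_mul_sum_sq (s := Finset.univ) (f := fun i => |b i|)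
    simpa using this
  have h0 : 0 ≤ ∑ i, |b i| := Finset.sum_nonneg fun i _ => abs_nonneg _
  have h2 : (|a| + ∑ i, |b i|) ^ 2 ≤ (d + 1) * (a ^ 2 + ∑ i, b i ^ 2) := by
    have hs : 0 ≤ ∑ i, b i ^ 2 := Finset.sum_nonneg fun i _ => sq_nonneg _
    have e1 : |a| ^ 2 = a ^ 2 := sq_abs a
    generalize hS : ∑ i, |b i| = S at *
    generalize hT : ∑ i, b i ^ 2 = T at *
    have hd0 : (0 : ℝ) ≤ d := Nat.cast_nonneg d
    have e2 : 2 * |a| * S ≤ d * a ^ 2 + T := by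
      rcases Nat.eq_zero_or_pos d with hd | hd
      · subst hd
        have : S ^ 2 ≤ 0 := by simpa using h1
        have : S = 0 := by nlinarith
        rw [this]; simp; exact hs
      · have hd' : (0 : ℝ) < d := Nat.cast_pos.2 hd
        have : d * (2 * |a| * S) ≤ d * (d * a ^ 2 + T) := by
          have h5 := sq_nonneg ((d:ℝ) * |a| - S)
          have h6 : ((d:ℝ) * |a| - S) ^ 2 = d ^ 2 * |a| ^ 2 - 2 * d * |a| * S + S ^ 2 := by ring
          rw [h6, e1] at h5
          linarith
        exact le_of_mul_le_mul_left this hd'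
    nlinarith
  have h3 : g ^ 2 ≤ (L * (|a| + ∑ i, |b i|)) ^ 2 := by
    rw [← sq_abs g]; exact pow_le_pow_left₀ (abs_nonneg _) h 2
  rw [mul_pow] at h3
  have := mul_le_mul_of_nonneg_left h2 (sq_nonneg L)
  nlinarith

/-- absorption argument in the Carleman inequality -/
theorem carleman_absorb {d : ℕ} {φ : Esp d → ℝ} (hφ : Sm φ) {K S B : Set (Esp d)} (hK : IsCompact K)
    (hS : IsCompact S) (hB : MeasurableSet B) {A τ C2 C3 e : ℝ} (hA : 0 < A) (hτ : 1 ≤ τ)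
    (hAC : 2 * (A * C2) ≤ τ) (hC3 : 0 ≤ C3) (hC2 : 0 ≤ C2)
    {w : Esp d → ℝ} {w1 : Fin d → Esp d → ℝ} {G : Esp d → ℝ}
    (cw : Continuous w) (cw1 : ∀ i, Continuous (w1 i)) (cG : Continuous G)
    (hz : ∀ z, z ∉ K → w z = 0 ∧ (∀ i, w1 i z = 0) ∧ G z = 0)
    (hG : ∀ z, z ∉ S → G z ^ 2 ≤ C2 * (w z ^ 2 + ∑ i, w1 i z ^ 2))
    (hG2 : ∀ z, G z ^ 2 ≤ C3)
    (hS2 : ∀ z ∈ S, φ z ≤ e) (hB2 : ∀ z ∈ B, e ≤ φ z)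
    (H : ∫ z, Real.exp (2 * τ * φ z) * (τ ^ 3 * w z ^ 2 + τ * ∑ i, w1 i z ^ 2)
        ≤ A * ∫ z, Real.exp (2 * τ * φ z) * G z ^ 2) :
    τ * ∫ z in B, w z ^ 2 ≤ 2 * A * C3 * (volume S).toReal := by
  have cE : Continuous fun z : Esp d => Real.exp (2 * τ * φ z) := (exp_sm hφ (2 * τ)).continuous
  have hτ0 : 0 < τ := by linarith
  have I1 : Integrable fun z => Real.exp (2 * τ * φ z) * (τ ^ 3 * w z ^ 2 + τ * ∑ i, w1 i z ^ 2) := by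
    refine Continuous.integrable_of_hasCompactSupport (by fun_prop) (HasCompactSupport.intro hK fun z h => ?_)
    obtain ⟨z0, z1, z2⟩ := hz z h
    simp [z0, z1]
  have IG : Integrable fun z => Real.exp (2 * τ * φ z) * G z ^ 2 := by
    refine Continuous.integrable_of_hasCompactSupport (by fun_prop) (HasCompactSupport.intro hK fun z h => ?_)
    obtain ⟨z0, z1, z2⟩ := hz z h
    simp [z2]
  have Iw : Integrable fun z => w z ^ 2 := by
    refine Continuous.integrable_of_hasCompactSupport (by fun_prop) (HasCompactSupport.intro hK fun z h => ?_)
    obtain ⟨z0, z1, z2⟩ := hz z h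
    simp [z0]
  have IS : Integrable (S.indicator fun _ => Real.exp (2 * τ * e) * C3) := by
    rw [integrable_indicator_iff hS.measurableSet]
    exact continuousOn_const.integrableOn_compact hS
  have IB : Integrable (B.indicator fun z => Real.exp (2 * τ * e) * (τ * w z ^ 2)) :=
    ((Iw.const_mul τ).const_mul _).indicator hB
  have pt : ∀ z, B.indicator (fun z => Real.exp (2 * τ * e) * (τ * w z ^ 2)) z
      + 2 * A * (Real.exp (2 * τ * φ z) * G z ^ 2) ≤
      2 * (Real.exp (2 * τ * φ z) * (τ ^ 3 * w z ^ 2 + τ * ∑ i, w1 i z ^ 2))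
        + 2 * A * S.indicator (fun _ => Real.exp (2 * τ * e) * C3) z := by
    intro z
    have hs : 0 ≤ ∑ i, w1 i z ^ 2 := Finset.sum_nonneg fun i _ => sq_nonneg _
    have hE := Real.exp_pos (2 * τ * φ z)
    have b1 : B.indicator (fun z => Real.exp (2 * τ * e) * (τ * w z ^ 2)) z ≤
        Real.exp (2 * τ * φ z) * (τ ^ 3 * w z ^ 2) := by
      by_cases h : z ∈ B
      · rw [indicator_of_mem h]
        have h1 : Real.exp (2 * τ * e) ≤ Real.exp (2 * τ * φ z) :=
          Real.exp_le_exp.2 (mul_le_mul_of_nonneg_left (hB2 z h) (by positivity))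
        have h2 : τ ≤ τ ^ 3 := by nlinarith [sq_nonneg τ]
        gcongr
      · rw [indicator_of_notMem h]; positivity
    by_cases h : z ∈ S
    · rw [indicator_of_mem h]
      have h1 : Real.exp (2 * τ * φ z) ≤ Real.exp (2 * τ * e) :=
        Real.exp_le_exp.2 (mul_le_mul_of_nonneg_left (hS2 z h) (by positivity))
      have h2 : Real.exp (2 * τ * φ z) * G z ^ 2 ≤ Real.exp (2 * τ * e) * C3 :=
        mul_le_mul h1 (hG2 z) (sq_nonneg _) (Real.exp_pos _).le
      have h3 := mul_le_mul_of_nonneg_left h2 hA.le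
      have h4 : 0 ≤ Real.exp (2 * τ * φ z) * (τ ^ 3 * w z ^ 2) := by positivity
      have h5 : 0 ≤ Real.exp (2 * τ * φ z) * (τ * ∑ i, w1 i z ^ 2) := by positivity
      nlinarith
    · rw [indicator_of_notMem h]
      have h2 := mul_le_mul_of_nonneg_left (hG z h) (mul_pos (mul_pos two_pos hA) hE).le
      have h3 : 2 * (A * C2) * (w z ^ 2 + ∑ i, w1 i z ^ 2) ≤ τ * (w z ^ 2 + ∑ i, w1 i z ^ 2) := by gcongr
      have h6 : τ * w z ^ 2 ≤ τ ^ 3 * w z ^ 2 := by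
        have h2 : τ ≤ τ ^ 3 := by nlinarith [sq_nonneg τ]
        gcongr
      have h4 : 0 ≤ τ * ∑ i, w1 i z ^ 2 := by positivity
      have h7 : 2 * (A * C2) * (w z ^ 2 + ∑ i, w1 i z ^ 2) ≤ τ ^ 3 * w z ^ 2 + 2 * (τ * ∑ i, w1 i z ^ 2) := by
        nlinarith
      have h8 := mul_le_mul_of_nonneg_left h7 hE.le
      nlinarith
  have hIneq := integral_mono (IB.add (IG.const_mul (2 * A))) ((I1.const_mul 2).add (IS.const_mul (2 * A))) pt
  simp only [Pi.add_apply] at hIneq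
  rw [integral_add IB (IG.const_mul (2 * A)), integral_add (I1.const_mul 2) (IS.const_mul (2 * A)),
    integral_const_mul, integral_const_mul, integral_const_mul, integral_indicator hB,
    integral_indicator hS.measurableSet, integral_const_mul, integral_const_mul, setIntegral_const] at hIneq
  have hfin : Real.exp (2 * τ * e) * (τ * ∫ z in B, w z ^ 2) ≤
      Real.exp (2 * τ * e) * (2 * A * C3 * (volume S).toReal) := by
    simp only [smul_eq_mul, Measure.real] at hIneq
    nlinarith
  exact le_of_mul_le_mul_left hfin (Real.exp_pos _)

open Set MeasureTheory Filter Topology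

theorem ss_nonneg {d : ℕ} (y : Fin d → ℝ) (z : Esp d) : 0 ≤ ss y z :=
  Finset.sum_nonneg fun i _ => sq_nonneg _

theorem lapl_of_dd {d : ℕ} {χ : Esp d → ℝ} {z : Esp d} (h : ∀ i, dd (ex i) χ =ᶠ[𝓝 z] fun _ => 0) :
    lapl χ z = 0 := by
  unfold lapl
  exact Finset.sum_eq_zero fun i _ => (dd_zero_of_ev (h i) (ex i)).self_of_nhds

theorem dd_one_of_ev {d : ℕ} {χ : Esp d → ℝ} {z : Esp d} (h : χ =ᶠ[𝓝 z] fun _ => 1) (a : Esp d) :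
    dd a χ =ᶠ[𝓝 z] fun _ => 0 := by
  filter_upwards [h.fderiv (𝕜 := ℝ)] with y hy
  simp [dd, hy]

theorem ucp_core {d : ℕ} {C : ℝ} {W : Esp d → ℝ} {W1 W2 : Fin d → Esp d → ℝ} {Wt F : Esp d → ℝ}
    (hr : Rough C W W1 W2 Wt F) {y : Fin d → ℝ} {ρ q t0 T L : ℝ} (hρ : 0 < ρ) (hq : 0 < q) (hT : 0 < T)
    (hL : 0 ≤ L) (hF : ∀ z, ss y z < q → |F z| ≤ L * (|W z| + ∑ i, |W1 i z|))
    (hW : ∀ z, ss y z < ρ → |z.2 - t0| < T → W z = 0) :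
    ∀ x, ss y ((x, t0) : Esp d) < q / 2 → W (x, t0) = 0 := by
  obtain ⟨c, hc⟩ : ∃ c, c = q / T ^ 2 := ⟨_, rfl⟩
  have hc0 : 0 < c := by rw [hc]; positivity
  have cps := (ps_sm y t0 c).continuous
  have css := (ss_sm y).continuous
  have hsm := chi_sm y t0 c q
  have hcK : IsCompact {z : Esp d | ps y t0 c z ≤ 3 * q / 4} := ps_compact y t0 hc0 _
  have hcs : HasCompactSupport (chi y t0 c q) := by
    refine HasCompactSupport.intro hcK fun z hz => ?_
    simp only [mem_ofPred_eq, not_le] at hz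
    exact chi_zero hq hz.le
  obtain ⟨C', hr'⟩ := rough_mul hr hsm hcs
  -- vanishing region
  have hzero : ∀ z, ps y t0 c z < 3 * q / 4 → ss y z < ρ → W z = 0 := by
    intro z h1 h2
    refine hW z h2 ?_
    have h3 := ss_nonneg y z
    have h4 : c * (z.2 - t0) ^ 2 < q := by unfold ps at h1; linarith
    rw [hc, div_mul_eq_mul_div, div_lt_iff₀ (by positivity)] at h4
    exact abs_lt_of_sq_lt_sq (lt_of_mul_lt_mul_left h4 hq.le) hT.le
  have hS0 : IsCompact ({z : Esp d | ps y t0 c z ≤ 3 * q / 4} ∩ {z | ρ ≤ ss y z}) :=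
    hcK.inter_right (isClosed_le continuous_const css)
  have hop : IsOpen {z : Esp d | ρ / 2 < ss y z} := isOpen_lt continuous_const css
  obtain ⟨δ, hδ, hsub⟩ := hS0.exists_cthickening_subset_open hop (fun z hz => by
    have : ρ ≤ ss y z := hz.2
    show ρ / 2 < ss y z
    linarith)
  have hK := hS0.cthickening (r := δ)
  obtain ⟨A, τ0, hA, hτ0, HC⟩ := carleman_conc y t0 c (4 / ρ) hK (r0 := ρ / 2) (by positivity) (by positivity)
    (by field_simp; norm_num) (fun z hz => (hsub hz).le)
  have hsupp : ∀ z z' : Esp d, chi y t0 c q z' * W z' ≠ 0 → dist z z' < δ →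
      z ∈ Metric.cthickening δ ({z : Esp d | ps y t0 c z ≤ 3 * q / 4} ∩ {z | ρ ≤ ss y z}) := by
    intro z z' h1 h2
    have h3 : ps y t0 c z' < 3 * q / 4 := by
      by_contra hh
      exact h1 (by rw [chi_zero hq (not_lt.1 hh), zero_mul])
    have h4 : ρ ≤ ss y z' := by
      by_contra hh
      exact h1 (by rw [hzero z' h3 (not_le.1 hh), mul_zero])
    exact Metric.mem_cthickening_of_dist_le z z' δ _ ⟨h3.le, h4⟩ h2.le
  have hS : IsCompact {z : Esp d | ps y t0 c z ≤ 3 * q / 4 ∧ q / 2 ≤ ps y t0 c z} :=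
    hcK.inter_right (isClosed_le continuous_const cps)
  have hB : IsOpen {z : Esp d | ps y t0 c z < q / 2} := isOpen_lt cps continuous_const
  -- local behaviour of the cut-off
  have ev0 : ∀ z, ¬ ps y t0 c z ≤ 3 * q / 4 → chi y t0 c q =ᶠ[𝓝 z] fun _ => 0 := by
    intro z hz
    filter_upwards [(isOpen_lt continuous_const cps).mem_nhds (not_le.1 hz)] with z' hz'
    exact chi_zero hq (le_of_lt hz')
  have ev1 : ∀ z, ps y t0 c z < q / 2 → chi y t0 c q =ᶠ[𝓝 z] fun _ => 1 := by
    intro z hz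
    filter_upwards [hB.mem_nhds hz] with z' hz'
    exact chi_one hq (le_of_lt hz')
  have hz : ∀ z, z ∉ {z : Esp d | ps y t0 c z ≤ 3 * q / 4} → chi y t0 c q z * W z = 0 ∧
      (∀ i, dd (ex i) (chi y t0 c q) z * W z + chi y t0 c q z * W1 i z = 0) ∧
      (dd et (chi y t0 c q) z - lapl (chi y t0 c q) z) * W z
        - 2 * (∑ i, dd (ex i) (chi y t0 c q) z * W1 i z) + chi y t0 c q z * F z = 0 := by
    intro z hz
    have e := ev0 z hz
    have e1 := e.self_of_nhds
    have e2 := fun a => (dd_zero_of_ev e a).self_of_nhds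
    have e3 := lapl_of_dd fun i => dd_zero_of_ev e (ex i)
    simp only at e1 e2
    simp [e1, e2, e3]
  have hb : ∀ z, ps y t0 c z < q / 2 → chi y t0 c q z * W z = W z ∧
      (∀ i, dd (ex i) (chi y t0 c q) z * W z + chi y t0 c q z * W1 i z = W1 i z) ∧
      (dd et (chi y t0 c q) z - lapl (chi y t0 c q) z) * W z
        - 2 * (∑ i, dd (ex i) (chi y t0 c q) z * W1 i z) + chi y t0 c q z * F z = F z := by
    intro z hz
    have e := ev1 z hz
    have e1 := e.self_of_nhds
    have e2 := fun a => (dd_one_of_ev e a).self_of_nhds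
    have e3 := lapl_of_dd fun i => dd_one_of_ev e (ex i)
    simp only at e1 e2
    simp [e1, e2, e3]
  have hC2 : 0 ≤ L ^ 2 * ((d : ℝ) + 1) := by positivity
  have key : ∀ τ, max τ0 (2 * (A * (L ^ 2 * ((d : ℝ) + 1)))) ≤ τ →
      τ * ∫ z in {z : Esp d | ps y t0 c z < q / 2}, (chi y t0 c q z * W z) ^ 2 ≤ 2 * A * C' ^ 2 *
        (volume {z : Esp d | ps y t0 c z ≤ 3 * q / 4 ∧ q / 2 ≤ ps y t0 c z}).toReal := by
    intro τ hτ
    have hcr := carleman_rough (wt_sm y t0 c (4 / ρ)) hK hδ (HC τ (le_trans (le_max_left _ _) hτ)) hr' hsupp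
    refine carleman_absorb (e := Real.exp (-(4 / ρ) * (q / 2))) (wt_sm y t0 c (4 / ρ)) hcK hS hB.measurableSet hA
      (hτ0.trans (le_trans (le_max_left _ _) hτ)) (le_trans (le_max_right _ _) hτ) (sq_nonneg C') hC2
      hr'.hc hr'.hc1 hr'.hG hz ?_ ?_ ?_ ?_ hcr
    · intro z hzS
      by_cases h1 : ps y t0 c z < q / 2
      · obtain ⟨a1, a2, a3⟩ := hb z h1
        simp only [a1, a2, a3]
        refine sum_sq_bound hL (hF z ?_)
        have : 0 ≤ c * (z.2 - t0) ^ 2 := by positivity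
        unfold ps at h1
        linarith
      · have h2 : ¬ ps y t0 c z ≤ 3 * q / 4 := fun h => hzS ⟨h, not_lt.1 h1⟩
        obtain ⟨a1, a2, a3⟩ := hz z h2
        simp [a1, a2, a3]
    · intro z
      exact sq_le_sq' (neg_le_of_abs_le (hr'.bG z)) (le_of_abs_le (hr'.bG z))
    · intro z h
      refine Real.exp_le_exp.2 ?_
      have : 0 < 4 / ρ := by positivity
      have h2 : q / 2 ≤ ps y t0 c z := h.2
      nlinarith
    · intro z h
      refine Real.exp_le_exp.2 ?_
      have : 0 < 4 / ρ := by positivity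
      have h2 : ps y t0 c z < q / 2 := h
      nlinarith
  generalize hV : 2 * A * C' ^ 2 *
        (volume {z : Esp d | ps y t0 c z ≤ 3 * q / 4 ∧ q / 2 ≤ ps y t0 c z}).toReal = V at key
  have hcw : Continuous fun z => chi y t0 c q z * W z := hr'.hc
  have I0 : ∫ z in {z : Esp d | ps y t0 c z < q / 2}, (chi y t0 c q z * W z) ^ 2 = 0 := by
    have hn : 0 ≤ ∫ z in {z : Esp d | ps y t0 c z < q / 2}, (chi y t0 c q z * W z) ^ 2 :=
      integral_nonneg fun z => sq_nonneg _
    by_contra hne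
    have hp := lt_of_le_of_ne hn (Ne.symm hne)
    generalize (∫ z in {z : Esp d | ps y t0 c z < q / 2}, (chi y t0 c q z * W z) ^ 2) = I at *
    have h1 := key (max (max τ0 (2 * (A * (L ^ 2 * ((d : ℝ) + 1))))) ((V + 1) / I)) (le_max_left _ _)
    have h2 : (V + 1) / I * I ≤ max (max τ0 (2 * (A * (L ^ 2 * ((d : ℝ) + 1))))) ((V + 1) / I) * I :=
      mul_le_mul_of_nonneg_right (le_max_right _ _) hn
    rw [div_mul_cancel₀ _ hne] at h2
    linarith
  have Iw : Integrable fun z => (chi y t0 c q z * W z) ^ 2 := by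
    refine Continuous.integrable_of_hasCompactSupport (by fun_prop) (HasCompactSupport.intro hcK fun z h => ?_)
    simp [(hz z h).1]
  rw [setIntegral_eq_zero_iff_of_nonneg_ae (ae_of_all _ fun z => sq_nonneg _) Iw.integrableOn] at I0
  have hE := Measure.eqOn_open_of_ae_eq I0 hB (hcw.pow 2).continuousOn continuousOn_const
  intro x hx
  have hx' : ps y t0 c ((x, t0) : Esp d) < q / 2 := by unfold ps; simpa using hx
  have := hE hx'
  rw [← (hb _ hx').1]
  simpa using this

open Set MeasureTheory Filter Topology

theorem ld_shift {d : ℕ} {g : Esp d → ℝ} {g' : Esp d → ℝ} {a : Esp d} (h : ∀ z, HasLineDerivAt ℝ g (g' z) z a)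
    (b : Esp d) (z : Esp d) :
    HasLineDerivAt ℝ (fun z => g (z + b) - g z) (g' (z + b) - g' z) z a := by
  have h1 := h (z + b)
  have h2 := h z
  unfold HasLineDerivAt at *
  refine (h1.sub h2).congr_of_eventuallyEq (Eventually.of_forall fun t => ?_)
  simp only [Pi.sub_apply]
  rw [add_right_comm]

theorem abs_diff_le {a b A : ℝ} (ha : |a| ≤ A) (hb : |b| ≤ A) : |a - b| ≤ 2 * A := by
  have := abs_sub a b
  linarith

theorem Sol.rough {d : ℕ} {ω N R' C : ℝ} {u : Esp d → ℝ} {u1 u2 : Fin d → Esp d → ℝ} {ut G : Esp d → ℝ}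
    (S : Sol ω N R' u u1 u2 ut G) (c1 : ∀ i, Continuous (u1 i)) (cG : Continuous G)
    (b2 : ∀ i z, |u2 i z| ≤ C) (bt : ∀ z, |ut z| ≤ C) (s : ℝ) :
    ∃ C', Rough C' (fun z => u (z + s • et) - u z) (fun i z => u1 i (z + s • et) - u1 i z)
      (fun i z => u2 i (z + s • et) - u2 i z) (fun z => ut (z + s • et) - ut z) (fun z => G (z + s • et) - G z) := by
  have hC : 0 ≤ C := (abs_nonneg _).trans (bt 0)
  have cu := S.hc
  have hCs : 0 ≤ C * |s| := by positivity
  have hdC : 0 ≤ (d : ℝ) * (2 * C) := by positivity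
  have e : ∀ z, G (z + s • et) - G z = (ut (z + s • et) - ut z) - ∑ i, (u2 i (z + s • et) - u2 i z) := by
    intro z
    rw [S.heq, S.heq z, Finset.sum_sub_distrib]; ring
  have hbS : ∀ z, |∑ i, (u2 i (z + s • et) - u2 i z)| ≤ d * (2 * C) := by
    intro z
    refine (Finset.abs_sum_le_sum_abs _ _).trans ?_
    refine (Finset.sum_le_sum fun i _ => abs_diff_le (b2 i _) (b2 i _)).trans ?_
    simp
  refine ⟨C * |s| + 2 * |R'| + 2 * C + d * (2 * C), ?_⟩
  have hR' := abs_nonneg R'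
  constructor
  · fun_prop
  · intro i
    have := c1 i
    fun_prop
  · fun_prop
  · intro i z; exact ld_shift (S.h1 i) _ z
  · intro i z; exact ld_shift (S.h2 i) _ z
  · intro z; exact ld_shift S.ht _ z
  · intro z; exact e z
  · intro z
    have h1 : ∀ r ∈ (univ : Set ℝ), HasDerivWithinAt (fun s : ℝ => u (z + s • et)) (ut (z + r • et)) univ r :=
      fun r _ => (ld_add S.ht z r).hasDerivWithinAt
    have h2 := convex_univ.norm_image_sub_le_of_norm_hasDerivWithin_le h1 (fun r _ => bt _) (mem_univ (0 : ℝ))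
      (mem_univ s)
    simp only [zero_smul, add_zero, sub_zero, Real.norm_eq_abs] at h2
    linarith
  · intro i z
    have := abs_diff_le ((S.hR i (z + s • et)).trans (le_abs_self R')) ((S.hR i z).trans (le_abs_self R'))
    linarith
  · intro i z
    have := abs_diff_le (b2 i (z + s • et)) (b2 i z)
    linarith
  · intro z
    have := abs_diff_le (bt (z + s • et)) (bt z)
    linarith
  · intro z
    rw [e]
    have h1 := abs_diff_le (bt (z + s • et)) (bt z)
    have h2 := hbS z
    have h3 := abs_sub (ut (z + s • et) - ut z) (∑ i, (u2 i (z + s • et) - u2 i z))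
    linarith

theorem dist_of_ss {d : ℕ} {y : Fin d → ℝ} {z : Esp d} {r : ℝ} (hr : 0 < r) (h : ss y z < r ^ 2) :
    dist z.1 y < r := by
  rw [dist_pi_lt_iff hr]
  intro i
  rw [Real.dist_eq]
  refine abs_lt_of_sq_lt_sq (lt_of_le_of_lt ?_ h) hr.le
  exact Finset.single_le_sum (f := fun i => (z.1 i - y i) ^ 2) (fun i _ => sq_nonneg _) (Finset.mem_univ i)

theorem ss_le_dist {d : ℕ} {y : Fin d → ℝ} {z : Esp d} : ss y z ≤ d * dist z.1 y ^ 2 := by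
  unfold ss
  have : ∀ i ∈ (Finset.univ : Finset (Fin d)), (z.1 i - y i) ^ 2 ≤ dist z.1 y ^ 2 := by
    intro i _
    rw [← sq_abs]
    have := dist_le_pi_dist z.1 y i
    rw [Real.dist_eq] at this
    exact pow_le_pow_left₀ (abs_nonneg _) this 2
  refine (Finset.sum_le_sum this).trans ?_
  simp

section
variable {d : ℕ} {Ω : Set (Fin d → ℝ)} {f : ((Fin d → ℝ) × ℝ × (Fin d → ℝ)) → ℝ}
  {p : (Fin d → ℝ) → ℝ → ℝ} {ω R : ℝ}

theorem Per.ucp_loc (h : Per Ω f p ω R) {x0 : Fin d → ℝ} {r : ℝ} (hr : 0 < r)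
    (hb : Metric.closedBall x0 (6 * r) ⊆ Ω) :
    ∃ ε > 0, ∀ y ∈ Metric.ball x0 ε, ∀ ρ > 0, ∀ a b s : ℝ,
      (∀ x ∈ Metric.ball y ρ, ∀ t ∈ Ioo a b, p x (t + s) = p x t) →
      ∀ x ∈ Metric.ball x0 ε, ∀ t ∈ Ioo a b, p x (t + s) = p x t := by
  obtain ⟨N, R', C, L, u, u1, u2, ut, G, S, c1, cG, b2, bt, hL, hloc⟩ := h.loc hr hb
  have hd0 : (0 : ℝ) ≤ d := Nat.cast_nonneg d
  have hε : 0 < r / (8 * (d + 1)) := by positivity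
  have hεr : r / (8 * (d + 1)) ≤ r / 8 := by
    apply div_le_div_of_nonneg_left hr.le (by norm_num)
    linarith
  have hεd : d * (r / (8 * (d + 1))) ≤ r / 8 := by
    rw [mul_div_assoc', div_le_div_iff₀ (by positivity) (by norm_num)]
    nlinarith
  refine ⟨r / (8 * (d + 1)), hε, fun y hy ρ hρ a b s hyp x hx t0 ht0 => ?_⟩
  generalize r / (8 * (d + 1)) = ε at *
  rw [Metric.mem_ball] at hy hx
  obtain ⟨C', hR⟩ := S.rough c1 cG b2 bt s
  have hsh : ∀ z : Esp d, z + s • et = (z.1, z.2 + s) := by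
    intro z
    ext <;> simp [et]
  have hin : ∀ z : Esp d, ss y z < (r / 2) ^ 2 → z.1 ∈ Metric.ball x0 r := by
    intro z hz
    have := dist_of_ss (half_pos hr) hz
    rw [Metric.mem_ball]
    have := dist_triangle z.1 y x0
    linarith
  have hm : 0 < min ρ (r / 2) := lt_min hρ (half_pos hr)
  have hT : 0 < min (t0 - a) (b - t0) := lt_min (by linarith [ht0.1]) (by linarith [ht0.2])
  have hxin : x ∈ Metric.ball x0 r := by rw [Metric.mem_ball]; linarith
  have hfin := ucp_core hR (y := y) (ρ := (min ρ (r / 2)) ^ 2) (q := (r / 2) ^ 2) (t0 := t0)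
    (T := min (t0 - a) (b - t0)) (L := L) (by positivity) (by positivity) hT hL ?_ ?_ x ?_
  · simp only [hsh] at hfin
    rw [(hloc x hxin (t0 + s)).1, (hloc x hxin t0).1] at hfin
    linarith
  · intro z hz
    have := (hloc z.1 (hin z hz) (z.2 + s)).2.2 z.2
    simp only [hsh]
    exact this
  · intro z hz hzt
    have h1 := dist_of_ss hm hz
    have h2 : z.1 ∈ Metric.ball x0 r := by
      refine hin z (hz.trans_le ?_)
      exact pow_le_pow_left₀ hm.le (min_le_right _ _) 2
    have h3 : z.2 ∈ Ioo a b := by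
      have h4 := hzt.trans_le (min_le_left _ _)
      have h5 := hzt.trans_le (min_le_right _ _)
      rw [abs_lt] at h4 h5
      constructor <;> linarith
    have := hyp z.1 (h1.trans_le (min_le_left _ _)) z.2 h3
    simp only [hsh]
    have e1 := (hloc z.1 h2 (z.2 + s)).1
    have e2 := (hloc z.1 h2 z.2).1
    rw [e1, this, ← e2, Prod.mk.eta, sub_self]
  · refine lt_of_le_of_lt ss_le_dist ?_
    have h1 : dist x y < 2 * ε := by
      have := dist_triangle x x0 y
      rw [dist_comm x0 y] at this
      linarith
    have h0 : 0 ≤ dist x y := dist_nonneg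
    show d * dist x y ^ 2 < _
    have : dist x y ^ 2 ≤ (2 * ε) ^ 2 := pow_le_pow_left₀ h0 h1.le 2
    have h3 : d * dist x y ^ 2 ≤ d * (2 * ε) ^ 2 := mul_le_mul_of_nonneg_left this hd0
    have h4 : d * (2 * ε) ^ 2 = 4 * (d * ε) * ε := by ring
    have h5 : 4 * (d * ε) * ε ≤ 4 * (r / 8) * (r / 8) := by
      have : 0 ≤ d * ε := by positivity
      nlinarith
    nlinarith

theorem Per.ucp (h : Per Ω f p ω R) (hΩc : IsPreconnected Ω) {y : Fin d → ℝ} (hy : y ∈ Ω) {ρ a b s : ℝ} (hρ : 0 < ρ)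
    (hyp : ∀ x ∈ Metric.ball y ρ, ∀ t ∈ Ioo a b, p x (t + s) = p x t) :
    ∀ x ∈ Ω, ∀ t ∈ Ioo a b, p x (t + s) = p x t := by
  have hZ : IsOpen (interior {x | ∀ t ∈ Ioo a b, p x (t + s) = p x t}) := isOpen_interior
  have := hΩc.subset_of_closure_inter_subset hZ ⟨y, hy, ?_⟩ ?_
  · intro x hx
    exact interior_subset (this hx)
  · rw [mem_interior_iff_mem_nhds]
    exact Filter.mem_of_superset (Metric.ball_mem_nhds y hρ) hyp
  · rintro x ⟨hx, hxΩ⟩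
    obtain ⟨r, hr, hb⟩ := Metric.nhds_basis_closedBall.mem_iff.1 (h.hΩo.mem_nhds hxΩ)
    obtain ⟨ε, hε, hu⟩ := h.ucp_loc (x0 := x) (r := r / 6) (by positivity) (by rwa [mul_div_cancel₀ _ (by norm_num)])
    obtain ⟨y', hy', hd⟩ := Metric.mem_closure_iff.1 hx ε hε
    obtain ⟨ρ', hρ', hs⟩ := Metric.mem_nhds_iff.1 (mem_interior_iff_mem_nhds.1 hy')
    rw [mem_interior_iff_mem_nhds]
    refine Filter.mem_of_superset (Metric.ball_mem_nhds x hε) ?_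
    exact hu y' (by rwa [Metric.mem_ball, dist_comm]) ρ' hρ' a b s (fun x' hx' => hs hx')
end

open Set MeasureTheory Filter Topology

theorem f_lip {d : ℕ} {Ω : Set (Fin d → ℝ)} (hΩb : Bornology.IsBounded Ω)
    {f : ((Fin d → ℝ) × ℝ × (Fin d → ℝ)) → ℝ}
    (hf : ContDiffOn ℝ (⊤ : ℕ∞) f (closure Ω ×ˢ ((univ : Set ℝ) ×ˢ (univ : Set (Fin d → ℝ))))) (R : ℝ) :
    ∃ M, 0 ≤ M ∧ ∀ x ∈ Ω, ∀ a a' : ℝ, |a| ≤ R → |a'| ≤ R → ∀ b : Fin d → ℝ, (∀ i, |b i| ≤ R) →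
      |f (x, a, b) - f (x, a', b)| ≤ M * |a - a'| := by
  generalize hS : closure Ω ×ˢ ((univ : Set ℝ) ×ˢ (univ : Set (Fin d → ℝ))) = S at hf
  have hK : IsCompact (closure Ω ×ˢ ((Icc (-R) R) ×ˢ (Set.pi univ fun _ : Fin d => Icc (-R) R))) :=
    hΩb.isCompact_closure.prod (isCompact_Icc.prod (isCompact_univ_pi fun _ => isCompact_Icc))
  have hKS : (closure Ω ×ˢ ((Icc (-R) R) ×ˢ (Set.pi univ fun _ : Fin d => Icc (-R) R))) ⊆ S := by
    rw [← hS]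
    exact prod_mono_right (prod_mono (subset_univ _) (subset_univ _))
  have hM : ∃ M : ℝ, ∀ z ∈ (closure Ω ×ˢ ((Icc (-R) R) ×ˢ (Set.pi univ fun _ : Fin d => Icc (-R) R))),
      ∃ f' : ((Fin d → ℝ) × ℝ × (Fin d → ℝ)) →L[ℝ] ℝ, HasFDerivWithinAt f f' S z ∧ ‖f'‖ ≤ M := by
    refine hK.induction_on (p := fun T => ∃ M : ℝ, ∀ z ∈ T,
      ∃ f' : ((Fin d → ℝ) × ℝ × (Fin d → ℝ)) →L[ℝ] ℝ, HasFDerivWithinAt f f' S z ∧ ‖f'‖ ≤ M) ⟨0, fun z hz => hz.elim⟩ ?_ ?_ ?_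
    · rintro s t hst ⟨M, hM⟩
      exact ⟨M, fun z hz => hM z (hst hz)⟩
    · rintro s t ⟨M, hM⟩ ⟨M', hM'⟩
      refine ⟨max M M', fun z hz => ?_⟩
      rcases hz with hz | hz
      · obtain ⟨f', h1, h2⟩ := hM z hz
        exact ⟨f', h1, h2.trans (le_max_left _ _)⟩
      · obtain ⟨f', h1, h2⟩ := hM' z hz
        exact ⟨f', h1, h2.trans (le_max_right _ _)⟩
    · intro z hz
      have h1 : ContDiffWithinAt ℝ ((0 : WithTop ℕ∞) + 1) f S z :=
        (hf z (hKS hz)).of_le (by norm_cast)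
      obtain ⟨u, hu, -, -, f', h2, h3⟩ := (contDiffWithinAt_succ_iff_hasFDerivWithinAt' (by simp)).1 h1
      rw [insert_eq_of_mem (hKS hz)] at hu
      have h4 : ∀ᶠ z' in 𝓝[S] z, ‖f' z'‖ < ‖f' z‖ + 1 :=
        h3.continuousWithinAt.norm.eventually (gt_mem_nhds (lt_add_one _))
      refine ⟨{z' | z' ∈ u ∧ ‖f' z'‖ < ‖f' z‖ + 1}, nhdsWithin_mono _ hKS (Filter.inter_mem hu h4), ‖f' z‖ + 1, ?_⟩
      intro z' hz'
      exact ⟨f' z', h2 z' hz'.1, le_of_lt hz'.2⟩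
  obtain ⟨M, hM⟩ := hM
  refine ⟨max M 0, le_max_right _ _, fun x hx a a' ha ha' b hb => ?_⟩
  have hb' : b ∈ Set.pi univ fun _ : Fin d => Icc (-R) R := fun i _ => abs_le.1 (hb i)
  have hd : ∀ c ∈ Icc (-R) R, ∃ D : ℝ, HasDerivAt (fun c => f (x, c, b)) D c ∧ |D| ≤ max M 0 := by
    intro c hc
    obtain ⟨f', h1, h2⟩ := hM (x, c, b) ⟨subset_closure hx, hc, hb'⟩
    have h3 : HasDerivAt (fun c : ℝ => ((x, c, b) : (Fin d → ℝ) × ℝ × (Fin d → ℝ))) (0, 1, 0) c :=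
      (hasDerivAt_const c x).prodMk ((hasDerivAt_id c).prodMk (hasDerivAt_const c b))
    have h4 := h1.comp_hasDerivWithinAt (s := univ) c h3.hasDerivWithinAt (fun c' _ => by
      rw [← hS]; exact ⟨subset_closure hx, mem_univ _, mem_univ _⟩)
    rw [hasDerivWithinAt_univ] at h4
    refine ⟨_, h4, ?_⟩
    have h5 := f'.le_opNorm ((0, 1, 0) : (Fin d → ℝ) × ℝ × (Fin d → ℝ))
    have h6 : ‖((0, 1, 0) : (Fin d → ℝ) × ℝ × (Fin d → ℝ))‖ = 1 := by simp [Prod.norm_def]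
    rw [h6, mul_one, Real.norm_eq_abs] at h5
    exact h5.trans (h2.trans (le_max_left _ _))
  choose! D hD1 hD2 using hd
  have := Convex.norm_image_sub_le_of_norm_hasDerivWithin_le (s := Icc (-R) R)
    (fun c hc => (hD1 c hc).hasDerivWithinAt) hD2 (convex_Icc _ _) (abs_le.1 ha') (abs_le.1 ha)
  simpa using this

section
variable {d : ℕ} {Ω : Set (Fin d → ℝ)} {f : ((Fin d → ℝ) × ℝ × (Fin d → ℝ)) → ℝ}
  {p : (Fin d → ℝ) → ℝ → ℝ} {ω R : ℝ}

theorem line_fd {g : (Fin d → ℝ) → ℝ} {x e : Fin d → ℝ} {r : ℝ} (h : DifferentiableAt ℝ g (x + r • e)) :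
    HasDerivAt (fun r : ℝ => g (x + r • e)) (fderiv ℝ g (x + r • e) e) r := by
  have h1 : HasDerivAt (fun r : ℝ => x + r • e) e r := by
    simpa using ((hasDerivAt_id r).smul_const e).const_add x
  exact h.hasFDerivAt.comp_hasDerivAt r h1

theorem Per.max_pt (h : Per Ω f p ω R) {x : Fin d → ℝ} (hx : x ∈ Ω) {s t : ℝ}
    (hm : IsLocalMax (fun y => p y s - p y t) x) :
    (∀ i, pd i (fun y => p y s) x = pd i (fun y => p y t) x) ∧ lap (fun y => p y s) x ≤ lap (fun y => p y t) x := by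
  have key : ∀ i, pd i (fun y => p y s) x = pd i (fun y => p y t) x ∧
      pd i (pd i fun y => p y s) x ≤ pd i (pd i fun y => p y t) x := by
    intro i
    have hc : ContinuousAt (fun r : ℝ => x + r • (Pi.single i 1 : Fin d → ℝ)) 0 := by fun_prop
    have h0 : x + (0 : ℝ) • (Pi.single i 1 : Fin d → ℝ) = x := by simp
    have hin : ∀ᶠ r in 𝓝 (0 : ℝ), x + r • (Pi.single i 1 : Fin d → ℝ) ∈ Ω :=
      hc.eventually (by simp only [h0]; exact h.hΩo.mem_nhds hx)
    have d1 : ∀ᶠ r in 𝓝 (0 : ℝ), HasDerivAt (fun r : ℝ => p (x + r • (Pi.single i 1 : Fin d → ℝ)) s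
        - p (x + r • (Pi.single i 1 : Fin d → ℝ)) t) (pd i (fun y => p y s) (x + r • (Pi.single i 1 : Fin d → ℝ))
          - pd i (fun y => p y t) (x + r • (Pi.single i 1 : Fin d → ℝ))) r := by
      filter_upwards [hin] with r hr
      exact (line_fd (h.dp hr s)).sub (line_fd (h.dp hr t))
    have d2 : HasDerivAt (fun r : ℝ => pd i (fun y => p y s) (x + r • (Pi.single i 1 : Fin d → ℝ))
          - pd i (fun y => p y t) (x + r • (Pi.single i 1 : Fin d → ℝ)))
        (pd i (pd i fun y => p y s) x - pd i (pd i fun y => p y t) x) 0 := by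
      have a1 := line_fd (e := (Pi.single i 1 : Fin d → ℝ)) (r := 0) (h0.symm ▸ h.dp1 hx s i)
      have a2 := line_fd (e := (Pi.single i 1 : Fin d → ℝ)) (r := 0) (h0.symm ▸ h.dp1 hx t i)
      have := a1.sub a2
      rw [h0] at this
      exact this
    have hl : IsLocalMax (fun r : ℝ => p (x + r • (Pi.single i 1 : Fin d → ℝ)) s
        - p (x + r • (Pi.single i 1 : Fin d → ℝ)) t) 0 := by
      have hm' : ∀ᶠ y in 𝓝 (x + (0 : ℝ) • (Pi.single i 1 : Fin d → ℝ)), p y s - p y t ≤ p x s - p x t := by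
        rw [h0]; exact hm
      have := hc.eventually hm'
      refine this.mono fun r hr => ?_
      simp only [h0]
      exact hr
    have e1 := hl.hasDerivAt_eq_zero d1.self_of_nhds
    have e2 := snd_test d1 d2 hl
    rw [h0] at e1
    constructor <;> linarith
  refine ⟨fun i => (key i).1, ?_⟩
  unfold lap
  exact Finset.sum_le_sum fun i _ => (key i).2

theorem Per.compare (h : Per Ω f p ω R) (hΩb : Bornology.IsBounded Ω)
    (hpbc : ∀ x ∈ frontier Ω, ∀ t : ℝ, p x t = 0) {τ1 τ2 : ℝ} (he : ∀ x ∈ Ω, p x τ1 = p x τ2) :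
    ∀ x ∈ Ω, ∀ t, 0 ≤ t → p x (τ1 + t) ≤ p x (τ2 + t) := by
  obtain ⟨M, hM0, hM⟩ := f_lip hΩb h.hf R
  intro x0 hx0 t2 ht2
  have hQ : IsCompact (closure Ω ×ˢ Icc (0 : ℝ) t2) := hΩb.isCompact_closure.prod isCompact_Icc
  have hsh : ∀ τ : ℝ, ContinuousOn (fun z : (Fin d → ℝ) × ℝ => p z.1 (τ + z.2)) (closure Ω ×ˢ Icc (0 : ℝ) t2) := by
    intro τ
    refine h.hpc.comp (f := fun z : (Fin d → ℝ) × ℝ => (z.1, τ + z.2)) (by fun_prop) ?_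
    intro z hz
    exact ⟨hz.1, mem_univ _⟩
  have hcont : ContinuousOn (fun z : (Fin d → ℝ) × ℝ => Real.exp (-(M + 1) * z.2) * (p z.1 (τ1 + z.2) - p z.1 (τ2 + z.2)))
      (closure Ω ×ˢ Icc (0 : ℝ) t2) :=
    ContinuousOn.mul (by fun_prop) ((hsh τ1).sub (hsh τ2))
  obtain ⟨⟨x, t⟩, hz, hmax⟩ := hQ.exists_isMaxOn ⟨(x0, 0), subset_closure hx0, le_refl _, ht2⟩ hcont
  have hmax' : ∀ y ∈ closure Ω, ∀ r ∈ Icc (0 : ℝ) t2, Real.exp (-(M + 1) * r) * (p y (τ1 + r) - p y (τ2 + r)) ≤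
      Real.exp (-(M + 1) * t) * (p x (τ1 + t) - p x (τ2 + t)) := fun y hy r hr => hmax (show (y, r) ∈ _ from ⟨hy, hr⟩)
  have hx : x ∈ closure Ω := hz.1
  have ht : t ∈ Icc (0 : ℝ) t2 := hz.2
  by_cases hpos : p x (τ1 + t) - p x (τ2 + t) ≤ 0
  · have h1 := hmax' x0 (subset_closure hx0) t2 ⟨ht2, le_refl _⟩
    have h2 : Real.exp (-(M + 1) * t) * (p x (τ1 + t) - p x (τ2 + t)) ≤ 0 :=
      mul_nonpos_of_nonneg_of_nonpos (Real.exp_pos _).le hpos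
    have h3 := Real.exp_pos (-(M + 1) * t2)
    by_contra hcon
    push Not at hcon
    have := mul_pos h3 (sub_pos.2 hcon)
    linarith
  exfalso
  push Not at hpos
  have hxΩ : x ∈ Ω := by
    rw [closure_eq_self_union_frontier] at hx
    rcases hx with hx | hx
    · exact hx
    · rw [hpbc x hx, hpbc x hx] at hpos
      linarith
  have ht0 : 0 < t := by
    rcases eq_or_lt_of_le ht.1 with h0 | h0
    · rw [← h0, add_zero, add_zero, he x hxΩ] at hpos
      linarith
    · exact h0
  have hE := Real.exp_pos (-(M + 1) * t)
  have hm : IsLocalMax (fun y => p y (τ1 + t) - p y (τ2 + t)) x := by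
    filter_upwards [h.hΩo.mem_nhds hxΩ] with y hy
    exact le_of_mul_le_mul_left (hmax' y (subset_closure hy) t ht) hE
  obtain ⟨hg, hl⟩ := h.max_pt hxΩ hm
  have hdt : ∀ τ, HasDerivAt (fun r => p x (τ + r)) (deriv (p x) (τ + t)) t := by
    intro τ
    have := ((h.hpt x hxΩ).differentiable (by norm_num) (τ + t)).hasDerivAt
    exact this.comp_const_add τ t
  have hde : HasDerivAt (fun r => Real.exp (-(M + 1) * r)) (Real.exp (-(M + 1) * t) * (-(M + 1))) t := by
    have := ((hasDerivAt_id t).const_mul (-(M + 1))).exp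
    simpa using this
  have hdg := hde.mul ((hdt τ1).sub (hdt τ2))
  have hnn : 0 ≤ Real.exp (-(M + 1) * t) * -(M + 1) * (p x (τ1 + t) - p x (τ2 + t)) +
      Real.exp (-(M + 1) * t) * (deriv (p x) (τ1 + t) - deriv (p x) (τ2 + t)) := by
    by_contra hneg
    push Not at hneg
    have hs := (hasDerivAt_iff_tendsto_slope.1 hdg).eventually (gt_mem_nhds hneg)
    have hs2 : ∀ᶠ r in 𝓝[<] t, slope ((fun r => Real.exp (-(M + 1) * r)) * ((fun r => p x (τ1 + r)) - fun r => p x (τ2 + r))) t r < 0 :=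
      nhdsWithin_mono t (fun r (hr : r < t) => ne_of_lt hr) hs
    have hs3 : ∀ᶠ r in 𝓝[<] t, r ∈ Ioo 0 t := Ioo_mem_nhdsLT ht0
    obtain ⟨r, hr1, hr2⟩ := (hs2.and hs3).exists
    rw [slope_def_field, div_neg_iff] at hr1
    have := hmax' x hx r ⟨hr2.1.le, hr2.2.le.trans ht.2⟩
    simp only [Pi.mul_apply, Pi.sub_apply] at hr1
    have h4 := hr2.2
    rcases hr1 with ⟨a1, a2⟩ | ⟨a1, a2⟩ <;> linarith
  rw [mul_assoc, ← mul_add] at hnn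
  have hnn2 := nonneg_of_mul_nonneg_right hnn hE
  rw [h.hpeq x hxΩ, h.hpeq x hxΩ] at hnn2
  have hb1 := h.hbnd x hxΩ (τ1 + t)
  have hb2 := h.hbnd x hxΩ (τ2 + t)
  have hfl := hM x hxΩ _ _ hb1.1 hb2.1 _ hb2.2
  have hgg : (fun i => pd i (fun y => p y (τ1 + t)) x) = fun i => pd i (fun y => p y (τ2 + t)) x := funext hg
  rw [hgg] at hnn2
  rw [abs_of_pos hpos] at hfl
  have := (le_abs_self _).trans hfl
  linarith

/-- uniqueness property: a local time-shift symmetry is a multiple of the period -/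
def Uq (Ω : Set (Fin d → ℝ)) (p : (Fin d → ℝ) → ℝ → ℝ) (ω : ℝ) : Prop :=
  ∀ y ∈ Ω, ∀ ρ > 0, ∀ a b s : ℝ, a < b → (∀ x ∈ Metric.ball y ρ, ∀ t ∈ Ioo a b, p x (t + s) = p x t) →
    ∃ n : ℤ, s = n * ω

theorem Per.uq (h : Per Ω f p ω R) (hΩb : Bornology.IsBounded Ω) (hΩc : IsPreconnected Ω)
    (hpbc : ∀ x ∈ frontier Ω, ∀ t : ℝ, p x t = 0)
    (hmin : ∀ ω' : ℝ, 0 < ω' → (∀ x ∈ closure Ω, ∀ t : ℝ, p x (t + ω') = p x t) → ω ≤ ω') : Uq Ω p ω := by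
  intro y hy ρ hρ a b s hab hyp
  have h1 := h.ucp hΩc hy hρ hyp
  have h2 : ∀ x ∈ Ω, p x ((a + b) / 2 + s) = p x ((a + b) / 2) :=
    fun x hx => h1 x hx _ ⟨by linarith, by linarith⟩
  have hP : ∀ x ∈ closure Ω, Function.Periodic (p x) ω := fun x hx t => h.hper x hx t
  have h3 : ∀ x ∈ Ω, ∀ t, p x (t + s) = p x t := by
    intro x hx t
    obtain ⟨k, hk⟩ := exists_nat_ge (((a + b) / 2 - t) / ω)
    rw [div_le_iff₀ h.hω] at hk
    have hPk := (hP x (subset_closure hx)).int_mul k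
    have e1 := hPk (t + s)
    have e2 := hPk t
    push_cast at e1 e2
    rw [← e1, ← e2]
    have hnn : 0 ≤ t + k * ω - (a + b) / 2 := by linarith
    have c1 := h.compare hΩb hpbc h2 x hx _ hnn
    have c2 := h.compare hΩb hpbc (fun x hx => (h2 x hx).symm) x hx _ hnn
    have r1 : (a + b) / 2 + s + (t + k * ω - (a + b) / 2) = t + s + k * ω := by ring
    have r2 : (a + b) / 2 + (t + k * ω - (a + b) / 2) = t + k * ω := by ring
    rw [r1, r2] at c1 c2
    exact le_antisymm c1 c2
  have h4 : ∀ x ∈ closure Ω, ∀ t, p x (t + s) = p x t := by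
    intro x hx t
    rw [closure_eq_self_union_frontier] at hx
    rcases hx with hx | hx
    · exact h3 x hx t
    · rw [hpbc x hx, hpbc x hx]
  have hω := h.hω
  refine ⟨⌊s / ω⌋, ?_⟩
  have f1 := Int.floor_le (s / ω)
  have f2 := Int.lt_floor_add_one (s / ω)
  rw [le_div_iff₀ hω] at f1
  rw [div_lt_iff₀ hω] at f2
  by_contra hne
  have hpos : 0 < s - ⌊s / ω⌋ * ω := by
    rcases eq_or_lt_of_le f1 with h | h
    · exact absurd h.symm hne
    · linarith
  have := hmin _ hpos (fun x hx t => by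
    have e := (hP x hx).int_mul ⌊s / ω⌋ (t + (s - ⌊s / ω⌋ * ω))
    rw [← e, ← h4 x hx t]
    congr 1; ring)
  nlinarith
end

open Set MeasureTheory Filter Topology

theorem baire_open {X ι : Type*} [TopologicalSpace X] [BaireSpace X] [Countable ι] {O : Set X} (hO : IsOpen O)
    (hne : O.Nonempty) {F : ι → Set X} (hF : ∀ i, IsClosed (F i)) (hc : O ⊆ ⋃ i, F i) :
    ∃ i, (O ∩ interior (F i)).Nonempty := by
  let F' : Option ι → Set X := fun o => o.elim Oᶜ F
  have h1 : ∀ o, IsClosed (F' o) := by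
    rintro (_ | i)
    · exact hO.isClosed_compl
    · exact hF i
  have h2 : ⋃ o, F' o = univ := by
    refine eq_univ_of_forall fun x => ?_
    by_cases hx : x ∈ O
    · obtain ⟨i, hi⟩ := mem_iUnion.1 (hc hx)
      exact mem_iUnion.2 ⟨some i, hi⟩
    · exact mem_iUnion.2 ⟨none, hx⟩
  have h3 := dense_iUnion_interior_of_closed h1 h2
  obtain ⟨x, hxO, hx⟩ := h3.inter_open_nonempty O hO hne
  obtain ⟨o, ho⟩ := mem_iUnion.1 hx
  rcases o with _ | i
  · exact absurd hxO (interior_subset ho)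
  · exact ⟨i, x, hxO, ho⟩

theorem closed_proj {X : Type*} [TopologicalSpace X] {K : Set ℝ} (hK : IsCompact K) {h : X × ℝ → ℝ}
    (hh : Continuous h) : IsClosed {x | ∃ τ ∈ K, h (x, τ) = 0} := by
  rw [← isOpen_compl_iff, isOpen_iff_mem_nhds]
  intro x hx
  have hx' : ∀ τ ∈ K, h (x, τ) ≠ 0 := fun τ hτ h0 => hx ⟨τ, hτ, h0⟩
  have : ∀ᶠ y in 𝓝 x, ∀ τ ∈ K, h (y, τ) ≠ 0 := by
    refine hK.eventually_forall_of_forall_eventually fun τ hτ => ?_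
    exact hh.continuousAt.eventually_ne (hx' τ hτ)
  filter_upwards [this] with y hy
  rintro ⟨τ, hτ, h0⟩
  exact hy τ hτ h0

/-- uniform slope -/
def Sl (g : ℝ → ℝ) (m : ℕ) (a b : ℝ) : Prop :=
  ∀ t ∈ Icc a b, ∀ t' ∈ Icc a b, |t - t'| ≤ m * |g t - g t'|

theorem sl_of_deriv {g : ℝ → ℝ} (hg : ContDiff ℝ 1 g) {t : ℝ} (ht : deriv g t ≠ 0) {ε : ℝ} (hε : 0 < ε) :
    ∃ (m : ℕ) (α β : ℚ), t - ε < α ∧ (α : ℝ) < t ∧ t < β ∧ (β : ℝ) < t + ε ∧ Sl g m α β := by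
  have hs : HasStrictDerivAt g (deriv g t) t := hg.contDiffAt.hasStrictDerivAt (by norm_num)
  have hc : 0 < |deriv g t| / 2 := by positivity
  have h1 := (hasStrictDerivAt_iff_hasStrictFDerivAt.1 hs).isLittleO.def hc
  rw [Metric.eventually_nhds_iff] at h1
  obtain ⟨δ, hδ, h1⟩ := h1
  have hm : 0 < min δ ε := lt_min hδ hε
  obtain ⟨α, hα1, hα2⟩ := exists_rat_btwn (show t - min δ ε < t by linarith)
  obtain ⟨β, hβ1, hβ2⟩ := exists_rat_btwn (show t < t + min δ ε by linarith)
  obtain ⟨m, hm'⟩ := exists_nat_ge (2 / |deriv g t|)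
  have m1 := min_le_left δ ε
  have m2 := min_le_right δ ε
  refine ⟨m, α, β, by linarith, hα2, hβ1, by linarith, ?_⟩
  intro r hr r' hr'
  have hd : dist (r, r') (t, t) < δ := by
    rw [Prod.dist_eq, max_lt_iff, Real.dist_eq, Real.dist_eq, abs_lt, abs_lt]
    obtain ⟨a1, a2⟩ := hr
    obtain ⟨a3, a4⟩ := hr'
    refine ⟨⟨?_, ?_⟩, ?_, ?_⟩ <;> simp only <;> linarith
  have h2 := h1 hd
  simp only [ContinuousLinearMap.toSpanSingleton_apply, smul_eq_mul, Real.norm_eq_abs] at h2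
  have h3 : |(r - r') * deriv g t| ≤ |g r - g r'| + |g r - g r' - (r - r') * deriv g t| := by
    have := abs_sub (g r - g r') (g r - g r' - (r - r') * deriv g t)
    simpa using this
  rw [abs_mul] at h3
  have h4 : |r - r'| * |deriv g t| ≤ 2 * |g r - g r'| := by linarith
  have hp : 0 < |deriv g t| := by positivity
  rw [← le_div_iff₀ hp] at h4
  refine h4.trans ?_
  rw [mul_comm, mul_div_assoc, mul_comm]
  exact mul_le_mul_of_nonneg_right hm' (abs_nonneg _)

theorem sl_deriv_ne {g : ℝ → ℝ} (hg : Differentiable ℝ g) {m : ℕ} {a b t : ℝ} (h : Sl g m a b) (ht : t ∈ Ioo a b) :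
    deriv g t ≠ 0 := by
  intro h0
  have hd := (hg t).hasDerivAt
  rw [h0] at hd
  have h1 := (hasDerivAt_iff_isLittleO.1 hd).def (show (0 : ℝ) < 1 / (2 * (m + 1)) by positivity)
  have h2 : ∀ᶠ r in 𝓝[>] t, ‖g r - g t - (r - t) • (0 : ℝ)‖ ≤ 1 / (2 * (m + 1)) * ‖r - t‖ :=
    h1.filter_mono nhdsWithin_le_nhds
  obtain ⟨r, hr1, hr2⟩ := (h2.and (Ioo_mem_nhdsGT ht.2)).exists
  have h3 := h r ⟨(ht.1.trans hr2.1).le, hr2.2.le⟩ t ⟨ht.1.le, ht.2.le⟩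
  simp only [smul_zero, sub_zero, Real.norm_eq_abs] at hr1
  have hp : 0 < |r - t| := abs_pos.2 (sub_ne_zero.2 (ne_of_gt hr2.1))
  have hm : (0 : ℝ) ≤ m := Nat.cast_nonneg m
  rw [div_mul_eq_mul_div, le_div_iff₀ (by positivity)] at hr1
  nlinarith [abs_nonneg (g r - g t)]

/-- one dimensional Sard: a nontrivial interval of values cannot consist of critical values -/
theorem sard1 {g : ℝ → ℝ} (hg : ContDiff ℝ 1 g) {t1 t2 : ℝ} (ht : t1 < t2) (hne : g t1 ≠ g t2)
    (hc : ∀ t ∈ Icc t1 t2, ∃ τ, deriv g τ = 0 ∧ g τ = g t) : False := by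
  have hd : Differentiable ℝ g := hg.differentiable (by norm_num)
  have h1 : volume (g '' {τ | deriv g τ = 0}) = 0 := by
    refine addHaar_image_eq_zero_of_det_fderivWithin_eq_zero volume
      (f' := fun τ => fderiv ℝ g τ) (fun τ _ => (hd τ).hasFDerivAt.hasFDerivWithinAt) ?_
    intro τ hτ
    have : fderiv ℝ g τ = 0 := by
      ext
      have hτ' : deriv g τ = 0 := hτ
      simpa using hτ'
    rw [this]
    simp [ContinuousLinearMap.det]
  have h2 : uIcc (g t1) (g t2) ⊆ g '' {τ | deriv g τ = 0} := by
    intro y hy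
    have h3 := intermediate_value_uIcc (hd.continuous.continuousOn (s := uIcc t1 t2)) hy
    obtain ⟨t, ht', rfl⟩ := h3
    rw [uIcc_of_le ht.le] at ht'
    obtain ⟨τ, a1, a2⟩ := hc t ht'
    exact ⟨τ, a1, a2⟩
  have h3 := measure_mono_null h2 h1
  rw [Real.volume_interval, ENNReal.ofReal_eq_zero] at h3
  have := abs_pos.2 (sub_ne_zero.2 hne.symm)
  linarith

open Set MeasureTheory Filter Topology

/-- local data for the observability argument -/
structure Dat {d : ℕ} (x0 : Fin d → ℝ) (r ω : ℝ) (u : Esp d → ℝ) (u1 : Fin d → Esp d → ℝ) : Prop where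
  hr : 0 < r
  hω : 0 < ω
  cu : Continuous u
  c1 : ∀ i, Continuous (u1 i)
  hd : ∀ x ∈ Metric.ball x0 r, ∀ s t : ℝ, (∀ i, u1 i (x, s) = u1 i (x, t)) →
    HasFDerivAt (fun y => u (y, t) - u (y, s)) (0 : (Fin d → ℝ) →L[ℝ] ℝ) x
  ht : ∀ x ∈ Metric.ball x0 r, ContDiff ℝ 1 fun t => u (x, t)
  hper : ∀ x ∈ Metric.ball x0 r, ∀ t, u (x, t + ω) = u (x, t)
  hper1 : ∀ x ∈ Metric.ball x0 r, ∀ i t, u1 i (x, t + ω) = u1 i (x, t)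
  hE : ∀ y ∈ Metric.ball x0 r, ∀ s t : ℝ, (∀ᶠ x in 𝓝 y, u (x, s) = u (x, t)) →
    deriv (fun r => u (y, r)) s = deriv (fun r => u (y, r)) t
  hU : ∀ y ∈ Metric.ball x0 r, ∀ ρ > 0, ∀ a b s : ℝ, a < b →
    (∀ x ∈ Metric.ball y ρ, ∀ t ∈ Ioo a b, u (x, t + s) = u (x, t)) → ∃ n : ℤ, s = n * ω

theorem not_mul {ω s : ℝ} (hω : 0 < ω) (h0 : 0 < s) (h1 : s < ω) {n : ℤ} (h : s = n * ω) : False := by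
  rw [h] at h0 h1
  have a1 : (0 : ℝ) < n := by
    by_contra hh
    have := mul_nonpos_of_nonpos_of_nonneg (not_lt.1 hh) hω.le
    linarith
  have a2 : (n : ℝ) < 1 := by
    by_contra hh
    have := mul_le_mul_of_nonneg_right (not_lt.1 hh) hω.le
    linarith
  have a1' : 0 < n := by exact_mod_cast a1
  have a2' : n < 1 := by exact_mod_cast a2
  omega

/-- mismatch function -/
noncomputable def mu {d : ℕ} (u : Esp d → ℝ) (u1 : Fin d → Esp d → ℝ) (x : Fin d → ℝ) (t τ : ℝ) : ℝ :=
  |u (x, τ) - u (x, t)| + ∑ i, |u1 i (x, τ) - u1 i (x, t)|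

theorem mu_zero {d : ℕ} {u : Esp d → ℝ} {u1 : Fin d → Esp d → ℝ} {x : Fin d → ℝ} {t τ : ℝ} :
    mu u u1 x t τ = 0 ↔ u (x, τ) = u (x, t) ∧ ∀ i, u1 i (x, τ) = u1 i (x, t) := by
  unfold mu
  have h0 : 0 ≤ ∑ i, |u1 i (x, τ) - u1 i (x, t)| := Finset.sum_nonneg fun i _ => abs_nonneg _
  rw [add_eq_zero_iff_of_nonneg (abs_nonneg _) h0, abs_eq_zero, sub_eq_zero,
    Finset.sum_eq_zero_iff_of_nonneg fun i _ => abs_nonneg _]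
  simp [sub_eq_zero]

section
variable {d : ℕ} {x0 : Fin d → ℝ} {r ω : ℝ} {u : Esp d → ℝ} {u1 : Fin d → Esp d → ℝ}

theorem sl_closed (cu : Continuous u) (m : ℕ) (a b : ℝ) : IsClosed {x | Sl (fun t => u (x, t)) m a b} := by
  have : {x | Sl (fun t => u (x, t)) m a b} =
      ⋂ t ∈ Icc a b, ⋂ t' ∈ Icc a b, {x | |t - t'| ≤ m * |u (x, t) - u (x, t')|} := by
    ext x; simp only [Sl, mem_iInter, mem_ofPred_eq]
  rw [this]
  refine isClosed_biInter fun t _ => isClosed_biInter fun t' _ => ?_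
  exact isClosed_le continuous_const (by fun_prop)

theorem Dat.mu_cont (D : Dat x0 r ω u u1) :
    Continuous fun z : ((Fin d → ℝ) × ℝ) × ℝ => mu u u1 z.1.1 z.1.2 z.2 := by
  have := D.cu
  have := D.c1
  unfold mu
  fun_prop

/-- step a: an open set with uniform slope -/
theorem Dat.slope (D : Dat x0 r ω u u1) (t0 : ℝ) {ε : ℝ} (hε : 0 < ε) :
    ∃ (y : Fin d → ℝ) (ρ : ℝ) (m : ℕ) (a b : ℝ), 0 < ρ ∧ Metric.ball y ρ ⊆ Metric.ball x0 r ∧ a < b ∧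
      t0 - ε < a ∧ b < t0 + ε ∧ ∀ x ∈ Metric.ball y ρ, Sl (fun t => u (x, t)) m a b := by
  by_contra hcon
  push Not at hcon
  have cu := D.cu
  -- the complement of the closed sets
  have hconst : ∀ x ∈ Metric.ball x0 r, ∀ t ∈ Ioo (t0 - ε) (t0 + ε), u (x, t) = u (x, t0) := by
    by_contra hne
    push Not at hne
    obtain ⟨x1, hx1, t1, ht1, hne⟩ := hne
    have hO : IsOpen (Metric.ball x0 r ∩ {x | u (x, t1) ≠ u (x, t0)}) :=
      Metric.isOpen_ball.inter (isOpen_ne_fun (by fun_prop) (by fun_prop))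
    have hcl : ∀ k : ℕ × ℚ × ℚ, IsClosed {x | ((k.2.1 : ℝ) < k.2.2 ∧ t0 - ε < k.2.1 ∧ (k.2.2 : ℝ) < t0 + ε) ∧
        Sl (fun t => u (x, t)) k.1 k.2.1 k.2.2} := by
      intro k
      exact (isClosed_const (p := ((k.2.1 : ℝ) < k.2.2 ∧ t0 - ε < k.2.1 ∧ (k.2.2 : ℝ) < t0 + ε))).inter (sl_closed cu _ _ _)
    obtain ⟨k, x, hx, hxi⟩ := baire_open hO ⟨x1, hx1, hne⟩ hcl (by
      rintro x ⟨hx, hxne⟩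
      have hdiff : Differentiable ℝ fun t => u (x, t) := (D.ht x hx).differentiable (by norm_num)
      have : ∃ t ∈ Ioo (t0 - ε) (t0 + ε), deriv (fun t => u (x, t)) t ≠ 0 := by
        by_contra hz
        push Not at hz
        refine hxne ?_
        refine (convex_Ioo (t0 - ε) (t0 + ε)).is_const_of_fderivWithin_eq_zero (𝕜 := ℝ) (f := fun t => u (x, t))
          hdiff.differentiableOn ?_ ht1 ⟨by linarith, by linarith⟩
        intro t ht
        rw [fderivWithin_of_isOpen isOpen_Ioo ht]
        ext
        simpa using hz t ht
      obtain ⟨t, ht, hdt⟩ := this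
      obtain ⟨m, α, β, h1, h2, h3, h4, h5⟩ := sl_of_deriv (D.ht x hx) hdt
        (ε := min (t - (t0 - ε)) (t0 + ε - t)) (lt_min (by linarith [ht.1]) (by linarith [ht.2]))
      have m1 := min_le_left (t - (t0 - ε)) (t0 + ε - t)
      have m2 := min_le_right (t - (t0 - ε)) (t0 + ε - t)
      exact mem_iUnion.2 ⟨(m, α, β), ⟨by linarith, by linarith, by linarith⟩, h5⟩)
    have hxb := hx.1
    obtain ⟨ρ, hρ, hs⟩ := Metric.mem_nhds_iff.1 (Filter.inter_mem (Metric.isOpen_ball.mem_nhds hxb)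
      (mem_interior_iff_mem_nhds.1 hxi))
    have hxk := (hs (Metric.mem_ball_self hρ)).2.1
    obtain ⟨x', hx', hn⟩ := hcon x ρ k.1 k.2.1 k.2.2 hρ (fun x' hx' => (hs hx').1) hxk.1 hxk.2.1 hxk.2.2
    exact hn (hs hx').2.2
  have hs : 0 < min (ε / 2) (ω / 2) := lt_min (by linarith) (by linarith [D.hω])
  have m1 := min_le_left (ε / 2) (ω / 2)
  have m2 := min_le_right (ε / 2) (ω / 2)
  obtain ⟨n, hn⟩ := D.hU x0 (Metric.mem_ball_self D.hr) r D.hr (t0 - ε / 2) t0 (min (ε / 2) (ω / 2)) (by linarith)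
    (fun x hx t ht => by
      obtain ⟨a1, a2⟩ := ht
      rw [hconst x hx (t + min (ε / 2) (ω / 2)) ⟨by linarith, by linarith⟩, hconst x hx t ⟨by linarith, by linarith⟩])
  exact not_mul D.hω hs (by linarith [D.hω]) hn

/-- step c: everything bad implies a uniform family of matches -/
theorem Dat.family (D : Dat x0 r ω u u1) {y : Fin d → ℝ} {ρ : ℝ} {m : ℕ} {a b : ℝ} (hρ : 0 < ρ)
    (hb : Metric.ball y ρ ⊆ Metric.ball x0 r) (hab : a < b)
    (hsl : ∀ x ∈ Metric.ball y ρ, Sl (fun t => u (x, t)) m a b)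
    (hbad : ∀ x ∈ Metric.ball y ρ, ∀ t ∈ Ioo a b, ∃ τ ∈ Icc b (a + ω), mu u u1 x t τ = 0) :
    ∃ (y' : Fin d → ℝ) (ρ' : ℝ) (m' : ℕ) (α β a' b' : ℝ), 0 < ρ' ∧ Metric.ball y' ρ' ⊆ Metric.ball y ρ ∧
      a < a' ∧ a' < b' ∧ b' < b ∧ ∀ x ∈ Metric.ball y' ρ', Sl (fun t => u (x, t)) m' α β ∧
        ∀ t ∈ Icc a' b', ∃ τ ∈ Icc α β ∩ Icc b (a + ω), mu u u1 x t τ = 0 := by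
  have cu := D.cu
  have hcm := D.mu_cont
  have hKc : ∀ α β : ℝ, IsCompact (Icc α β ∩ Icc b (a + ω)) := fun α β => isCompact_Icc.inter isCompact_Icc
  have hcl : ∀ k : (ℕ × ℚ × ℚ) × (ℚ × ℚ), IsClosed {x | (a < k.2.1 ∧ (k.2.1 : ℝ) < k.2.2 ∧ (k.2.2 : ℝ) < b) ∧
      Sl (fun t => u (x, t)) k.1.1 k.1.2.1 k.1.2.2 ∧ ∀ t ∈ Icc (k.2.1 : ℝ) k.2.2,
        ∃ τ ∈ Icc (k.1.2.1 : ℝ) k.1.2.2 ∩ Icc b (a + ω), mu u u1 x t τ = 0} := by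
    intro k
    refine (isClosed_const (p := (a < k.2.1 ∧ (k.2.1 : ℝ) < k.2.2 ∧ (k.2.2 : ℝ) < b))).inter
      ((sl_closed cu _ _ _).inter ?_)
    show IsClosed {x | ∀ t ∈ Icc (k.2.1 : ℝ) k.2.2,
      ∃ τ ∈ Icc (k.1.2.1 : ℝ) k.1.2.2 ∩ Icc b (a + ω), mu u u1 x t τ = 0}
    have : {x | ∀ t ∈ Icc (k.2.1 : ℝ) k.2.2, ∃ τ ∈ Icc (k.1.2.1 : ℝ) k.1.2.2 ∩ Icc b (a + ω), mu u u1 x t τ = 0}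
        = ⋂ t ∈ Icc (k.2.1 : ℝ) k.2.2, {x | ∃ τ ∈ Icc (k.1.2.1 : ℝ) k.1.2.2 ∩ Icc b (a + ω), mu u u1 x t τ = 0} := by
      ext x; simp
    rw [this]
    refine isClosed_biInter fun t _ => ?_
    exact closed_proj (hKc _ _) (h := fun z : (Fin d → ℝ) × ℝ => mu u u1 z.1 t z.2)
      (hcm.comp (f := fun z : (Fin d → ℝ) × ℝ => ((z.1, t), z.2)) (by fun_prop))
  obtain ⟨k, x, hx, hxi⟩ := baire_open Metric.isOpen_ball ⟨y, Metric.mem_ball_self hρ⟩ hcl (by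
    intro x hx
    have hC1 := D.ht x (hb hx)
    have hcd : Continuous (deriv fun t => u (x, t)) := hC1.continuous_deriv (by norm_num)
    have hK0 : IsCompact (Icc b (a + ω) ∩ {τ | deriv (fun t => u (x, t)) τ = 0}) :=
      isCompact_Icc.inter_right (isClosed_eq hcd continuous_const)
    let F : Option (ℕ × ℚ × ℚ) → Set ℝ := fun o => o.elim
      {t | ∃ τ ∈ Icc b (a + ω) ∩ {τ | deriv (fun t => u (x, t)) τ = 0}, u (x, τ) - u (x, t) = 0}
      (fun k => {t | Sl (fun t => u (x, t)) k.1 k.2.1 k.2.2 ∧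
        ∃ τ ∈ Icc (k.2.1 : ℝ) k.2.2 ∩ Icc b (a + ω), mu u u1 x t τ = 0})
    have hF : ∀ o, IsClosed (F o) := by
      rintro (_ | k)
      · exact closed_proj hK0 (h := fun z : ℝ × ℝ => u (x, z.2) - u (x, z.1)) (by fun_prop)
      · refine (isClosed_const (p := Sl (fun t => u (x, t)) k.1 k.2.1 k.2.2)).inter ?_
        exact closed_proj (hKc _ _) (h := fun z : ℝ × ℝ => mu u u1 x z.1 z.2)
          (hcm.comp (f := fun z : ℝ × ℝ => ((x, z.1), z.2)) (by fun_prop))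
    obtain ⟨o, t, ht, hti⟩ := baire_open (isOpen_Ioo (a := a) (b := b)) (nonempty_Ioo.2 hab) hF (by
      intro t ht
      obtain ⟨τ, hτ, hmu⟩ := hbad x hx t ht
      by_cases hz : deriv (fun t => u (x, t)) τ = 0
      · exact mem_iUnion.2 ⟨none, τ, ⟨hτ, hz⟩, sub_eq_zero.2 (mu_zero.1 hmu).1⟩
      · obtain ⟨m', α, β, h1, h2, h3, h4, h5⟩ := sl_of_deriv hC1 hz (ε := 1) one_pos
        exact mem_iUnion.2 ⟨some (m', α, β), h5, τ, ⟨⟨h2.le, h3.le⟩, hτ⟩, hmu⟩)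
    -- a rational interval inside the interior
    obtain ⟨δ, hδ, hs⟩ := Metric.mem_nhds_iff.1 (Filter.inter_mem (isOpen_Ioo.mem_nhds ht)
      (mem_interior_iff_mem_nhds.1 hti))
    obtain ⟨a', ha1, ha2⟩ := exists_rat_btwn (show t - δ < t by linarith)
    obtain ⟨b', hb1, hb2⟩ := exists_rat_btwn (show t < t + δ by linarith)
    have hin : ∀ s ∈ Icc (a' : ℝ) b', s ∈ Ioo a b ∧ s ∈ F o := by
      intro s hs'
      refine hs ?_
      rw [Metric.mem_ball, Real.dist_eq, abs_lt]
      constructor <;> linarith [hs'.1, hs'.2]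
    have hab' : (a' : ℝ) < b' := by linarith
    have hA := (hin a' ⟨le_refl _, hab'.le⟩).1
    have hB := (hin b' ⟨hab'.le, le_refl _⟩).1
    rcases o with _ | k
    · exfalso
      refine sard1 hC1 hab' ?_ ?_
      · intro he
        have h1 := hsl x hx a' ⟨hA.1.le, hA.2.le⟩ b' ⟨hB.1.le, hB.2.le⟩
        simp only [he, sub_self, abs_zero, mul_zero] at h1
        have := abs_nonpos_iff.1 h1
        linarith
      · intro s hs'
        obtain ⟨τ, h1, h2⟩ := (hin s hs').2
        exact ⟨τ, h1.2, sub_eq_zero.1 h2⟩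
    · refine mem_iUnion.2 ⟨(k, (a', b')), ⟨hA.1, hab', hB.2⟩, (hin a' ⟨le_refl _, hab'.le⟩).2.1, ?_⟩
      intro s hs'
      exact (hin s hs').2.2)
  obtain ⟨ρ', hρ', hs⟩ := Metric.mem_nhds_iff.1 (Filter.inter_mem (Metric.isOpen_ball.mem_nhds hx)
    (mem_interior_iff_mem_nhds.1 hxi))
  have hk := (hs (Metric.mem_ball_self hρ')).2.1
  exact ⟨x, ρ', k.1.1, k.1.2.1, k.1.2.2, k.2.1, k.2.2, hρ', fun x' hx' => (hs hx').1, hk.1, hk.2.1, hk.2.2,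
    fun x' hx' => (hs hx').2.2⟩

/-- step d: a uniform family of matches is impossible -/
theorem Dat.rigid (D : Dat x0 r ω u u1) {y : Fin d → ℝ} {ρ : ℝ} {m m' : ℕ} {a b α β a' b' : ℝ} (hρ : 0 < ρ)
    (hb : Metric.ball y ρ ⊆ Metric.ball x0 r) (ha : a < a') (hab' : a' < b') (hb' : b' < b)
    (hsl : Sl (fun t => u (y, t)) m a b)
    (hm : ∀ x ∈ Metric.ball y ρ, Sl (fun t => u (x, t)) m' α β ∧
        ∀ t ∈ Icc a' b', ∃ τ ∈ Icc α β ∩ Icc b (a + ω), mu u u1 x t τ = 0) : False := by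
  have cu := D.cu
  have hyb : y ∈ Metric.ball y ρ := Metric.mem_ball_self hρ
  have hτ : ∀ x ∈ Metric.ball y ρ, ∀ t ∈ Icc a' b', ∃ τ ∈ Icc α β ∩ Icc b (a + ω), mu u u1 x t τ = 0 :=
    fun x hx => (hm x hx).2
  choose! τ hτ1 hτ2 using hτ
  have hτe : ∀ x ∈ Metric.ball y ρ, ∀ t ∈ Icc a' b', u (x, τ x t) = u (x, t) := fun x hx t ht =>
    (mu_zero.1 (hτ2 x hx t ht)).1
  have hτg : ∀ x ∈ Metric.ball y ρ, ∀ t ∈ Icc a' b', ∀ i, u1 i (x, τ x t) = u1 i (x, t) := fun x hx t ht =>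
    (mu_zero.1 (hτ2 x hx t ht)).2
  -- no dependence on x
  have hx : ∀ t ∈ Icc a' b', ∀ x ∈ Metric.ball y ρ, τ x t = τ y t := by
    intro t ht x hx
    have hder : ∀ x ∈ Metric.ball y ρ, HasFDerivAt (fun x => τ x t) (0 : (Fin d → ℝ) →L[ℝ] ℝ) x := by
      intro x hx
      have h1 := D.hd x (hb hx) (τ x t) t (hτg x hx t ht)
      rw [hasFDerivAt_iff_isLittleO] at h1 ⊢
      refine Asymptotics.IsBigO.trans_isLittleO (Asymptotics.IsBigO.of_bound m' ?_) h1
      filter_upwards [Metric.isOpen_ball.mem_nhds hx] with x' hx'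
      have h2 := (hm x' hx').1 _ (hτ1 x' hx' t ht).1 _ (hτ1 x hx t ht).1
      simp only [hτe x' hx' t ht] at h2
      simpa [hτe x hx t ht] using h2
    exact Metric.isOpen_ball.is_const_of_fderiv_eq_zero (𝕜 := ℝ) (convex_ball y ρ).isPreconnected
      (f := fun x => τ x t) (fun x hx => (hder x hx).differentiableAt.differentiableWithinAt)
      (fun x hx => (hder x hx).fderiv) hx hyb
  have hall : ∀ t ∈ Icc a' b', ∀ x ∈ Metric.ball y ρ, u (x, τ y t) = u (x, t) := by
    intro t ht x hx'
    rw [← hx t ht x hx']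
    exact hτe x hx' t ht
  have hdiff : Differentiable ℝ fun t => u (y, t) := (D.ht y (hb hyb)).differentiable (by norm_num)
  have hdt : ∀ t ∈ Ioo a' b', HasDerivAt (fun t => τ y t) 1 t := by
    intro t ht
    have ht' : t ∈ Icc a' b' := ⟨ht.1.le, ht.2.le⟩
    have hne : deriv (fun t => u (y, t)) t ≠ 0 := sl_deriv_ne hdiff hsl ⟨by linarith [ht.1], by linarith [ht.2]⟩
    have he : deriv (fun t => u (y, t)) (τ y t) = deriv (fun t => u (y, t)) t := by
      refine D.hE y (hb hyb) _ _ ?_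
      filter_upwards [Metric.isOpen_ball.mem_nhds hyb] with x hx'
      exact hall t ht' x hx'
    have hev : ∀ᶠ t' in 𝓝 t, t' ∈ Icc a' b' := Filter.mem_of_superset (isOpen_Ioo.mem_nhds ht) Ioo_subset_Icc_self
    have d1 := (hdiff t).hasDerivAt
    have d2 := (hdiff (τ y t)).hasDerivAt
    rw [he] at d2
    -- Lipschitz bound for τ
    have hO : (fun t' => τ y t' - τ y t) =O[𝓝 t] fun t' => t' - t := by
      refine Asymptotics.IsBigO.trans (Asymptotics.IsBigO.of_bound m' ?_) d1.isBigO_sub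
      filter_upwards [hev] with t' ht2
      have h2 := (hm y hyb).1 _ (hτ1 y hyb t' ht2).1 _ (hτ1 y hyb t ht').1
      simp only [hτe y hyb t' ht2, hτe y hyb t ht'] at h2
      simpa using h2
    have hcont : Tendsto (fun t' => τ y t') (𝓝 t) (𝓝 (τ y t)) := by
      rw [← tendsto_sub_nhds_zero_iff]
      refine hO.trans_tendsto ?_
      have : Tendsto (fun t' : ℝ => t' - t) (𝓝 t) (𝓝 (t - t)) := tendsto_id.sub_const t
      simpa using this
    rw [hasDerivAt_iff_isLittleO] at d1 d2 ⊢
    have l2 := (d2.comp_tendsto hcont).trans_isBigO hO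
    have l3 := (d1.sub l2).const_mul_left (deriv (fun t => u (y, t)) t)⁻¹
    refine l3.congr' ?_ (Eventually.of_forall fun _ => rfl)
    filter_upwards [hev] with t' ht2
    simp only [Function.comp_apply, hτe y hyb t' ht2, hτe y hyb t ht', smul_eq_mul]
    field_simp
    ring
  have hconst : ∀ t ∈ Ioo a' b', τ y t - t = τ y ((a' + b') / 2) - (a' + b') / 2 := by
    intro t ht
    have hd2 : ∀ t ∈ Ioo a' b', HasFDerivAt (fun t => τ y t - t) (0 : ℝ →L[ℝ] ℝ) t := by
      intro t ht
      have := ((hdt t ht).sub (hasDerivAt_id t)).hasFDerivAt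
      simp only [sub_self] at this
      refine this.congr_fderiv ?_
      ext; simp
    exact isOpen_Ioo.is_const_of_fderiv_eq_zero (𝕜 := ℝ) (convex_Ioo a' b').isPreconnected
      (f := fun t => τ y t - t) (fun t ht => (hd2 t ht).differentiableAt.differentiableWithinAt)
      (fun t ht => (hd2 t ht).fderiv) ht ⟨by linarith, by linarith⟩
  obtain ⟨s, hs⟩ : ∃ s, s = τ y ((a' + b') / 2) - (a' + b') / 2 := ⟨_, rfl⟩
  rw [← hs] at hconst
  have hI := (hτ1 y hyb ((a' + b') / 2) ⟨by linarith, by linarith⟩).2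
  obtain ⟨n, hn⟩ := D.hU y (hb hyb) ρ hρ a' b' s hab' (fun x hx' t ht => by
    have := hconst t ht
    rw [show t + s = τ y t by linarith]
    exact hall t ⟨ht.1.le, ht.2.le⟩ x hx')
  exact not_mul D.hω (by linarith [hI.1]) (by linarith [hI.2]) hn

theorem Dat.main (D : Dat x0 r ω u u1) (t0 : ℝ) {ε : ℝ} (hε : 0 < ε) :
    ∃ V : Set (Esp d), IsOpen V ∧ V.Nonempty ∧ V ⊆ Metric.ball x0 r ×ˢ Ioo (t0 - ε) (t0 + ε) ∧ ∀ z ∈ V,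
      deriv (fun t => u (z.1, t)) z.2 ≠ 0 ∧
      ∀ t, (u (z.1, t) = u (z.1, z.2) ∧ ∀ i, u1 i (z.1, t) = u1 i (z.1, z.2)) → ∃ n : ℤ, t = z.2 + n * ω := by
  have hω := D.hω
  obtain ⟨y, ρ, m, a, b, hρ, hb, hab, ha, hb2, hsl⟩ := D.slope t0 hε
  by_cases hbad : ∀ x ∈ Metric.ball y ρ, ∀ t ∈ Ioo a b, ∃ τ ∈ Icc b (a + ω), mu u u1 x t τ = 0
  · exfalso
    obtain ⟨y', ρ', m', α, β, a', b', h1, h2, h3, h4, h5, h6⟩ := D.family hρ hb hab hsl hbad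
    exact D.rigid h1 (h2.trans hb) h3 h4 h5 (hsl y' (h2 (Metric.mem_ball_self h1))) h6
  push Not at hbad
  obtain ⟨x, hx, t, ht, hnb⟩ := hbad
  have hcl : IsClosed {z : Esp d | ∃ τ ∈ Icc b (a + ω), mu u u1 z.1 z.2 τ = 0} :=
    closed_proj isCompact_Icc (h := fun z : Esp d × ℝ => mu u u1 z.1.1 z.1.2 z.2) D.mu_cont
  refine ⟨(Metric.ball y ρ ×ˢ Ioo a b) ∩ {z : Esp d | ∃ τ ∈ Icc b (a + ω), mu u u1 z.1 z.2 τ = 0}ᶜ,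
    (Metric.isOpen_ball.prod isOpen_Ioo).inter hcl.isOpen_compl, ⟨(x, t), ⟨hx, ht⟩, ?_⟩, ?_, ?_⟩
  · rintro ⟨τ, h1, h2⟩
    exact hnb τ h1 h2
  · rintro z ⟨⟨h1, h2⟩, -⟩
    exact ⟨hb h1, by linarith [h2.1], by linarith [h2.2]⟩
  · rintro ⟨x, t⟩ ⟨⟨hx, ht⟩, hnb⟩
    simp only at hx ht ⊢
    refine ⟨sl_deriv_ne ((D.ht x (hb hx)).differentiable (by norm_num)) (hsl x hx) ht, ?_⟩
    rintro t' ⟨h1, h2⟩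
    obtain ⟨k, hk1, hk2⟩ : ∃ k : ℤ, a ≤ t' + k * ω ∧ t' + k * ω < a + ω := by
      refine ⟨-⌊(t' - a) / ω⌋, ?_⟩
      have f1 := Int.floor_le ((t' - a) / ω)
      have f2 := Int.lt_floor_add_one ((t' - a) / ω)
      rw [le_div_iff₀ hω] at f1
      rw [div_lt_iff₀ hω] at f2
      push_cast
      constructor <;> nlinarith
    have p1 : u (x, t' + k * ω) = u (x, t') :=
      Function.Periodic.int_mul (f := fun t => u (x, t)) (c := ω) (D.hper x (hb hx)) k t'
    have p2 : ∀ i, u1 i (x, t' + k * ω) = u1 i (x, t') := fun i =>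
      Function.Periodic.int_mul (f := fun t => u1 i (x, t)) (c := ω) (D.hper1 x (hb hx) i) k t'
    by_cases hle : t' + k * ω ≤ b
    · have h3 := hsl x hx (t' + k * ω) ⟨hk1, hle⟩ t ⟨ht.1.le, ht.2.le⟩
      simp only [p1, h1, sub_self, abs_zero, mul_zero] at h3
      have := sub_eq_zero.1 (abs_nonpos_iff.1 h3)
      refine ⟨-k, ?_⟩
      push_cast
      linarith
    · exact absurd ⟨t' + k * ω, ⟨(not_le.1 hle).le, hk2.le⟩, mu_zero.2 ⟨p1.trans h1, fun i => (p2 i).trans (h2 i)⟩⟩ hnb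
end

open Set MeasureTheory Filter Topology

theorem lap_ev {d : ℕ} {χ χ' : (Fin d → ℝ) → ℝ} {x : Fin d → ℝ} (h : χ =ᶠ[𝓝 x] χ') :
    lap χ x = lap χ' x := by
  unfold lap
  exact Finset.sum_congr rfl fun i _ => (pd_ev (pd_ev h i) i).eq_of_nhds

theorem Per.dat {d : ℕ} {Ω : Set (Fin d → ℝ)} {f : ((Fin d → ℝ) × ℝ × (Fin d → ℝ)) → ℝ}
    {p : (Fin d → ℝ) → ℝ → ℝ} {ω R : ℝ} (h : Per Ω f p ω R) (hU : Uq Ω p ω)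
    {x0 : Fin d → ℝ} {r : ℝ} (hr : 0 < r) (hb : Metric.closedBall x0 (6 * r) ⊆ Ω) :
    ∃ (u : Esp d → ℝ) (u1 : Fin d → Esp d → ℝ), Dat x0 r ω u u1 ∧
      ∀ x ∈ Metric.ball x0 r, ∀ t, u (x, t) = p x t ∧ ∀ i, u1 i (x, t) = pd i (fun y => p y t) x := by
  obtain ⟨N, R', C, L, u, u1, u2, ut, G, hS, hc1, -, -, -, -, hL⟩ := h.loc hr hb
  have hu : ∀ x ∈ Metric.ball x0 r, ∀ t, u (x, t) = p x t := fun x hx t => (hL x hx t).1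
  have hu1 : ∀ x ∈ Metric.ball x0 r, ∀ t i, u1 i (x, t) = pd i (fun y => p y t) x :=
    fun x hx t => (hL x hx t).2.1
  have hsub : Metric.ball x0 r ⊆ Ω := fun x hx => hb (by
    have := Metric.mem_ball.1 hx
    exact Metric.mem_closedBall.2 (by linarith))
  have hnh : ∀ x ∈ Metric.ball x0 r, Metric.ball x0 r ∈ 𝓝 x := fun x hx => Metric.isOpen_ball.mem_nhds hx
  have hfu : ∀ x ∈ Metric.ball x0 r, (fun t => u (x, t)) = p x := fun x hx => funext fun t => hu x hx t
  refine ⟨u, u1, ⟨hr, h.hω, hS.hc, hc1, ?_, ?_, ?_, ?_, ?_, ?_⟩, fun x hx t => ⟨hu x hx t, hu1 x hx t⟩⟩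
  · intro x hx s t hst
    have hdf : ∀ t, HasFDerivAt (fun y => p y t) (fderiv ℝ (fun y => p y t) x) x := fun t =>
      (((h.hpx t).contDiffAt (h.hΩo.mem_nhds (hsub hx))).differentiableAt (by norm_num)).hasFDerivAt
    have heq : fderiv ℝ (fun y => p y t) x = fderiv ℝ (fun y => p y s) x := by
      apply ContinuousLinearMap.coe_injective
      refine LinearMap.pi_ext' fun i => LinearMap.ext_ring ?_
      have := hst i
      rw [hu1 x hx, hu1 x hx] at this
      simpa [pd] using this.symm
    have h1 := (hdf t).sub (hdf s)
    rw [heq, sub_self] at h1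
    refine h1.congr_of_eventuallyEq ?_
    filter_upwards [hnh x hx] with y hy
    simp [hu y hy]
  · intro x hx
    rw [hfu x hx]
    exact h.hpt x (hsub hx)
  · intro x hx t
    rw [hu x hx, hu x hx]
    exact h.hper x (subset_closure (hsub hx)) t
  · intro x hx i t
    rw [hu1 x hx, hu1 x hx]
    refine (pd_ev ?_ i).eq_of_nhds
    filter_upwards [hnh x hx] with y hy
    exact h.hper y (subset_closure (hsub hy)) t
  · intro y hy s t hst
    rw [hfu y hy, h.hpeq y (hsub hy), h.hpeq y (hsub hy)]
    have hev : (fun x => p x s) =ᶠ[𝓝 y] fun x => p x t := by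
      filter_upwards [hnh y hy, hst] with x hx hxe
      rwa [hu x hx, hu x hx] at hxe
    have e1 : p y s = p y t := hev.eq_of_nhds
    have e2 : (fun i => pd i (fun x => p x s) y) = fun i => pd i (fun x => p x t) y :=
      funext fun i => (pd_ev hev i).eq_of_nhds
    rw [lap_ev hev, e1, e2]
  · intro y hy ρ hρ a b s hab hs
    obtain ⟨ε, hε, hε'⟩ := Metric.mem_nhds_iff.1 (hnh y hy)
    refine hU y (hsub hy) (min ρ ε) (lt_min hρ hε) a b s hab fun x hx t ht => ?_
    have hx1 : x ∈ Metric.ball x0 r := hε' (Metric.ball_subset_ball (min_le_right _ _) hx)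
    have := hs x (Metric.ball_subset_ball (min_le_left _ _) hx) t ht
    rwa [hu x hx1, hu x hx1] at this

open Set MeasureTheory Filter Topology

/-- Proposition `prop-1to1-per` / Theorem `th-1to1-intro2`:
pointwise observability of the period of a periodic orbit. -/
theorem periodic_orbit_pointwise_observability
    (d : ℕ) (hd : 2 ≤ d) (γ : NNReal) (hγ0 : 0 < γ) (hγ1 : γ ≤ 1)
    (Ω : Set (Fin d → ℝ)) (hΩo : IsOpen Ω) (hΩc : IsConnected Ω)
    (hΩb : Bornology.IsBounded Ω) (hΩreg : HasC2HolderBoundary Ω γ)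
    (f : ((Fin d → ℝ) × ℝ × (Fin d → ℝ)) → ℝ)
    (hf : ContDiffOn ℝ (⊤ : ℕ∞) f
      (closure Ω ×ˢ ((univ : Set ℝ) ×ˢ (univ : Set (Fin d → ℝ)))))
    (p : (Fin d → ℝ) → ℝ → ℝ)
    -- `p` is a classical solution of the parabolic equation
    (hpc : ContinuousOn (fun q : (Fin d → ℝ) × ℝ => p q.1 q.2)
      (closure Ω ×ˢ (univ : Set ℝ)))
    (hpx : ∀ t : ℝ, ContDiffOn ℝ 2 (fun x => p x t) Ω)
    (hpt : ∀ x ∈ Ω, ContDiff ℝ 1 (p x))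
    (hpeq : ∀ x ∈ Ω, ∀ t : ℝ,
      deriv (p x) t = lap (fun y => p y t) x
        + f (x, p x t, fun i => pd i (fun y => p y t) x))
    (hpbc : ∀ x ∈ frontier Ω, ∀ t : ℝ, p x t = 0)
    -- `p` is periodic with minimal period `ω > 0`
    (ω : ℝ) (hω : 0 < ω)
    (hper : ∀ x ∈ closure Ω, ∀ t : ℝ, p x (t + ω) = p x t)
    (hmin : ∀ ω' : ℝ, 0 < ω' → (∀ x ∈ closure Ω, ∀ t : ℝ, p x (t + ω') = p x t) → ω ≤ ω')
    -- `p` and `∇p` are uniformly bounded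
    (hbnd : ∃ R : ℝ, ∀ x ∈ Ω, ∀ t : ℝ, |p x t| ≤ R ∧ ∀ i, |pd i (fun y => p y t) x| ≤ R) :
    ∃ D : Set ((Fin d → ℝ) × ℝ), IsOpen D ∧ D ⊆ Ω ×ˢ (univ : Set ℝ) ∧
      Ω ×ˢ (univ : Set ℝ) ⊆ closure D ∧
      ∀ q ∈ D,
        (¬ (deriv (p q.1) q.2 = 0 ∧ ∀ i, pd i (fun y => deriv (p y) q.2) q.1 = 0)) ∧
        ∀ t : ℝ, (p q.1 t = p q.1 q.2 ∧
            ∀ i, pd i (fun y => p y t) q.1 = pd i (fun y => p y q.2) q.1) →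
          ∃ n : ℤ, t = q.2 + n * ω := by
  obtain ⟨R, hR⟩ := hbnd
  have h : Per Ω f p ω R := ⟨hΩo, hf, hpc, hpx, hpt, hpeq, hω, hper, hR⟩
  have hU := h.uq hΩb hΩc.isPreconnected hpbc hmin
  set Good : Set ((Fin d → ℝ) × ℝ) := {q | q.1 ∈ Ω ∧
    (¬ (deriv (p q.1) q.2 = 0 ∧ ∀ i, pd i (fun y => deriv (p y) q.2) q.1 = 0)) ∧
        ∀ t : ℝ, (p q.1 t = p q.1 q.2 ∧
            ∀ i, pd i (fun y => p y t) q.1 = pd i (fun y => p y q.2) q.1) →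
          ∃ n : ℤ, t = q.2 + n * ω} with hGood
  refine ⟨interior Good, isOpen_interior, fun q hq => ⟨(interior_subset hq).1, mem_univ _⟩, ?_,
    fun q hq => (interior_subset hq).2⟩
  rintro ⟨x, t⟩ ⟨hx, -⟩
  rw [Metric.mem_closure_iff]
  intro ε hε
  obtain ⟨δ, hδ, hδ'⟩ := Metric.mem_nhds_iff.1 (hΩo.mem_nhds hx)
  have hr : 0 < min (δ / 7) ε := lt_min (by positivity) hε
  have hb : Metric.closedBall x (6 * min (δ / 7) ε) ⊆ Ω := by
    refine Subset.trans (fun y hy => ?_) hδ'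
    have h1 := Metric.mem_closedBall.1 hy
    have h2 := min_le_left (δ / 7) ε
    exact Metric.mem_ball.2 (by linarith)
  have hsub : Metric.ball x (min (δ / 7) ε) ⊆ Ω := fun y hy => hb (by
    have := Metric.mem_ball.1 hy
    exact Metric.mem_closedBall.2 (by linarith))
  obtain ⟨u, u1, D, hu⟩ := h.dat hU hr hb
  obtain ⟨V, hVo, ⟨q, hq⟩, hVs, hV⟩ := D.main t hε
  have hVG : V ⊆ Good := by
    intro z hz
    have hz1 := (hVs hz).1
    obtain ⟨g1, g2⟩ := hV z hz
    refine ⟨hsub hz1, fun hn => g1 ?_, fun t' ht' => g2 t' ?_⟩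
    · have : (fun t => u (z.1, t)) = p z.1 := funext fun t => (hu z.1 hz1 t).1
      rw [this]
      exact hn.1
    · refine ⟨?_, fun i => ?_⟩
      · rw [(hu z.1 hz1 t').1, (hu z.1 hz1 z.2).1]
        exact ht'.1
      · rw [(hu z.1 hz1 t').2, (hu z.1 hz1 z.2).2]
        exact ht'.2 i
  refine ⟨q, interior_maximal hVG hVo hq, ?_⟩
  obtain ⟨q1, q2⟩ := hVs hq
  rw [dist_comm, Prod.dist_eq]
  refine max_lt (lt_of_lt_of_le (Metric.mem_ball.1 q1) (min_le_right _ _)) ?_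
  rw [Real.dist_eq, abs_lt]
  constructor <;> linarith [q2.1, q2.2]
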